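/- Let 0 < γ < (2+α)/(2−α) and let g : ∂B → ℝ be continuous, nonnegative and not identically zero. Then problem (P_g) admits exactly one solution. -/

import Mathlib

open MeasureTheory Real Filter Topology Metric Set

noncomputable section

abbrev EN (N : ℕ) := EuclideanSpace ℝ (Fin N)

/-- The normalizing constant `c_{N,α}` of the fractional Laplacian. -/
def fracLapCoeff (N : ℕ) (α : ℝ) : ℝ :=
  2 ^ α * Real.pi ^ (-(N : ℝ) / 2) * Real.Gamma (((N : ℝ) + α) / 2) / |Real.Gamma (-α / 2)|

/-- `HasFracLap N α u x L` means the principal-value limit defining `Δ^{α/2} u (x)` exists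
and equals `L`. -/
def HasFracLap (N : ℕ) (α : ℝ) (u : EN N → ℝ) (x : EN N) (L : ℝ) : Prop :=
  Tendsto (fun ε : ℝ =>
      fracLapCoeff N α * ∫ y in {y : EN N | ε < dist y x}, (u y - u x) / dist y x ^ ((N : ℝ) + α))
    (𝓝[>] (0 : ℝ)) (𝓝 L)

/-- The value of the fractional Laplacian at `x` (junk value `0` where the limit fails). -/
def fracLap (N : ℕ) (α : ℝ) (u : EN N → ℝ) (x : EN N) : ℝ :=
  haveI := Classical.propDecidable (∃ L, HasFracLap N α u x L)
  if h : ∃ L, HasFracLap N α u x L then h.choose else 0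

/-- The weighted space `𝓛_α`. -/
def memLalpha (N : ℕ) (α : ℝ) (u : EN N → ℝ) : Prop :=
  Integrable (fun y : EN N => u y * (1 + ‖y‖) ^ (-((N : ℝ) + α)))

/-- `δ(x) = 1 - |x|` on the unit ball, `0` outside. -/
def delta1 {N : ℕ} (x : EN N) : ℝ := if ‖x‖ < 1 then 1 - ‖x‖ else 0

/-- The constant `κ_{N,α}`. -/
def greenCoeff (N : ℕ) (α : ℝ) : ℝ :=
  Real.Gamma ((N : ℝ) / 2) / (2 ^ α * Real.pi ^ ((N : ℝ) / 2) * Real.Gamma (α / 2) ^ 2)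

/-- The Green function of the unit ball. -/
def greenB (N : ℕ) (α : ℝ) (x y : EN N) : ℝ :=
  if ‖x‖ < 1 ∧ ‖y‖ < 1 then
    greenCoeff N α * ‖x - y‖ ^ (α - (N : ℝ)) *
      ∫ s in (0:ℝ)..((1 - ‖x‖ ^ 2) * (1 - ‖y‖ ^ 2) / ‖x - y‖ ^ 2),
        s ^ (α / 2 - 1) * (1 + s) ^ (-(N : ℝ) / 2)
  else 0

/-- The Green function of the ball `B(a,r)`, by scaling. -/
def greenBall (N : ℕ) (α : ℝ) (a : EN N) (r : ℝ) (x y : EN N) : ℝ :=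
  r ^ (α - (N : ℝ)) * greenB N α (r⁻¹ • (x - a)) (r⁻¹ • (y - a))

/-- The constant `c_α^N` of the Poisson kernel. -/
def poissonCoeff (N : ℕ) (α : ℝ) : ℝ :=
  Real.pi ^ (-1 - (N : ℝ) / 2) * Real.Gamma ((N : ℝ) / 2) * Real.sin (Real.pi * α / 2)

/-- The Poisson kernel of the ball `B(a,r)`. -/
def poissonBall (N : ℕ) (α : ℝ) (a : EN N) (r : ℝ) (x y : EN N) : ℝ :=
  poissonCoeff N α * ((r ^ 2 - ‖x - a‖ ^ 2) / (‖y - a‖ ^ 2 - r ^ 2)) ^ (α / 2) *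
    ‖x - y‖ ^ (-(N : ℝ))

/-- The harmonic-measure operator `H^α_{B(a,r)} f`. -/
def Hball (N : ℕ) (α : ℝ) (a : EN N) (r : ℝ) (f : EN N → ℝ) (x : EN N) : ℝ :=
  ∫ y in {y : EN N | r < ‖y - a‖}, poissonBall N α a r x y * f y

/-- Solution (in the distributional sense) of `Δ^{α/2} u = u^γ` in the open set `U`. -/
def IsSolution (N : ℕ) (α γ : ℝ) (U : Set (EN N)) (u : EN N → ℝ) : Prop :=
  (∀ x, 0 ≤ u x) ∧ ContinuousOn u U ∧ memLalpha N α u ∧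
    ∀ φ : EN N → ℝ, ContDiff ℝ (⊤ : ℕ∞) φ → HasCompactSupport φ → tsupport φ ⊆ U →
      (∀ x, 0 ≤ φ x) →
        ∫ x, u x * fracLap N α φ x = ∫ x, u x ^ γ * φ x

/-- The surface measure `σ` on the unit sphere. -/
def sphereMeasure (N : ℕ) : Measure (Metric.sphere (0 : EN N) 1) :=
  (volume : Measure (EN N)).toSphere

/-- The Martin integral `M_B^α g`. -/
def martinB (N : ℕ) (α : ℝ) (g : Metric.sphere (0 : EN N) 1 → ℝ) (x : EN N) : ℝ :=
  if ‖x‖ < 1 then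
    ∫ y, (1 - ‖x‖ ^ 2) ^ (α / 2) * ‖x - (y : EN N)‖ ^ (-(N : ℝ)) * g y ∂(sphereMeasure N)
  else 0

/-- Solution of the moderate blow-up problem `(P_g)`. -/
def IsSolutionPg (N : ℕ) (α γ : ℝ) (g : Metric.sphere (0 : EN N) 1 → ℝ) (u : EN N → ℝ) : Prop :=
  (∀ x, 0 ≤ u x) ∧ memLalpha N α u ∧ (∀ x : EN N, ¬ ‖x‖ < 1 → u x = 0) ∧
    IsSolution N α γ (Metric.ball (0 : EN N) 1) u ∧
    ∀ z : Metric.sphere (0 : EN N) 1,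
      Tendsto (fun x => delta1 x ^ (1 - α / 2) * u x)
        (𝓝[Metric.ball (0 : EN N) 1] (z : EN N)) (𝓝 (g z))

/-- Solution of the blow-up problem `(P_∞)`. -/
def IsSolutionPinf (N : ℕ) (α γ : ℝ) (u : EN N → ℝ) : Prop :=
  (∀ x, 0 ≤ u x) ∧ memLalpha N α u ∧ (∀ x : EN N, ¬ ‖x‖ < 1 → u x = 0) ∧
    IsSolution N α γ (Metric.ball (0 : EN N) 1) u ∧
    ∀ z : Metric.sphere (0 : EN N) 1,
      Tendsto (fun x => delta1 x ^ (1 - α / 2) * u x)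
        (𝓝[Metric.ball (0 : EN N) 1] (z : EN N)) atTop


/-- The truncated kernel `|z|^{-N-α} 1_{|z|>ε}`. -/
def kJ (N : ℕ) (α ε : ℝ) (z : EN N) : ℝ :=
  if ε < ‖z‖ then ‖z‖ ^ (-((N : ℝ) + α)) else 0

/-- The truncated fractional Laplacian. -/
def Leps (N : ℕ) (α ε : ℝ) (u : EN N → ℝ) (x : EN N) : ℝ :=
  fracLapCoeff N α * ∫ z, kJ N α ε z * (u (x + z) - u x)

/-- An integrable dominating function. -/
def domJ (N : ℕ) (α : ℝ) (z : EN N) : ℝ :=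
  min (‖z‖ ^ 2) 1 * ‖z‖ ^ (-((N : ℝ) + α))

lemma coeff_pos {N : ℕ} {α : ℝ} (hα0 : 0 < α) (hα2 : α < 2) : 0 < fracLapCoeff N α := by
  unfold fracLapCoeff
  have h1 : Real.Gamma (-α / 2) ≠ 0 := by
    apply Real.Gamma_ne_zero
    intro m hm
    rcases Nat.eq_zero_or_pos m with h | h
    · subst h; simp at hm; linarith
    · have : (1 : ℝ) ≤ m := by exact_mod_cast h
      linarith
  have h2 : 0 < Real.Gamma (((N : ℝ) + α) / 2) := by
    apply Real.Gamma_pos_of_pos; positivity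
  have := Real.pi_pos
  positivity

lemma domJ_integrable {N : ℕ} (hN : 3 ≤ N) {α : ℝ} (hα0 : 0 < α) (hα2 : α < 2) :
    Integrable (domJ N α) := by
  have : Nonempty (Fin N) := ⟨⟨0, by omega⟩⟩
  have h := (integrable_fun_norm_addHaar (volume : Measure (EN N))
    (f := fun r : ℝ => min (r ^ 2) 1 * r ^ (-((N : ℝ) + α)))).2
  refine h ?_
  have hd : Module.finrank ℝ (EN N) = N := by simp
  rw [hd]
  have hcast : ((N - 1 : ℕ) : ℝ) = (N : ℝ) - 1 := by
    rw [Nat.cast_sub (by omega)]; simp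
  have hmeas : ∀ s : Set ℝ, AEStronglyMeasurable
      (fun y : ℝ => y ^ (N - 1) • (min (y ^ 2) 1 * y ^ (-((N : ℝ) + α)))) (volume.restrict s) := by
    intro s
    have : Measurable (fun y : ℝ => y ^ (N - 1) • (min (y ^ 2) 1 * y ^ (-((N : ℝ) + α)))) := by
      fun_prop
    exact this.aestronglyMeasurable
  rw [← Ioc_union_Ioi_eq_Ioi (zero_le_one' ℝ)]
  refine IntegrableOn.union ?_ ?_
  · have h1 : IntegrableOn (fun y : ℝ => y ^ (1 - α)) (Ioc 0 1) := by
      have := intervalIntegral.intervalIntegrable_rpow' (a := 0) (b := 1) (r := 1 - α) (by linarith)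
      exact (intervalIntegrable_iff_integrableOn_Ioc_of_le zero_le_one).1 this
    refine Integrable.mono' h1 (hmeas _) ?_
    refine (ae_restrict_mem measurableSet_Ioc).mono fun y hy => ?_
    have hy0 : 0 < y := hy.1
    rw [smul_eq_mul, Real.norm_of_nonneg (by positivity)]
    calc y ^ (N - 1) * (min (y ^ 2) 1 * y ^ (-((N : ℝ) + α)))
        ≤ y ^ (N - 1) * (y ^ 2 * y ^ (-((N : ℝ) + α))) := by
          gcongr; exact min_le_left _ _
      _ = y ^ (1 - α) := by
          rw [← Real.rpow_natCast, hcast, ← Real.rpow_natCast, ← Real.rpow_add hy0,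
            ← Real.rpow_add hy0]
          congr 1; push_cast; ring
  · have h1 : IntegrableOn (fun y : ℝ => y ^ (-1 - α)) (Ioi 1) :=
      integrableOn_Ioi_rpow_of_lt (by linarith) zero_lt_one
    refine Integrable.mono' h1 (hmeas _) ?_
    refine (ae_restrict_mem measurableSet_Ioi).mono fun y hy => ?_
    have hy0 : 0 < y := lt_trans zero_lt_one hy
    rw [smul_eq_mul, Real.norm_of_nonneg (by positivity)]
    calc y ^ (N - 1) * (min (y ^ 2) 1 * y ^ (-((N : ℝ) + α)))
        ≤ y ^ (N - 1) * (1 * y ^ (-((N : ℝ) + α))) := by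
          gcongr; exact min_le_right _ _
      _ = y ^ (-1 - α) := by
          rw [← Real.rpow_natCast, hcast, one_mul, ← Real.rpow_add hy0]
          congr 1; ring

lemma domJ_nonneg {N : ℕ} {α : ℝ} (z : EN N) : 0 ≤ domJ N α z := by
  unfold domJ; positivity

lemma kJ_nonneg {N : ℕ} {α ε : ℝ} (z : EN N) : 0 ≤ kJ N α ε z := by
  unfold kJ; split_ifs <;> positivity

lemma kJ_neg {N : ℕ} {α ε : ℝ} (z : EN N) : kJ N α ε (-z) = kJ N α ε z := by
  unfold kJ; simp

lemma kJ_measurable {N : ℕ} {α ε : ℝ} : Measurable (kJ N α ε) := by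
  unfold kJ
  refine Measurable.ite (measurableSet_lt measurable_const measurable_norm) ?_ measurable_const
  fun_prop

lemma kJ_le {N : ℕ} {α ε : ℝ} (hα0 : 0 < α) (hε : 0 < ε) (z : EN N) :
    kJ N α ε z ≤ ε ^ (-((N : ℝ) + α)) := by
  unfold kJ
  split_ifs with h
  · exact Real.rpow_le_rpow_of_nonpos hε h.le (by have : (0:ℝ) ≤ N := by positivity
                                                  linarith)
  · positivity

lemma kJ_le_dom {N : ℕ} {α ε : ℝ} (hε : 0 < ε) (hε1 : ε ≤ 1) (z : EN N) :
    kJ N α ε z ≤ (ε ^ 2)⁻¹ * domJ N α z := by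
  unfold kJ domJ
  split_ifs with h
  · rw [← mul_assoc]
    refine le_mul_of_one_le_left (by positivity) ?_
    rw [inv_mul_eq_div, le_div_iff₀ (by positivity), one_mul]
    refine le_min ?_ ?_
    · gcongr
    · exact pow_le_one₀ hε.le hε1
  · positivity

lemma kJ_integrable {N : ℕ} (hN : 3 ≤ N) {α ε : ℝ} (hα0 : 0 < α) (hα2 : α < 2)
    (hε : 0 < ε) : Integrable (kJ N α ε) := by
  have h1 : Integrable (kJ N α (min ε 1)) := by
    refine Integrable.mono' ((domJ_integrable hN hα0 hα2).const_mul ((min ε 1) ^ 2)⁻¹)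
      kJ_measurable.aestronglyMeasurable (Eventually.of_forall fun z => ?_)
    rw [Real.norm_of_nonneg (kJ_nonneg z)]
    exact kJ_le_dom (lt_min hε one_pos) (min_le_right _ _) z
  refine Integrable.mono' h1 kJ_measurable.aestronglyMeasurable (Eventually.of_forall fun z => ?_)
  rw [Real.norm_of_nonneg (kJ_nonneg z)]
  unfold kJ
  split_ifs with h h' h'
  · exact le_rfl
  · exact absurd (lt_of_le_of_lt (min_le_left _ _) h) h'
  · positivity
  · exact le_rfl

lemma kJ_mul_integrable {N : ℕ} {α ε : ℝ} (hα0 : 0 < α)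
    (hε : 0 < ε) {u : EN N → ℝ} (hu : Integrable u) :
    Integrable (fun z => kJ N α ε z * u z) := by
  refine hu.bdd_mul (c := ε ^ (-((N : ℝ) + α))) kJ_measurable.aestronglyMeasurable
    (Eventually.of_forall fun z => ?_)
  rw [Real.norm_of_nonneg (kJ_nonneg z)]
  exact kJ_le hα0 hε z

lemma kJ_shift_integrable {N : ℕ} {α ε : ℝ} (hα0 : 0 < α)
    (hε : 0 < ε) {u : EN N → ℝ} (hu : Integrable u) (x : EN N) :
    Integrable (fun z => kJ N α ε z * u (x + z)) :=
  kJ_mul_integrable hα0 hε (hu.comp_add_left x)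

section
variable {N : ℕ} (hN : 3 ≤ N) {α : ℝ} (hα0 : 0 < α) (hα2 : α < 2)

lemma kJ_diff_integrable (hN : 3 ≤ N) (hα0 : 0 < α) (hα2 : α < 2) {ε : ℝ}
    (hε : 0 < ε) {u : EN N → ℝ} (hu : Integrable u) (x : EN N) :
    Integrable (fun z => kJ N α ε z * (u (x + z) - u x)) := by
  have := (kJ_shift_integrable hα0 hε hu x).sub ((kJ_integrable hN hα0 hα2 hε).mul_const (u x))
  refine this.congr (Eventually.of_forall fun z => ?_)
  simp only [Pi.sub_apply]; ring

lemma Leps_eq (hN : 3 ≤ N) (hα0 : 0 < α) (hα2 : α < 2) {ε : ℝ}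
    (hε : 0 < ε) {u : EN N → ℝ} (hu : Integrable u) (x : EN N) :
    Leps N α ε u x = fracLapCoeff N α * ((∫ z, kJ N α ε z * u (x + z))
      - (∫ z, kJ N α ε z) * u x) := by
  unfold Leps
  rw [← integral_mul_const, ← integral_sub (kJ_shift_integrable hα0 hε hu x)
    ((kJ_integrable hN hα0 hα2 hε).mul_const (u x))]
  congr 1
  refine integral_congr_ae (Eventually.of_forall fun z => ?_)
  simp only; ring

lemma Leps_add (hN : 3 ≤ N) (hα0 : 0 < α) (hα2 : α < 2) {ε : ℝ}
    (hε : 0 < ε) {u v : EN N → ℝ} (hu : Integrable u) (hv : Integrable v) (x : EN N) :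
    Leps N α ε (fun y => u y + v y) x = Leps N α ε u x + Leps N α ε v x := by
  unfold Leps
  rw [← mul_add, ← integral_add (kJ_diff_integrable hN hα0 hα2 hε hu x)
    (kJ_diff_integrable hN hα0 hα2 hε hv x)]
  congr 1
  refine integral_congr_ae (Eventually.of_forall fun z => ?_)
  simp only; ring

lemma Leps_sub (hN : 3 ≤ N) (hα0 : 0 < α) (hα2 : α < 2) {ε : ℝ}
    (hε : 0 < ε) {u v : EN N → ℝ} (hu : Integrable u) (hv : Integrable v) (x : EN N) :
    Leps N α ε (fun y => u y - v y) x = Leps N α ε u x - Leps N α ε v x := by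
  unfold Leps
  rw [← mul_sub, ← integral_sub (kJ_diff_integrable hN hα0 hα2 hε hu x)
    (kJ_diff_integrable hN hα0 hα2 hε hv x)]
  congr 1
  refine integral_congr_ae (Eventually.of_forall fun z => ?_)
  simp only; ring

lemma Leps_smul {ε : ℝ} (a : ℝ) {u : EN N → ℝ} (x : EN N) :
    Leps N α ε (fun y => a * u y) x = a * Leps N α ε u x := by
  unfold Leps
  have h : ∀ z, kJ N α ε z * (a * u (x + z) - a * u x) =
      a * (kJ N α ε z * (u (x + z) - u x)) := fun z => by ring
  simp_rw [h]
  rw [integral_const_mul]; ring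

lemma Leps_translate {ε : ℝ} (e : EN N) {u : EN N → ℝ} (x : EN N) :
    Leps N α ε (fun y => u (y + e)) x = Leps N α ε u (x + e) := by
  unfold Leps
  congr 2
  funext z
  rw [add_right_comm]

/-- symmetrized form -/
lemma Leps_symm (hN : 3 ≤ N) (hα0 : 0 < α) (hα2 : α < 2) {ε : ℝ}
    (hε : 0 < ε) {u : EN N → ℝ} (hu : Integrable u) (x : EN N) :
    Leps N α ε u x = fracLapCoeff N α / 2 *
      ∫ z, kJ N α ε z * (u (x + z) + u (x - z) - 2 * u x) := by
  have h1 := kJ_diff_integrable hN hα0 hα2 hε hu x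
  have h2 : (∫ z, kJ N α ε z * (u (x - z) - u x)) = ∫ z, kJ N α ε z * (u (x + z) - u x) := by
    rw [← integral_neg_eq_self (fun z => kJ N α ε z * (u (x - z) - u x)) volume]
    refine integral_congr_ae (Eventually.of_forall fun z => ?_)
    simp only [kJ_neg, sub_neg_eq_add]
  have h3 : Integrable (fun z => kJ N α ε z * (u (x - z) - u x)) := by
    refine (h1.comp_neg).congr (Eventually.of_forall fun z => ?_)
    simp only [kJ_neg, sub_eq_add_neg]
  have h4 : (∫ z, kJ N α ε z * (u (x + z) + u (x - z) - 2 * u x)) =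
      (∫ z, kJ N α ε z * (u (x + z) - u x)) + ∫ z, kJ N α ε z * (u (x - z) - u x) := by
    rw [← integral_add h1 h3]
    refine integral_congr_ae (Eventually.of_forall fun z => ?_)
    simp only; ring
  rw [h4, h2]; unfold Leps; ring

lemma fracLap_integral_eq {ε : ℝ} (u : EN N → ℝ) (x : EN N) :
    fracLapCoeff N α * ∫ y in {y : EN N | ε < dist y x}, (u y - u x) / dist y x ^ ((N : ℝ) + α)
      = Leps N α ε u x := by
  unfold Leps
  congr 1
  have hm : MeasurableSet {y : EN N | ε < dist y x} :=
    measurableSet_lt measurable_const (measurable_id.dist measurable_const)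
  rw [← integral_indicator hm, ← integral_add_left_eq_self _ x]
  refine integral_congr_ae (Eventually.of_forall fun z => ?_)
  simp only [indicator, mem_ofPred_eq, dist_eq_norm, add_sub_cancel_left, kJ]
  split_ifs with h
  · rw [Real.rpow_neg (norm_nonneg z)]; ring
  · ring

/-- symmetry of the truncated operator -/
lemma Leps_pairing (hN : 3 ≤ N) (hα0 : 0 < α) (hα2 : α < 2) {ε : ℝ}
    (hε : 0 < ε) {u v : EN N → ℝ} (hu : Integrable u) (hv : Integrable v)
    (huv : Integrable (fun x => u x * v x)) :
    ∫ x, u x * Leps N α ε v x = ∫ x, v x * Leps N α ε u x := by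
  -- the double integral
  have hmk : Measurable (fun p : EN N × EN N => kJ N α ε (p.2 - p.1)) :=
    kJ_measurable.comp (measurable_snd.sub measurable_fst)
  have hprod : Integrable (fun p : EN N × EN N => kJ N α ε (p.2 - p.1) * (u p.1 * v p.2))
      (volume.prod volume) := by
    refine (hu.mul_prod hv).bdd_mul (c := ε ^ (-((N : ℝ) + α))) hmk.aestronglyMeasurable
      (Eventually.of_forall fun z => ?_)
    rw [Real.norm_of_nonneg (kJ_nonneg _)]
    exact kJ_le hα0 hε _
  have key : ∀ {a b : EN N → ℝ}, Integrable a → Integrable b →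
      Integrable (fun x => a x * b x) →
      Integrable (fun p : EN N × EN N => kJ N α ε (p.2 - p.1) * (a p.1 * b p.2))
        (volume.prod volume) →
      ∫ x, a x * Leps N α ε b x = fracLapCoeff N α * ((∫ x, ∫ y,
        kJ N α ε (y - x) * (a x * b y)) - (∫ z, kJ N α ε z) * ∫ x, a x * b x) := by
    intro a b ha hb hab hp
    have e1 : ∀ x, a x * Leps N α ε b x = fracLapCoeff N α * ((∫ y,
        kJ N α ε (y - x) * (a x * b y)) - (∫ z, kJ N α ε z) * (a x * b x)) := by
      intro x
      rw [Leps_eq hN hα0 hα2 hε hb]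
      have : (∫ y, kJ N α ε (y - x) * (a x * b y)) = a x * ∫ z, kJ N α ε z * b (x + z) := by
        rw [← integral_add_left_eq_self _ x, ← integral_const_mul]
        refine integral_congr_ae (Eventually.of_forall fun z => ?_)
        simp only [add_sub_cancel_left]; ring
      rw [this]; ring
    simp_rw [e1]
    rw [integral_const_mul, integral_sub hp.integral_prod_left (hab.const_mul _),
      integral_const_mul]
  have hprod2 : Integrable (fun p : EN N × EN N => kJ N α ε (p.2 - p.1) * (v p.1 * u p.2))
      (volume.prod volume) := by
    refine hprod.swap.congr (Eventually.of_forall fun p => ?_)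
    simp only [Function.comp, Prod.swap]
    rw [← kJ_neg, neg_sub]; ring
  have hvu : Integrable (fun x => v x * u x) := by
    simpa only [mul_comm] using huv
  rw [key hu hv huv hprod, key hv hu hvu hprod2]
  congr 2
  · rw [integral_integral_swap hprod]
    congr 1; funext y; congr 1; funext x
    rw [← kJ_neg, neg_sub]; ring
  · congr 1; congr 1; funext x; ring

end

lemma second_diff_bound {N : ℕ} {φ : EN N → ℝ} (hφ : ContDiff ℝ (⊤ : ℕ∞) φ)
    (hc : HasCompactSupport φ) :
    ∃ M : ℝ, 0 ≤ M ∧ ∀ x z : EN N, |φ (x + z) + φ (x - z) - 2 * φ x| ≤ M * min (‖z‖ ^ 2) 1 := by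
  have hd1 : ContDiff ℝ 1 (fderiv ℝ φ) := hφ.fderiv_right (by norm_cast)
  obtain ⟨K, hK⟩ := ContDiff.lipschitzWith_of_hasCompactSupport (hc.fderiv ℝ) hd1 one_ne_zero
  obtain ⟨S, hS⟩ := hφ.continuous.bounded_above_of_compact_support hc
  have hS0 : 0 ≤ S := le_trans (norm_nonneg _) (hS 0)
  have hdiff : Differentiable ℝ φ := hφ.differentiable (by simp)
  have h1 : ∀ x z : EN N, |φ (x + z) + φ (x - z) - 2 * φ x| ≤ 2 * K * ‖z‖ ^ 2 := by
    intro x z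
    set g : ℝ → ℝ := fun t => φ (x + t • z) + φ (x - t • z) with hg
    have hl1 : ∀ t : ℝ, HasDerivAt (fun t : ℝ => x + t • z) z t := by
      intro t
      simpa using ((hasDerivAt_id t).smul_const z).const_add x
    have hl2 : ∀ t : ℝ, HasDerivAt (fun t : ℝ => x - t • z) (-z) t := by
      intro t
      simpa using ((hasDerivAt_id t).smul_const z).const_sub x
    have hder : ∀ t : ℝ, HasDerivAt g
        (fderiv ℝ φ (x + t • z) z + fderiv ℝ φ (x - t • z) (-z)) t := by
      intro t
      exact ((hdiff _).hasFDerivAt.comp_hasDerivAt t (hl1 t)).add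
        ((hdiff _).hasFDerivAt.comp_hasDerivAt t (hl2 t))
    have hb : ∀ t ∈ Icc (0:ℝ) 1,
        ‖fderiv ℝ φ (x + t • z) z + fderiv ℝ φ (x - t • z) (-z)‖ ≤ 2 * K * ‖z‖ ^ 2 := by
      intro t ht
      have : fderiv ℝ φ (x + t • z) z + fderiv ℝ φ (x - t • z) (-z)
          = (fderiv ℝ φ (x + t • z) - fderiv ℝ φ (x - t • z)) z := by
        simp [sub_eq_add_neg]
      rw [this]
      refine (ContinuousLinearMap.le_opNorm _ _).trans ?_
      have h2 : ‖fderiv ℝ φ (x + t • z) - fderiv ℝ φ (x - t • z)‖ ≤ K * (2 * ‖z‖) := by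
        rw [← dist_eq_norm]
        refine (hK.dist_le_mul _ _).trans ?_
        gcongr
        rw [dist_eq_norm]
        have : x + t • z - (x - t • z) = (2 * t) • z := by
          rw [two_mul, add_smul]; abel
        rw [this, norm_smul, Real.norm_of_nonneg (by linarith [ht.1])]
        gcongr
        linarith [ht.2]
      calc _ ≤ K * (2 * ‖z‖) * ‖z‖ := by gcongr
        _ = _ := by ring
    have := (convex_Icc (0:ℝ) 1).norm_image_sub_le_of_norm_hasDerivWithin_le
      (f := g) (fun t ht => (hder t).hasDerivWithinAt) hb (left_mem_Icc.2 zero_le_one)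
      (right_mem_Icc.2 zero_le_one)
    simp only [hg, one_smul, zero_smul, add_zero, sub_zero, norm_one, mul_one] at this
    rw [Real.norm_eq_abs] at this
    rwa [two_mul]
  refine ⟨2 * K + 4 * S, by positivity, fun x z => ?_⟩
  have h2 : |φ (x + z) + φ (x - z) - 2 * φ x| ≤ 4 * S := by
    have a1 := abs_le.1 (by simpa using hS (x + z))
    have a2 := abs_le.1 (by simpa using hS (x - z))
    have a3 := abs_le.1 (by simpa using hS x)
    rw [abs_le]; constructor <;> linarith
  rcases le_total (‖z‖ ^ 2) 1 with h | h
  · rw [min_eq_left h]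
    refine (h1 x z).trans ?_
    gcongr; linarith
  · rw [min_eq_right h]
    have : 0 ≤ (K : ℝ) := K.2
    linarith

lemma kJ_le_rpow {N : ℕ} {α ε : ℝ} (z : EN N) : kJ N α ε z ≤ ‖z‖ ^ (-((N : ℝ) + α)) := by
  unfold kJ
  split_ifs
  · exact le_rfl
  · positivity

lemma test_fracLap {N : ℕ} (hN : 3 ≤ N) {α : ℝ} (hα0 : 0 < α) (hα2 : α < 2)
    {φ : EN N → ℝ} (hφ : ContDiff ℝ (⊤ : ℕ∞) φ) (hc : HasCompactSupport φ) :
    ∃ C : ℝ, (∀ ε > 0, ∀ x, |Leps N α ε φ x| ≤ C) ∧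
      ∀ x, Tendsto (fun ε => Leps N α ε φ x) (𝓝[>] (0 : ℝ)) (𝓝 (fracLap N α φ x)) := by
  obtain ⟨M, hM0, hM⟩ := second_diff_bound hφ hc
  have hInt : Integrable φ := hφ.continuous.integrable_of_hasCompactSupport hc
  have hcp := coeff_pos (N := N) hα0 hα2
  have hdom := domJ_integrable hN hα0 hα2
  have hbd : ∀ ε x z, ‖kJ N α ε z * (φ (x + z) + φ (x - z) - 2 * φ x)‖ ≤ M * domJ N α z := by
    intro ε x z
    rw [norm_mul, Real.norm_of_nonneg (kJ_nonneg z), Real.norm_eq_abs]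
    calc _ ≤ ‖z‖ ^ (-((N : ℝ) + α)) * (M * min (‖z‖ ^ 2) 1) := by
          gcongr
          · exact kJ_le_rpow z
          · exact hM x z
      _ = _ := by unfold domJ; ring
  refine ⟨fracLapCoeff N α / 2 * ∫ z, M * domJ N α z, ?_, ?_⟩
  · intro ε hε x
    rw [Leps_symm hN hα0 hα2 hε hInt, abs_mul, abs_of_pos (by positivity)]
    gcongr
    exact norm_integral_le_of_norm_le (hdom.const_mul M) (Eventually.of_forall (hbd ε x))
  · intro x
    have hT : Tendsto (fun ε => Leps N α ε φ x) (𝓝[>] (0 : ℝ))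
        (𝓝 (fracLapCoeff N α / 2 * ∫ z, ‖z‖ ^ (-((N : ℝ) + α)) *
          (φ (x + z) + φ (x - z) - 2 * φ x))) := by
      have h1 : Tendsto (fun ε => fracLapCoeff N α / 2 * ∫ z, kJ N α ε z *
          (φ (x + z) + φ (x - z) - 2 * φ x)) (𝓝[>] (0 : ℝ))
          (𝓝 (fracLapCoeff N α / 2 * ∫ z, ‖z‖ ^ (-((N : ℝ) + α)) *
            (φ (x + z) + φ (x - z) - 2 * φ x))) := by
        refine Tendsto.const_mul _ ?_
        refine tendsto_integral_filter_of_dominated_convergence (fun z => M * domJ N α z) ?_ ?_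
          (hdom.const_mul M) ?_
        · refine Eventually.of_forall fun ε => ?_
          refine (kJ_measurable.mul ?_).aestronglyMeasurable
          have := hφ.continuous
          exact Continuous.measurable (by fun_prop)
        · exact Eventually.of_forall fun ε => Eventually.of_forall (hbd ε x)
        · refine Eventually.of_forall fun z => ?_
          rcases eq_or_ne z 0 with rfl | hz
          · have : φ (x + 0) + φ (x - 0) - 2 * φ x = 0 := by simp; ring
            rw [this]; simp
          · have hz' : 0 < ‖z‖ := norm_pos_iff.2 hz
            refine tendsto_const_nhds.congr' ?_
            filter_upwards [Ioo_mem_nhdsGT hz'] with ε hε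
            unfold kJ
            rw [if_pos hε.2]
      refine h1.congr' ?_
      filter_upwards [self_mem_nhdsWithin] with ε hε
      rw [Leps_symm hN hα0 hα2 hε hInt]
    have hex : ∃ L, HasFracLap N α φ x L :=
      ⟨fracLapCoeff N α / 2 * ∫ z, ‖z‖ ^ (-((N : ℝ) + α)) * (φ (x + z) + φ (x - z) - 2 * φ x), by
        unfold HasFracLap
        simp_rw [fracLap_integral_eq]
        exact hT⟩
    have : HasFracLap N α φ x (fracLap N α φ x) := by
      unfold fracLap
      rw [dif_pos hex]
      exact hex.choose_spec
    unfold HasFracLap at this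
    simp_rw [fracLap_integral_eq] at this
    exact this

/-- The one dimensional profile of `h` along a line. -/
def prof (α d b t : ℝ) : ℝ := (max (d - 2 * b * t - t ^ 2) 0) ^ (α / 2 - 1)

/-- A primitive. -/
def Gf (α ρ y : ℝ) : ℝ := ∫ w in ρ..y, (w ^ 2 - ρ ^ 2) ^ (α / 2 - 1)

lemma prof_neg (α d b t : ℝ) : prof α d b (-t) = prof α d (-b) t := by
  unfold prof; ring_nf

lemma Gf_integrable {α ρ : ℝ} (hα0 : 0 < α) (hρ : 0 < ρ) {y : ℝ} (hy : ρ ≤ y) :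
    IntervalIntegrable (fun w => (w ^ 2 - ρ ^ 2) ^ (α / 2 - 1)) volume ρ y := by
  have h0 : IntervalIntegrable (fun w : ℝ => w ^ (α / 2 - 1)) volume (ρ - ρ) (y - ρ) :=
    intervalIntegral.intervalIntegrable_rpow' (by linarith)
  have h1 : IntervalIntegrable (fun w : ℝ => (w - ρ) ^ (α / 2 - 1)) volume ρ y := by
    have := h0.comp_sub_right ρ
    simpa using this
  have h2 : ContinuousOn (fun w : ℝ => (w + ρ) ^ (α / 2 - 1)) (uIcc ρ y) := by
    rw [uIcc_of_le hy]
    refine ContinuousOn.rpow_const (by fun_prop) fun w hw => Or.inl ?_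
    have := hw.1
    exact (by linarith : 0 < w + ρ).ne'
  refine (h1.mul_continuousOn h2).congr ?_
  rw [uIoc_of_le hy]
  intro w hw
  have := hw.1
  simp only
  rw [← Real.mul_rpow (by linarith) (by linarith)]
  congr 1; ring

lemma Gf_hasDerivAt {α ρ : ℝ} (hα0 : 0 < α) (hρ : 0 < ρ) {y : ℝ} (hy : ρ < y) :
    HasDerivAt (Gf α ρ) ((y ^ 2 - ρ ^ 2) ^ (α / 2 - 1)) y := by
  unfold Gf
  have hm : Measurable (fun w : ℝ => (w ^ 2 - ρ ^ 2) ^ (α / 2 - 1)) := by fun_prop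
  refine intervalIntegral.integral_hasDerivAt_right (Gf_integrable hα0 hρ hy.le)
    hm.stronglyMeasurable.stronglyMeasurableAtFilter ?_
  refine ContinuousAt.rpow_const (by fun_prop) (Or.inl ?_)
  have : 0 < y ^ 2 - ρ ^ 2 := by nlinarith
  exact this.ne'

lemma Gf_continuousOn {α ρ : ℝ} (hα0 : 0 < α) (hρ : 0 < ρ) : ContinuousOn (Gf α ρ) (Ici ρ) := by
  intro y hy
  have hy1 : ρ ≤ y + 1 := by have : ρ ≤ y := hy
                             linarith
  have h := intervalIntegral.continuousOn_primitive_interval' (Gf_integrable hα0 hρ hy1)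
    (a := ρ) left_mem_uIcc
  rw [uIcc_of_le hy1] at h
  have h2 := h y ⟨hy, by linarith⟩
  refine h2.mono_of_mem_nhdsWithin ?_
  have : Icc ρ (y + 1) = Ici ρ ∩ Iic (y + 1) := rfl
  rw [this]
  exact inter_mem self_mem_nhdsWithin (mem_nhdsWithin_of_mem_nhds (Iic_mem_nhds (by linarith)))

/-- the first identity -/
lemma prof_K {α d b ε : ℝ} (hα0 : 0 < α) (hα2 : α < 2) (hd : 0 < d) (hε : 0 < ε)
    (hq : ε < -b + √(b ^ 2 + d)) :
    IntegrableOn (fun t => t ^ (-α) * prof α d b t) (Ioi ε) ∧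
    ∫ t in Ioi ε, t ^ (-α) * prof α d b t =
      d ^ (α / 2 - 1) * Gf α (√(b ^ 2 + d) / d) (1 / ε - b / d) ∧
    IntegrableOn (fun t => t ^ (-1 - α) * prof α d b t) (Ioi ε) ∧
    d * (∫ t in Ioi ε, t ^ (-1 - α) * prof α d b t) - b * ∫ t in Ioi ε, t ^ (-α) * prof α d b t
      = ε ^ (-α) * (d - 2 * b * ε - ε ^ 2) ^ (α / 2) / α := by
  set s := √(b ^ 2 + d) with hs
  have hs2 : s ^ 2 = b ^ 2 + d := Real.sq_sqrt (by positivity)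
  have hs0 : 0 < s := Real.sqrt_pos.2 (by positivity)
  have hbs : |b| < s := by
    apply abs_lt_of_sq_lt_sq _ hs0.le
    linarith
  have hbs1 := (abs_lt.1 hbs).1
  have hbs2 := (abs_lt.1 hbs).2
  set tp := -b + s with htp
  have htp0 : 0 < tp := by linarith
  have hfac : ∀ t, d - 2 * b * t - t ^ 2 = (tp - t) * (t + b + s) := fun t => by
    rw [htp]; nlinarith
  have hqpos : ∀ t, 0 < t → t < tp → 0 < d - 2 * b * t - t ^ 2 := fun t h1 h2 => by
    rw [hfac]; exact mul_pos (by linarith) (by linarith)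
  have hqneg : ∀ t, tp < t → d - 2 * b * t - t ^ 2 ≤ 0 := fun t h2 => by
    rw [hfac]; exact mul_nonpos_of_nonpos_of_nonneg (by linarith) (by linarith)
  have hprof : ∀ t, 0 < t → t < tp → prof α d b t = (d - 2 * b * t - t ^ 2) ^ (α / 2 - 1) :=
    fun t h1 h2 => by unfold prof; rw [max_eq_left (hqpos t h1 h2).le]
  have hprof0 : ∀ t, tp < t → prof α d b t = 0 := fun t h2 => by
    unfold prof; rw [max_eq_right (hqneg t h2), Real.zero_rpow (by linarith)]
  have hρ : 0 < s / d := by positivity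
  -- relation for the inverse
  have hinv : ∀ t, 0 < t → t ≤ tp → s / d ≤ 1 / t - b / d := fun t h1 h2 => by
    rw [le_sub_iff_add_le, ← add_div, div_le_div_iff₀ hd h1]
    have : (s + b) * tp = d := by rw [htp]; nlinarith
    nlinarith
  have hinv' : ∀ t, 0 < t → t < tp → s / d < 1 / t - b / d := fun t h1 h2 => by
    rw [lt_sub_iff_add_lt, ← add_div, div_lt_div_iff₀ hd h1]
    have : (s + b) * tp = d := by rw [htp]; nlinarith
    nlinarith
  have hinve : 1 / tp - b / d = s / d := by
    have : (s + b) * tp = d := by rw [htp]; nlinarith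
    rw [sub_eq_iff_eq_add, ← add_div, div_eq_div_iff htp0.ne' hd.ne']
    linarith
  -- FTC for the first
  have hcontH : ContinuousOn (fun t => -(d ^ (α / 2 - 1) * Gf α (s / d) (1 / t - b / d)))
      (Icc ε tp) := by
    refine (ContinuousOn.mul continuousOn_const ?_).neg
    refine (Gf_continuousOn hα0 hρ).comp ?_ ?_
    · refine ContinuousOn.sub (ContinuousOn.div continuousOn_const continuousOn_id ?_)
        continuousOn_const
      intro t ht; exact (lt_of_lt_of_le hε ht.1).ne'
    · intro t ht; exact hinv t (lt_of_lt_of_le hε ht.1) ht.2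
  have hderH : ∀ t ∈ Ioo ε tp, HasDerivAt (fun t => -(d ^ (α / 2 - 1) *
      Gf α (s / d) (1 / t - b / d))) (t ^ (-α) * prof α d b t) t := by
    intro t ht
    have ht0 : 0 < t := hε.trans ht.1
    have h1 := Gf_hasDerivAt hα0 hρ (hinv' t ht0 ht.2)
    have h2 : HasDerivAt (fun t : ℝ => 1 / t - b / d) (-(t ^ 2)⁻¹) t := by
      have := (hasDerivAt_inv ht0.ne').sub_const (b / d)
      simpa [one_div] using this
    have h3 := ((h1.comp t h2).const_mul (d ^ (α / 2 - 1))).neg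
    refine h3.congr_deriv ?_
    have hw : 0 < (1 / t - b / d) ^ 2 - (s / d) ^ 2 := by
      have := hinv' t ht0 ht.2; nlinarith
    rw [hprof t ht0 ht.2]
    have e1 : d - 2 * b * t - t ^ 2 = t ^ 2 * (d * ((1 / t - b / d) ^ 2 - (s / d) ^ 2)) := by
      rw [div_pow, hs2]; field_simp; ring
    rw [e1, Real.mul_rpow (by positivity) (by positivity), Real.mul_rpow hd.le hw.le]
    have e2 : (t ^ 2 : ℝ) ^ (α / 2 - 1) = t ^ α * (t ^ 2)⁻¹ := by
      rw [← Real.rpow_natCast, ← Real.rpow_mul ht0.le, ← Real.rpow_neg ht0.le, ← Real.rpow_add ht0]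
      congr 1; push_cast; ring
    rw [e2]
    have e3 : t ^ (-α) * t ^ α = 1 := by
      rw [← Real.rpow_add ht0]; simp
    linear_combination (-(t ^ 2)⁻¹ * (d ^ (α / 2 - 1) * ((1 / t - b / d) ^ 2 - (s / d) ^ 2) ^ (α / 2 - 1))) * e3
  have hpos : ∀ t ∈ Ioo ε tp, 0 ≤ t ^ (-α) * prof α d b t := fun t ht => by
    have ht0 : 0 < t := hε.trans ht.1
    have : 0 ≤ prof α d b t := by unfold prof; positivity
    positivity
  have hI1 : IntegrableOn (fun t => t ^ (-α) * prof α d b t) (Ioc ε tp) :=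
    intervalIntegral.integrableOn_deriv_of_nonneg hcontH hderH hpos
  have hval1 := intervalIntegral.integral_eq_sub_of_hasDerivAt_of_le hq.le hcontH hderH
    ((intervalIntegrable_iff_integrableOn_Ioc_of_le hq.le).2 hI1)
  -- FTC for the second
  have hcontF : ContinuousOn (fun t => -((d - 2 * b * t - t ^ 2) ^ (α / 2) * t ^ (-α) / α))
      (Icc ε tp) := by
    refine ((ContinuousOn.mul ?_ ?_).div_const _).neg
    · exact ContinuousOn.rpow_const (by fun_prop) fun t _ => Or.inr (by positivity)
    · refine ContinuousOn.rpow_const (by fun_prop) fun t ht => Or.inl ?_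
      exact (lt_of_lt_of_le hε ht.1).ne'
  have hderF : ∀ t ∈ Ioo ε tp, HasDerivAt (fun t => -((d - 2 * b * t - t ^ 2) ^ (α / 2) *
      t ^ (-α) / α)) ((t ^ (-1 - α) * prof α d b t) * (d - b * t)) t := by
    intro t ht
    have ht0 : 0 < t := hε.trans ht.1
    have hq0 := hqpos t ht0 ht.2
    have h1 : HasDerivAt (fun t : ℝ => d - 2 * b * t - t ^ 2) (-(2 * b) - 2 * t) t := by
      have := (((hasDerivAt_id t).const_mul (2 * b)).const_sub d).sub ((hasDerivAt_id t).pow 2)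
      refine (this.congr_deriv (by simp)).congr_of_eventuallyEq (Eventually.of_forall fun y => ?_)
      simp
    have h2 := h1.rpow_const (p := α / 2) (Or.inl hq0.ne')
    have h3 : HasDerivAt (fun t : ℝ => t ^ (-α)) (-α * t ^ (-α - 1)) t :=
      Real.hasDerivAt_rpow_const (Or.inl ht0.ne')
    refine ((h2.mul h3).div_const α).neg.congr_deriv ?_
    rw [hprof t ht0 ht.2]
    set q := d - 2 * b * t - t ^ 2 with hqd
    have e1 : q ^ (α / 2) = q ^ (α / 2 - 1) * q := by
      rw [← Real.rpow_add_one hq0.ne']; ring_nf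
    have e2 : t ^ (-α) = t ^ (-1 - α) * t := by
      rw [← Real.rpow_add_one ht0.ne']; ring_nf
    have e3 : -α - 1 = -1 - α := by ring
    rw [e3, e1, e2]
    field_simp
    rw [hqd]; ring
  have hpos2 : ∀ t ∈ Ioo ε tp, 0 ≤ (t ^ (-1 - α) * prof α d b t) * (d - b * t) := fun t ht => by
    have ht0 : 0 < t := hε.trans ht.1
    have : 0 ≤ prof α d b t := by unfold prof; positivity
    have h2 : 0 ≤ d - b * t := by
      have := hqpos t ht0 ht.2; nlinarith
    positivity
  have hI2 : IntegrableOn (fun t => (t ^ (-1 - α) * prof α d b t) * (d - b * t)) (Ioc ε tp) :=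
    intervalIntegral.integrableOn_deriv_of_nonneg hcontF hderF hpos2
  have hval2 := intervalIntegral.integral_eq_sub_of_hasDerivAt_of_le hq.le hcontF hderF
    ((intervalIntegrable_iff_integrableOn_Ioc_of_le hq.le).2 hI2)
  have hI3 : IntegrableOn (fun t => t ^ (-1 - α) * prof α d b t) (Ioc ε tp) := by
    have := (hI2.add (hI1.const_mul b)).const_mul d⁻¹
    refine IntegrableOn.congr_fun this ?_ measurableSet_Ioc
    intro t ht
    have ht0 : 0 < t := hε.trans ht.1
    have e2 : t ^ (-α) = t ^ (-1 - α) * t := by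
      rw [← Real.rpow_add_one ht0.ne']; ring_nf
    simp only [Pi.add_apply]
    rw [e2]; field_simp; ring
  have hval3 : (∫ t in ε..tp, (t ^ (-1 - α) * prof α d b t) * (d - b * t)) =
      d * (∫ t in ε..tp, t ^ (-1 - α) * prof α d b t) - b * ∫ t in ε..tp, t ^ (-α) * prof α d b t := by
    rw [← intervalIntegral.integral_const_mul, ← intervalIntegral.integral_const_mul,
      ← intervalIntegral.integral_sub]
    · refine intervalIntegral.integral_congr_ae (Eventually.of_forall fun t ht => ?_)
      rw [uIoc_of_le hq.le] at ht
      have ht0 : 0 < t := hε.trans ht.1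
      have e2 : t ^ (-α) = t ^ (-1 - α) * t := by
        rw [← Real.rpow_add_one ht0.ne']; ring_nf
      rw [e2]; ring
    · exact ((intervalIntegrable_iff_integrableOn_Ioc_of_le hq.le).2 hI3).const_mul d
    · exact ((intervalIntegrable_iff_integrableOn_Ioc_of_le hq.le).2 hI1).const_mul b
  -- transfer to the half line
  have htr : ∀ e : ℝ, IntegrableOn (fun t => t ^ e * prof α d b t) (Ioc ε tp) →
      IntegrableOn (fun t => t ^ e * prof α d b t) (Ioi ε) ∧
      ∫ t in Ioi ε, t ^ e * prof α d b t = ∫ t in ε..tp, t ^ e * prof α d b t := by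
    intro e he
    have hz : ∀ t ∈ Ioi ε \ Ioc ε tp, t ^ e * prof α d b t = 0 := by
      intro t ht
      have : tp < t := by
        by_contra hcon
        exact ht.2 ⟨ht.1, not_lt.1 hcon⟩
      rw [hprof0 t this, mul_zero]
    constructor
    · exact he.of_forall_sdiff_eq_zero measurableSet_Ioi hz
    · rw [intervalIntegral.integral_of_le hq.le]
      exact (setIntegral_eq_of_subset_of_forall_sdiff_eq_zero measurableSet_Ioi
        Ioc_subset_Ioi_self hz)
  obtain ⟨hA, hB⟩ := htr _ hI1
  obtain ⟨hC, hD⟩ := htr _ hI3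
  refine ⟨hA, ?_, hC, ?_⟩
  · rw [hB, hval1, hinve]
    unfold Gf
    rw [intervalIntegral.integral_same]; ring
  · rw [hB, hD, ← hval3, hval2]
    have : d - 2 * b * tp - tp ^ 2 = 0 := by rw [hfac]; ring
    rw [this, Real.zero_rpow (by linarith)]
    ring


lemma rpow_second {a d0 d b ε : ℝ} (ha0 : 0 < a) (ha1 : a < 1) (hd0 : 0 < d0)
    (hd : d0 ≤ d) (hd1 : d ≤ 1) (hb : |b| ≤ 1) (hε : 0 < ε) (hε1 : ε ≤ d0 / 6) :
    |(d - 2 * b * ε - ε ^ 2) ^ a + (d - 2 * (-b) * ε - ε ^ 2) ^ a - 2 * d ^ a|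
      ≤ 12 / d0 ^ 2 * ε ^ 2 := by
  have hdp : 0 < d := by linarith
  obtain ⟨hb1, hb2⟩ := abs_le.1 hb
  have hεd : ε ≤ d / 6 := by linarith
  set y1 := (d - 2 * b * ε - ε ^ 2) / d with hy1
  set y2 := (d - 2 * (-b) * ε - ε ^ 2) / d with hy2
  have p1 : 0 ≤ y1 := by rw [hy1]; apply div_nonneg _ hdp.le; nlinarith
  have p2 : 0 ≤ y2 := by rw [hy2]; apply div_nonneg _ hdp.le; nlinarith
  have e1 : d - 2 * b * ε - ε ^ 2 = d * y1 := by rw [hy1]; field_simp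
  have e2 : d - 2 * (-b) * ε - ε ^ 2 = d * y2 := by rw [hy2]; field_simp
  have hsum : y1 + y2 = 2 - 2 * (ε ^ 2 / d) := by rw [hy1, hy2]; field_simp; ring
  have hsum2 : y1 + y2 ≤ 2 := by rw [hsum]; have : 0 ≤ ε ^ 2 / d := by positivity
                                 linarith
  have hprod : 1 - 6 / d0 ^ 2 * ε ^ 2 ≤ y1 * y2 := by
    have h1 : y1 * y2 = 1 - 2 * ε ^ 2 / d - 4 * b ^ 2 * ε ^ 2 / d ^ 2 + ε ^ 4 / d ^ 2 := by
      rw [hy1, hy2]; field_simp; ring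
    have h2 : 2 * ε ^ 2 / d ≤ 2 * ε ^ 2 / d0 ^ 2 := by
      gcongr
      nlinarith
    have h3 : 4 * b ^ 2 * ε ^ 2 / d ^ 2 ≤ 4 * 1 * ε ^ 2 / d0 ^ 2 := by
      gcongr
      nlinarith
    have h4 : 0 ≤ ε ^ 4 / d ^ 2 := by positivity
    have h5 : 6 / d0 ^ 2 * ε ^ 2 = 2 * ε ^ 2 / d0 ^ 2 + 4 * 1 * ε ^ 2 / d0 ^ 2 := by
      ring
    rw [h1, h5]; linarith
  have hprod1 : y1 * y2 ≤ 1 := by nlinarith [sq_nonneg (y1 - y2)]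
  have hda : 0 ≤ d ^ a := by positivity
  have hda1 : d ^ a ≤ 1 := Real.rpow_le_one hdp.le hd1 ha0.le
  have hup : y1 ^ a + y2 ^ a ≤ 2 := by
    have u1 := rpow_one_add_le_one_add_mul_self (s := y1 - 1) (by linarith) ha0.le ha1.le
    have u2 := rpow_one_add_le_one_add_mul_self (s := y2 - 1) (by linarith) ha0.le ha1.le
    rw [add_sub_cancel] at u1 u2
    nlinarith
  have hlow : 2 * (1 - 6 / d0 ^ 2 * ε ^ 2) ≤ y1 ^ a + y2 ^ a := by
    have s1 : (y1 ^ (a / 2)) ^ 2 = y1 ^ a := by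
      rw [← Real.rpow_natCast, ← Real.rpow_mul p1]; congr 1; push_cast; ring
    have s2 : (y2 ^ (a / 2)) ^ 2 = y2 ^ a := by
      rw [← Real.rpow_natCast, ← Real.rpow_mul p2]; congr 1; push_cast; ring
    have s3 : y1 * y2 ≤ y1 ^ (a / 2) * y2 ^ (a / 2) := by
      rw [← Real.mul_rpow p1 p2]
      exact Real.self_le_rpow_of_le_one (mul_nonneg p1 p2) hprod1 (by linarith)
    nlinarith [sq_nonneg (y1 ^ (a / 2) - y2 ^ (a / 2))]
  rw [e1, e2, Real.mul_rpow hdp.le p1, Real.mul_rpow hdp.le p2]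
  have : d ^ a * y1 ^ a + d ^ a * y2 ^ a - 2 * d ^ a = d ^ a * (y1 ^ a + y2 ^ a - 2) := by ring
  rw [this, abs_mul, abs_of_nonneg hda]
  have h3 : |y1 ^ a + y2 ^ a - 2| ≤ 12 / d0 ^ 2 * ε ^ 2 := by
    have : 0 ≤ 12 / d0 ^ 2 * ε ^ 2 := by positivity
    rw [abs_le]; constructor <;> linarith [show 12 / d0 ^ 2 * ε ^ 2 = 2 * (6 / d0 ^ 2 * ε ^ 2) by ring]
  calc _ ≤ 1 * |y1 ^ a + y2 ^ a - 2| := by gcongr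
    _ ≤ _ := by rw [one_mul]; exact h3

set_option maxHeartbeats 800000 in
lemma prof_bounds {α d0 : ℝ} (hα0 : 0 < α) (hα2 : α < 2) (hd0 : 0 < d0) :
    ∃ C : ℝ, 0 ≤ C ∧ ∀ d b ε : ℝ, d0 ≤ d → d ≤ 1 → |b| ≤ 1 → 0 < ε → ε ≤ d0 / 6 →
      |∫ t in Ioi ε, t ^ (-α) * (prof α d b t - prof α d (-b) t)| ≤ C * ε ^ (2 - α) ∧
      |∫ t in Ioi ε, t ^ (-1 - α) * (prof α d b t + prof α d (-b) t - 2 * d ^ (α / 2 - 1))|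
        ≤ C * ε ^ (2 - α) := by
  set C1 : ℝ := d0 ^ (α / 2 - 1) * (8 ^ (1 - α / 2) * (2 / d0)) with hC1
  have hC1p : 0 ≤ C1 := by positivity
  set C2 : ℝ := (C1 + 12 / d0 ^ 2 / α) / d0 with hC2
  have hC2p : 0 ≤ C2 := by positivity
  refine ⟨C1 + C2, by positivity, ?_⟩
  intro d b ε hd hd1 hb hε hε1
  have hdp : 0 < d := by linarith
  obtain ⟨hb1, hb2⟩ := abs_le.1 hb
  have hb2' : b ^ 2 ≤ 1 := by nlinarith
  set s := √(b ^ 2 + d) with hs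
  have hs2 : s ^ 2 = b ^ 2 + d := Real.sq_sqrt (by positivity)
  have hs0 : 0 < s := Real.sqrt_pos.2 (by positivity)
  have hsle : s ≤ 2 := by nlinarith
  have hbs : |b| < s := by
    apply abs_lt_of_sq_lt_sq _ hs0.le
    linarith
  have hbs1 := (abs_lt.1 hbs).1
  have hbs2 := (abs_lt.1 hbs).2
  have hq1 : ε < -b + s := by
    have : (-b + s) * (b + s) = d := by nlinarith
    by_contra hcon
    nlinarith
  have hq2 : ε < -(-b) + s := by
    have : (-b + s) * (b + s) = d := by nlinarith
    by_contra hcon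
    nlinarith
  have hneg : (-b) ^ 2 = b ^ 2 := by ring
  obtain ⟨a1, a2, a3, a4⟩ := prof_K hα0 hα2 hdp hε hq1
  obtain ⟨b1, b2, b3, b4⟩ := prof_K (b := -b) hα0 hα2 hdp hε (by rw [hneg]; exact hq2)
  rw [hneg] at b2
  rw [← hs] at a2 b2
  have hρ : 0 < s / d := by positivity
  -- bound of the `G` difference
  have hT : 6 / d0 ≤ 1 / ε := by
    rw [div_le_div_iff₀ hd0 hε]; linarith
  have hbd : |b / d| ≤ 1 / d0 := by
    rw [abs_div, abs_of_pos hdp]; gcongr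
  obtain ⟨hbd1, hbd2⟩ := abs_le.1 hbd
  have hsd : s / d ≤ 2 / d0 := by gcongr
  set T := 1 / ε with hTd
  have hTp : 0 < T := by positivity
  have hi : 0 < 1 / d0 := by positivity
  have h6 : 6 / d0 = 6 * (1 / d0) := by ring
  have h62 : 2 / d0 = 2 * (1 / d0) := by ring
  have hGd : |Gf α (s / d) (T - b / d) - Gf α (s / d) (T - -b / d)| ≤
      8 ^ (1 - α / 2) * (2 / d0) * ε ^ (2 - α) := by
    have hmv := Convex.norm_image_sub_le_of_norm_hasDerivWithin_le (f := Gf α (s / d))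
      (f' := fun y => (y ^ 2 - (s / d) ^ 2) ^ (α / 2 - 1)) (s := Ici (T / 2))
      (C := (T ^ 2 / 8) ^ (α / 2 - 1)) (x := T - -b / d) (y := T - b / d) ?_ ?_
      (convex_Ici _) ?_ ?_
    · rw [Real.norm_eq_abs, Real.norm_eq_abs] at hmv
      refine hmv.trans ?_
      have e1 : (T ^ 2 / 8) ^ (α / 2 - 1) = 8 ^ (1 - α / 2) * ε ^ (2 - α) := by
        have : T ^ 2 / 8 = (8 * ε ^ 2)⁻¹ := by rw [hTd]; field_simp
        rw [this, Real.inv_rpow (by positivity), ← Real.rpow_neg (by positivity),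
          Real.mul_rpow (by positivity) (by positivity), ← Real.rpow_natCast ε,
          ← Real.rpow_mul hε.le]
        congr 2 <;> (push_cast; ring)
      have e2 : |T - b / d - (T - -b / d)| ≤ 2 / d0 := by
        have : T - b / d - (T - -b / d) = -(2 * (b / d)) := by ring
        rw [this, abs_neg, abs_mul, abs_two, h62]; gcongr
      rw [e1]
      calc _ ≤ 8 ^ (1 - α / 2) * ε ^ (2 - α) * (2 / d0) := by gcongr
        _ = _ := by ring
    · intro y hy
      refine (Gf_hasDerivAt hα0 hρ ?_).hasDerivWithinAt
      have : T / 2 ≤ y := hy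
      linarith
    · intro y hy
      have hy' : T / 2 ≤ y := hy
      have h81 : (s / d) ^ 2 ≤ (T / 3) ^ 2 := pow_le_pow_left₀ hρ.le (by linarith) 2
      have h82 : (T / 2) ^ 2 ≤ y ^ 2 := pow_le_pow_left₀ (by linarith) hy' 2
      have h83 : 0 ≤ T ^ 2 := by positivity
      have h8 : T ^ 2 / 8 ≤ y ^ 2 - (s / d) ^ 2 := by
        have e8 : (T / 3) ^ 2 = T ^ 2 / 9 := by ring
        have e9 : (T / 2) ^ 2 = T ^ 2 / 4 := by ring
        linarith
      have : 0 < T ^ 2 / 8 := by positivity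
      rw [Real.norm_of_nonneg (Real.rpow_nonneg (by linarith) _)]
      exact Real.rpow_le_rpow_of_nonpos this h8 (by linarith)
    · change T / 2 ≤ _
      rw [neg_div]; linarith
    · change T / 2 ≤ _
      linarith
  have hKdiff : |(∫ t in Ioi ε, t ^ (-α) * prof α d b t) - ∫ t in Ioi ε, t ^ (-α) * prof α d (-b) t|
      ≤ C1 * ε ^ (2 - α) := by
    rw [a2, b2, ← mul_sub, abs_mul, abs_of_nonneg (by positivity), hC1]
    have : d ^ (α / 2 - 1) ≤ d0 ^ (α / 2 - 1) :=
      Real.rpow_le_rpow_of_nonpos hd0 hd (by linarith)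
    calc _ ≤ d0 ^ (α / 2 - 1) * (8 ^ (1 - α / 2) * (2 / d0) * ε ^ (2 - α)) := by gcongr
      _ = _ := by ring
  have hεp : 0 ≤ ε ^ (2 - α) := by positivity
  constructor
  · simp_rw [mul_sub]
    rw [integral_sub a1 b1]
    refine hKdiff.trans ?_
    gcongr; linarith
  · have hI := integrableOn_Ioi_rpow_of_lt (a := -1 - α) (by linarith) hε
    have hIv : ∫ t in Ioi ε, t ^ (-1 - α) = ε ^ (-α) / α := by
      rw [integral_Ioi_rpow_of_lt (by linarith) hε]
      have : -1 - α + 1 = -α := by ring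
      rw [this, div_neg, neg_div, neg_neg]
    have hsp : (∫ t in Ioi ε, t ^ (-1 - α) * (prof α d b t + prof α d (-b) t - 2 * d ^ (α / 2 - 1)))
        = (∫ t in Ioi ε, t ^ (-1 - α) * prof α d b t) + (∫ t in Ioi ε, t ^ (-1 - α) * prof α d (-b) t)
          - ε ^ (-α) / α * (2 * d ^ (α / 2 - 1)) := by
      rw [← hIv, ← integral_mul_const, ← integral_add a3 b3, ← integral_sub ?_ (hI.mul_const _)]
      · refine integral_congr_ae (Eventually.of_forall fun t => ?_)
        simp only
        ring
      · exact a3.add b3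
    rw [hsp]
    set A1 := ∫ t in Ioi ε, t ^ (-1 - α) * prof α d b t
    set A2 := ∫ t in Ioi ε, t ^ (-1 - α) * prof α d (-b) t
    set K1 := ∫ t in Ioi ε, t ^ (-α) * prof α d b t
    set K2 := ∫ t in Ioi ε, t ^ (-α) * prof α d (-b) t
    have hrs := rpow_second (a := α / 2) (by linarith) (by linarith) hd0 hd hd1 hb hε hε1
    set Q := (d - 2 * b * ε - ε ^ 2) ^ (α / 2) + (d - 2 * (-b) * ε - ε ^ 2) ^ (α / 2)
      - 2 * d ^ (α / 2) with hQ
    have edp : d ^ (α / 2) = d ^ (α / 2 - 1) * d := by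
      rw [← Real.rpow_add_one hdp.ne']; ring_nf
    have key : d * (A1 + A2 - ε ^ (-α) / α * (2 * d ^ (α / 2 - 1))) =
        b * (K1 - K2) + ε ^ (-α) / α * Q := by
      rw [hQ, edp]
      linear_combination a4 + b4
    have hbound : |d * (A1 + A2 - ε ^ (-α) / α * (2 * d ^ (α / 2 - 1)))| ≤
        (C1 + 12 / d0 ^ 2 / α) * ε ^ (2 - α) := by
      rw [key]
      refine (abs_add_le _ _).trans ?_
      rw [abs_mul, abs_mul, abs_of_nonneg (a := ε ^ (-α) / α) (by positivity)]
      have e3 : ε ^ (2 - α) = ε ^ (-α) * ε ^ 2 := by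
        rw [← Real.rpow_natCast, ← Real.rpow_add hε]; congr 1; push_cast; ring
      calc _ ≤ 1 * (C1 * ε ^ (2 - α)) + ε ^ (-α) / α * (12 / d0 ^ 2 * ε ^ 2) := by gcongr
        _ = _ := by rw [e3]; ring
    rw [abs_mul, abs_of_pos hdp] at hbound
    have : |A1 + A2 - ε ^ (-α) / α * (2 * d ^ (α / 2 - 1))| ≤ C2 * ε ^ (2 - α) := by
      rw [hC2, div_mul_eq_mul_div (C1 + _), le_div_iff₀ hd0]
      refine le_trans ?_ hbound
      rw [mul_comm]; gcongr
    refine this.trans ?_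
    gcongr; linarith

/-- total mass of the sphere -/
def sphM (N : ℕ) : ℝ := ((volume : Measure (EN N)).toSphere).real univ

lemma polar_bound {N : ℕ} (hN : 3 ≤ N) {F : EN N → ℝ} {C : ℝ} (hC : 0 ≤ C)
    (h : ∀ θ : EN N, ‖θ‖ = 1 → |∫ t in Ioi (0 : ℝ), t ^ (N - 1) * F (t • θ)| ≤ C) :
    |∫ z, F z| ≤ C * sphM N := by
  have : Nonempty (Fin N) := ⟨⟨0, by omega⟩⟩
  have hnn : 0 ≤ sphM N := measureReal_nonneg
  have hd : Module.finrank ℝ (EN N) = N := by simp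
  by_cases hF : Integrable F
  swap
  · rw [integral_undef hF]; simp; positivity
  set ν := ((volume : Measure (EN N)).toSphere).prod (Measure.volumeIoiPow (N - 1))
  have hmp := (volume : Measure (EN N)).measurePreserving_homeomorphUnitSphereProd
  rw [hd] at hmp
  have e1 : ∫ z, F z = ∫ z : ({(0)}ᶜ : Set (EN N)), F z.1 ∂((volume : Measure (EN N)).comap (↑)) := by
    rw [integral_subtype_comap (measurableSet_singleton _).compl fun x => F x,
      restrict_compl_singleton]
  have hsm : ∀ z : ({(0)}ᶜ : Set (EN N)), F z.1 =
      F ((homeomorphUnitSphereProd (EN N) z).2.1 • (homeomorphUnitSphereProd (EN N) z).1.1) := by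
    intro z
    have hz : ‖z.1‖ ≠ 0 := norm_ne_zero_iff.2 z.2
    simp [smul_smul, hz]
  have e2 : ∫ z : ({(0)}ᶜ : Set (EN N)), F z.1 ∂((volume : Measure (EN N)).comap (↑)) =
      ∫ p, F (p.2.1 • p.1.1) ∂ν := by
    rw [← hmp.integral_comp (Homeomorph.measurableEmbedding _)
      (fun p : sphere (0 : EN N) 1 × Ioi (0 : ℝ) => F (p.2.1 • p.1.1))]
    exact integral_congr_ae (Eventually.of_forall hsm)
  have hInt : Integrable (fun p : sphere (0 : EN N) 1 × Ioi (0 : ℝ) => F (p.2.1 • p.1.1)) ν := by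
    rw [← hmp.integrable_comp_emb (Homeomorph.measurableEmbedding _)]
    have h1 : Integrable (fun z : ({(0)}ᶜ : Set (EN N)) => F z.1)
        ((volume : Measure (EN N)).comap (↑)) := by
      have h2 : IntegrableOn F ({(0)}ᶜ : Set (EN N)) := hF.integrableOn
      rwa [integrableOn_iff_comap_subtypeVal (measurableSet_singleton _).compl] at h2
    refine h1.congr (Eventually.of_forall hsm)
  rw [e1, e2, integral_prod _ hInt]
  have hin : ∀ θ : sphere (0 : EN N) 1, ‖∫ t : Ioi (0 : ℝ), F (t.1 • θ.1)
      ∂(Measure.volumeIoiPow (N - 1))‖ ≤ C := by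
    intro θ
    have e3 : ∫ t : Ioi (0 : ℝ), F (t.1 • θ.1) ∂(Measure.volumeIoiPow (N - 1)) =
        ∫ t in Ioi (0 : ℝ), t ^ (N - 1) * F (t • θ.1) := by
      simp only [Measure.volumeIoiPow, ENNReal.ofReal]
      rw [integral_withDensity_eq_integral_smul,
        integral_subtype_comap measurableSet_Ioi
          fun a : ℝ => Real.toNNReal (a ^ (N - 1)) • F (a • θ.1),
        setIntegral_congr_fun measurableSet_Ioi fun x hx => ?_]
      · rw [NNReal.smul_def, Real.coe_toNNReal _ (pow_nonneg (le_of_lt hx) _), smul_eq_mul]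
      · exact (measurable_subtype_coe.pow_const _).real_toNNReal
    rw [e3, Real.norm_eq_abs]
    refine h θ.1 ?_
    simp
  exact norm_integral_le_of_norm_le_const (Eventually.of_forall hin)

/-- The singular harmonic function of the ball. -/
def hB (N : ℕ) (α : ℝ) (x : EN N) : ℝ := (max (1 - ‖x‖ ^ 2) 0) ^ (α / 2 - 1)

lemma hB_nonneg {N : ℕ} {α : ℝ} (x : EN N) : 0 ≤ hB N α x := by unfold hB; positivity

lemma hB_out {N : ℕ} {α : ℝ} (hα2 : α < 2) {x : EN N} (hx : 1 ≤ ‖x‖) : hB N α x = 0 := by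
  unfold hB
  rw [max_eq_right (by nlinarith), Real.zero_rpow (by linarith)]

lemma hB_in {N : ℕ} {α : ℝ} {x : EN N} (hx : ‖x‖ < 1) :
    hB N α x = (1 - ‖x‖ ^ 2) ^ (α / 2 - 1) := by
  unfold hB
  rw [max_eq_left (by nlinarith [norm_nonneg x])]

lemma hB_ge_one {N : ℕ} {α : ℝ} (hα2 : α < 2) {x : EN N} (hx : ‖x‖ < 1) : 1 ≤ hB N α x := by
  rw [hB_in hx]
  refine Real.one_le_rpow_of_pos_of_le_one_of_nonpos ?_ ?_ (by linarith) <;>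
    nlinarith [norm_nonneg x]

lemma hB_measurable {N : ℕ} {α : ℝ} : Measurable (hB N α) := by
  unfold hB; fun_prop

lemma hB_continuousOn {N : ℕ} {α : ℝ} : ContinuousOn (hB N α) (ball 0 1) := by
  unfold hB
  refine ContinuousOn.rpow_const (by fun_prop) fun x hx => Or.inl ?_
  have h1 : ‖x‖ < 1 := by simpa using hx
  have : 0 < 1 - ‖x‖ ^ 2 := by nlinarith [norm_nonneg x]
  exact (lt_max_of_lt_left this).ne'

lemma hB_integrable {N : ℕ} (hN : 3 ≤ N) {α : ℝ} (hα0 : 0 < α) (hα2 : α < 2) :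
    Integrable (hB N α) := by
  have : Nonempty (Fin N) := ⟨⟨0, by omega⟩⟩
  have h := (integrable_fun_norm_addHaar (volume : Measure (EN N))
    (f := fun r : ℝ => (max (1 - r ^ 2) 0) ^ (α / 2 - 1))).2
  refine h ?_
  have hmeas : ∀ s : Set ℝ, AEStronglyMeasurable
      (fun y : ℝ => y ^ (Module.finrank ℝ (EN N) - 1) • (max (1 - y ^ 2) 0) ^ (α / 2 - 1))
        (volume.restrict s) := by
    intro s
    have : Measurable (fun y : ℝ => y ^ (Module.finrank ℝ (EN N) - 1) •
      (max (1 - y ^ 2) 0) ^ (α / 2 - 1)) := by fun_prop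
    exact this.aestronglyMeasurable
  rw [← Ioc_union_Ioi_eq_Ioi (show (0 : ℝ) ≤ 1 / 2 by norm_num)]
  refine IntegrableOn.union ?_ ?_
  · refine Integrable.mono' (g := fun _ => (3 / 4 : ℝ) ^ (α / 2 - 1))
      (integrableOn_const (by simp)) (hmeas _) ?_
    refine (ae_restrict_mem measurableSet_Ioc).mono fun y hy => ?_
    obtain ⟨hy0, hy1⟩ := hy
    rw [smul_eq_mul, Real.norm_of_nonneg (by positivity)]
    have h1 : y ^ (Module.finrank ℝ (EN N) - 1) ≤ 1 := pow_le_one₀ hy0.le (by linarith)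
    have h2 : (max (1 - y ^ 2) 0) ^ (α / 2 - 1) ≤ (3 / 4 : ℝ) ^ (α / 2 - 1) := by
      refine Real.rpow_le_rpow_of_nonpos (by norm_num) ?_ (by linarith)
      exact le_max_of_le_left (by nlinarith)
    calc _ ≤ 1 * (3 / 4 : ℝ) ^ (α / 2 - 1) := by gcongr
      _ = _ := one_mul _
  · have h1 := (prof_K (d := 1) (b := 0) (ε := 1 / 2) hα0 hα2 one_pos (by norm_num)
      (by norm_num)).1
    refine Integrable.mono' h1 (hmeas _) ?_
    refine (ae_restrict_mem measurableSet_Ioi).mono fun y hy => ?_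
    have hy0 : (1 / 2 : ℝ) < y := hy
    have hy0' : 0 < y := by linarith
    rw [smul_eq_mul, Real.norm_of_nonneg (by positivity)]
    have hp : prof α 1 0 y = (max (1 - y ^ 2) 0) ^ (α / 2 - 1) := by unfold prof; simp
    rw [hp]
    rcases le_total y 1 with h' | h'
    · gcongr
      calc y ^ (Module.finrank ℝ (EN N) - 1) ≤ 1 := pow_le_one₀ hy0'.le h'
        _ ≤ _ := Real.one_le_rpow_of_pos_of_le_one_of_nonpos hy0' h' (by linarith)
    · rw [max_eq_right (by nlinarith), Real.zero_rpow (by linarith)]; simp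

lemma hB_line {N : ℕ} {α : ℝ} (x θ : EN N) (hθ : ‖θ‖ = 1) (t : ℝ) :
    hB N α (x + t • θ) = prof α (1 - ‖x‖ ^ 2) (inner ℝ x θ) t := by
  unfold hB prof
  rw [norm_add_sq_real, norm_smul, hθ, inner_smul_right, mul_one, Real.norm_eq_abs, sq_abs]
  congr 2; ring

lemma hB_line' {N : ℕ} {α : ℝ} (x θ : EN N) (hθ : ‖θ‖ = 1) (t : ℝ) :
    hB N α (x - t • θ) = prof α (1 - ‖x‖ ^ 2) (-(inner ℝ x θ)) t := by
  rw [← prof_neg, ← hB_line x θ hθ, neg_smul, sub_eq_add_neg]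

lemma kJ_line {N : ℕ} (hN : 3 ≤ N) {α ε : ℝ} (θ : EN N) (hθ : ‖θ‖ = 1)
    (G : ℝ → ℝ) (F : EN N → ℝ) (hG : ∀ t, 0 < t → F (t • θ) = G t) (hε : 0 < ε) :
    ∫ t in Ioi (0 : ℝ), t ^ (N - 1) * (kJ N α ε (t • θ) * F (t • θ)) =
      ∫ t in Ioi ε, t ^ (-1 - α) * G t := by
  have hcast : ((N - 1 : ℕ) : ℝ) = (N : ℝ) - 1 := by
    rw [Nat.cast_sub (by omega)]; simp
  rw [setIntegral_eq_of_subset_of_forall_sdiff_eq_zero measurableSet_Ioi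
    (Ioi_subset_Ioi hε.le)]
  · refine setIntegral_congr_fun measurableSet_Ioi fun t ht => ?_
    have ht' : ε < t := ht
    have ht0 : 0 < t := hε.trans ht'
    rw [hG t ht0]
    unfold kJ
    rw [norm_smul, hθ, mul_one, Real.norm_of_nonneg ht0.le, if_pos ht', ← mul_assoc,
      ← Real.rpow_natCast, hcast, ← Real.rpow_add ht0]
    congr 2; ring
  · intro t ht
    have ht0 : 0 < t := ht.1
    have : ¬ ε < t := ht.2
    unfold kJ
    rw [norm_smul, hθ, mul_one, Real.norm_of_nonneg ht0.le, if_neg this]; simp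

lemma h_harm {N : ℕ} (hN : 3 ≤ N) {α : ℝ} (hα0 : 0 < α) (hα2 : α < 2) {r : ℝ} (hr0 : 0 ≤ r)
    (hr : r < 1) :
    ∃ C ε0 : ℝ, 0 ≤ C ∧ 0 < ε0 ∧ ∀ ε, 0 < ε → ε ≤ ε0 → ∀ x : EN N, ‖x‖ ≤ r →
      |Leps N α ε (hB N α) x| ≤ C * ε ^ (2 - α) ∧
      ∀ e : EN N, ‖e‖ ≤ 1 →
        |Leps N α ε (fun y => inner ℝ e y * hB N α y) x| ≤ C * ε ^ (2 - α) := by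
  have hd0 : 0 < 1 - r ^ 2 := by nlinarith
  obtain ⟨C, hC, hb⟩ := prof_bounds hα0 hα2 hd0
  have hcp := coeff_pos (N := N) hα0 hα2
  have hM : 0 ≤ sphM N := measureReal_nonneg
  have hInt := hB_integrable hN hα0 hα2
  refine ⟨fracLapCoeff N α / 2 * (C * sphM N + C * sphM N), (1 - r ^ 2) / 6, by positivity,
    by positivity, ?_⟩
  intro ε hε hε0 x hx
  have hxd : 1 - r ^ 2 ≤ 1 - ‖x‖ ^ 2 := by nlinarith [norm_nonneg x]
  have hxd1 : 1 - ‖x‖ ^ 2 ≤ 1 := by nlinarith [norm_nonneg x]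
  have hx1 : ‖x‖ < 1 := by linarith
  have hεp : 0 ≤ ε ^ (2 - α) := by positivity
  have hin : ∀ θ : EN N, ‖θ‖ = 1 → |inner ℝ x θ| ≤ 1 := fun θ hθ => by
    refine (abs_real_inner_le_norm x θ).trans ?_
    rw [hθ]; linarith
  -- first integral
  have hA : |∫ z, kJ N α ε z * (hB N α (x + z) + hB N α (x - z) - 2 * hB N α x)| ≤
      C * ε ^ (2 - α) * sphM N := by
    refine polar_bound hN (by positivity) fun θ hθ => ?_
    rw [kJ_line hN θ hθ (fun t => prof α (1 - ‖x‖ ^ 2) (inner ℝ x θ) t +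
      prof α (1 - ‖x‖ ^ 2) (-(inner ℝ x θ)) t - 2 * (1 - ‖x‖ ^ 2) ^ (α / 2 - 1))
      (fun z => hB N α (x + z) + hB N α (x - z) - 2 * hB N α x) ?_ hε]
    · exact (hb _ _ ε hxd hxd1 (hin θ hθ) hε hε0).2
    · intro t _
      rw [hB_line x θ hθ, hB_line' x θ hθ, hB_in hx1]
  constructor
  · rw [Leps_symm hN hα0 hα2 hε hInt, abs_mul, abs_of_pos (by positivity), mul_assoc]
    gcongr
    refine hA.trans ?_
    nlinarith [mul_nonneg (mul_nonneg hC hM) hεp]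
  · intro e he
    have hB2 : |∫ z, kJ N α ε z * (inner ℝ e z * (hB N α (x + z) - hB N α (x - z)))| ≤
        C * ε ^ (2 - α) * sphM N := by
      refine polar_bound hN (by positivity) fun θ hθ => ?_
      rw [kJ_line hN θ hθ (fun t => t * inner ℝ e θ * (prof α (1 - ‖x‖ ^ 2) (inner ℝ x θ) t -
        prof α (1 - ‖x‖ ^ 2) (-(inner ℝ x θ)) t))
        (fun z => inner ℝ e z * (hB N α (x + z) - hB N α (x - z))) ?_ hε]
      · have h1 := (hb _ _ ε hxd hxd1 (hin θ hθ) hε hε0).1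
        have h2 : ∫ t in Ioi ε, t ^ (-1 - α) * (t * inner ℝ e θ *
            (prof α (1 - ‖x‖ ^ 2) (inner ℝ x θ) t - prof α (1 - ‖x‖ ^ 2) (-(inner ℝ x θ)) t)) =
            inner ℝ e θ * ∫ t in Ioi ε, t ^ (-α) *
            (prof α (1 - ‖x‖ ^ 2) (inner ℝ x θ) t - prof α (1 - ‖x‖ ^ 2) (-(inner ℝ x θ)) t) := by
          rw [← integral_const_mul]
          refine setIntegral_congr_fun measurableSet_Ioi fun t ht => ?_
          have ht0 : 0 < t := hε.trans ht
          have e2 : t ^ (-α) = t ^ (-1 - α) * t := by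
            rw [← Real.rpow_add_one ht0.ne']; ring_nf
          rw [e2]; ring
        rw [h2, abs_mul]
        have h3 : |inner ℝ e θ| ≤ 1 := by
          refine (abs_real_inner_le_norm e θ).trans ?_
          rw [hθ]; linarith
        calc _ ≤ 1 * (C * ε ^ (2 - α)) := by gcongr
          _ = _ := one_mul _
      · intro t _
        rw [hB_line x θ hθ, hB_line' x θ hθ, inner_smul_right]
    have hinte : Integrable (fun y => inner ℝ e y * hB N α y) := by
      refine Integrable.mono' hInt ?_ (Eventually.of_forall fun y => ?_)
      · refine AEStronglyMeasurable.mul ?_ hInt.1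
        exact (Continuous.inner continuous_const continuous_id).aestronglyMeasurable
      · rw [norm_mul, Real.norm_of_nonneg (hB_nonneg y), Real.norm_eq_abs]
        rcases lt_or_ge ‖y‖ 1 with h | h
        · have := abs_real_inner_le_norm e y
          have h3 : |inner ℝ e y| ≤ 1 := by nlinarith [norm_nonneg e, norm_nonneg y]
          have := hB_nonneg (α := α) y
          nlinarith
        · rw [hB_out hα2 h]; simp
    rw [Leps_symm hN hα0 hα2 hε hinte]
    have hk := kJ_integrable hN hα0 hα2 hε
    have hsub : ∀ {u : EN N → ℝ}, Integrable u →
        Integrable (fun z => kJ N α ε z * (u (x + z) + u (x - z) - 2 * u x)) := by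
      intro u hu
      have i1 := kJ_shift_integrable hα0 hε hu x
      have i2 : Integrable (fun z => kJ N α ε z * u (x - z)) := by
        have := i1.comp_neg
        refine this.congr (Eventually.of_forall fun z => ?_)
        simp only
        rw [kJ_neg, sub_eq_add_neg]
      refine ((i1.add i2).sub (hk.mul_const (2 * u x))).congr (Eventually.of_forall fun z => ?_)
      simp only [Pi.add_apply, Pi.sub_apply]; ring
    have hI1 := (hsub hInt).const_mul (inner ℝ e x)
    have hI2 : Integrable (fun z => kJ N α ε z *
        (inner ℝ e z * (hB N α (x + z) - hB N α (x - z)))) := by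
      refine ((hsub hinte).sub hI1).congr (Eventually.of_forall fun z => ?_)
      simp only [Pi.sub_apply, inner_add_right, inner_sub_right]; ring
    have hsplit : ∫ z, kJ N α ε z * (inner ℝ e (x + z) * hB N α (x + z) +
        inner ℝ e (x - z) * hB N α (x - z) - 2 * (inner ℝ e x * hB N α x)) =
        inner ℝ e x * (∫ z, kJ N α ε z * (hB N α (x + z) + hB N α (x - z) - 2 * hB N α x)) +
        ∫ z, kJ N α ε z * (inner ℝ e z * (hB N α (x + z) - hB N α (x - z))) := by
      rw [← integral_const_mul, ← integral_add hI1 hI2]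
      refine integral_congr_ae (Eventually.of_forall fun z => ?_)
      simp only [inner_add_right, inner_sub_right]; ring
    rw [hsplit, abs_mul, abs_of_pos (by positivity), mul_assoc]
    gcongr
    refine (abs_add_le _ _).trans ?_
    rw [abs_mul]
    have h3 : |inner ℝ e x| ≤ 1 := by
      refine (abs_real_inner_le_norm e x).trans ?_
      nlinarith [norm_nonneg e, norm_nonneg x]
    calc _ ≤ 1 * (C * ε ^ (2 - α) * sphM N) + C * ε ^ (2 - α) * sphM N := by gcongr
      _ = _ := by ring

/-- indicator of the ball -/
def WB (N : ℕ) (x : EN N) : ℝ := if ‖x‖ < 1 then 1 else 0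

lemma WB_in {N : ℕ} {x : EN N} (h : ‖x‖ < 1) : WB N x = 1 := if_pos h
lemma WB_out {N : ℕ} {x : EN N} (h : 1 ≤ ‖x‖) : WB N x = 0 := if_neg (not_lt.2 h)
lemma WB_nonneg {N : ℕ} (x : EN N) : 0 ≤ WB N x := by unfold WB; split_ifs <;> norm_num
lemma WB_le_one {N : ℕ} (x : EN N) : WB N x ≤ 1 := by unfold WB; split_ifs <;> norm_num
lemma WB_measurable {N : ℕ} : Measurable (WB N) := by
  unfold WB
  exact Measurable.ite (measurableSet_lt measurable_norm measurable_const) measurable_const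
    measurable_const
lemma WB_le_hB {N : ℕ} {α : ℝ} (hα2 : α < 2) (x : EN N) : WB N x ≤ hB N α x := by
  rcases lt_or_ge ‖x‖ 1 with h | h
  · rw [WB_in h]; exact hB_ge_one hα2 h
  · rw [WB_out h]; exact hB_nonneg x
lemma WB_integrable {N : ℕ} : Integrable (WB N) := by
  have : WB N = (ball (0 : EN N) 1).indicator (fun _ => (1 : ℝ)) := by
    funext x
    unfold WB indicator
    simp
  rw [this, integrable_indicator_iff measurableSet_ball]
  exact integrableOn_const (by exact measure_ball_lt_top.ne)

lemma exists_dir {N : ℕ} (hN : 3 ≤ N) (x : EN N) : ∃ θ : EN N, ‖θ‖ = 1 ∧ x = ‖x‖ • θ := by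
  rcases eq_or_ne x 0 with rfl | hx
  · refine ⟨EuclideanSpace.single ⟨0, by omega⟩ 1, by simp, by simp⟩
  · refine ⟨‖x‖⁻¹ • x, ?_, ?_⟩
    · rw [norm_smul, norm_inv, norm_norm, inv_mul_cancel₀ (norm_ne_zero_iff.2 hx)]
    · rw [smul_smul, mul_inv_cancel₀ (norm_ne_zero_iff.2 hx), one_smul]

/-- the constant in the exit estimate -/
def cOut (N : ℕ) (α : ℝ) : ℝ := 3 ^ (-((N : ℝ) + α)) * volume.real (ball (0 : EN N) 1)

lemma cOut_pos {N : ℕ} {α : ℝ} : 0 < cOut N α := by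
  unfold cOut
  have : 0 < volume.real (ball (0 : EN N) 1) := by
    refine ENNReal.toReal_pos (measure_ball_pos _ _ one_pos).ne' measure_ball_lt_top.ne
  positivity

lemma out_integrable {N : ℕ} (hN : 3 ≤ N) {α : ℝ} (hα0 : 0 < α) (hα2 : α < 2) {ε : ℝ}
    (hε : 0 < ε) (x : EN N) : Integrable (fun z => kJ N α ε z * (1 - WB N (x + z))) := by
  refine ((kJ_integrable hN hα0 hα2 hε).sub
    (kJ_shift_integrable hα0 hε WB_integrable x)).congr (Eventually.of_forall fun z => ?_)
  simp only [Pi.sub_apply]; ring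

lemma out_bound {N : ℕ} (hN : 3 ≤ N) {α : ℝ} (hα0 : 0 < α) (hα2 : α < 2) {x : EN N}
    (hx : ‖x‖ < 1) {ε : ℝ} (hε : 0 < ε) (hεx : ε ≤ 1 - ‖x‖) :
    cOut N α * (1 - ‖x‖ ^ 2) ^ (-α) ≤ ∫ z, kJ N α ε z * (1 - WB N (x + z)) := by
  have : Nonempty (Fin N) := ⟨⟨0, by omega⟩⟩
  obtain ⟨θ, hθ, hxθ⟩ := exists_dir hN x
  set δ := 1 - ‖x‖ with hδ
  have hδ0 : 0 < δ := by linarith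
  have hNn : (0 : ℝ) ≤ N := by positivity
  set A := ball ((2 * δ) • θ) δ with hA
  have hnc : ‖(2 * δ) • θ‖ = 2 * δ := by
    rw [norm_smul, hθ, mul_one, Real.norm_of_nonneg (by positivity)]
  have hzA : ∀ z ∈ A, δ < ‖z‖ ∧ ‖z‖ ≤ 3 * δ ∧ 1 ≤ ‖x + z‖ := by
    intro z hz
    rw [hA, mem_ball, dist_eq_norm] at hz
    have h1 := norm_sub_norm_le ((2 * δ) • θ) z
    have h2 := norm_sub_norm_le z ((2 * δ) • θ)
    rw [norm_sub_rev] at h1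
    rw [hnc] at h1 h2
    refine ⟨by linarith, by linarith, ?_⟩
    have h3 : ‖x + (2 * δ) • θ‖ = ‖x‖ + 2 * δ := by
      conv_lhs => rw [hxθ]
      rw [← add_smul, norm_smul, hθ, mul_one, Real.norm_of_nonneg (by positivity)]
    have h4 := norm_sub_norm_le (x + (2 * δ) • θ) (x + z)
    rw [add_sub_add_left_eq_sub, norm_sub_rev, h3] at h4
    linarith
  have hlow : ∀ z, A.indicator (fun _ => (3 * δ) ^ (-((N : ℝ) + α))) z ≤
      kJ N α ε z * (1 - WB N (x + z)) := by
    intro z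
    by_cases hz : z ∈ A
    · rw [indicator_of_mem hz]
      obtain ⟨h1, h2, h3⟩ := hzA z hz
      rw [WB_out h3, sub_zero, mul_one]
      unfold kJ
      rw [if_pos (by linarith)]
      exact Real.rpow_le_rpow_of_nonpos (by linarith) h2 (by linarith)
    · rw [indicator_of_notMem hz]
      exact mul_nonneg (kJ_nonneg z) (by linarith [WB_le_one (x + z)])
  have hAi : Integrable (A.indicator (fun _ : EN N => (3 * δ) ^ (-((N : ℝ) + α)))) := by
    rw [integrable_indicator_iff measurableSet_ball]
    exact integrableOn_const (by exact measure_ball_lt_top.ne)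
  have h1 := integral_mono hAi (out_integrable hN hα0 hα2 hε x) hlow
  refine le_trans ?_ h1
  rw [integral_indicator measurableSet_ball, setIntegral_const, smul_eq_mul]
  have hvol : volume.real A = δ ^ N * volume.real (ball (0 : EN N) 1) := by
    rw [hA, Measure.real, Measure.addHaar_ball _ _ hδ0.le, ENNReal.toReal_mul,
      ENNReal.toReal_ofReal (by positivity)]
    simp [Measure.real]
  rw [hvol]
  unfold cOut
  have e1 : δ ^ N * volume.real (ball (0 : EN N) 1) * (3 * δ) ^ (-((N : ℝ) + α)) =
      3 ^ (-((N : ℝ) + α)) * volume.real (ball (0 : EN N) 1) * δ ^ (-α) := by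
    rw [Real.mul_rpow (by norm_num) hδ0.le]
    have : δ ^ (-α) = δ ^ N * δ ^ (-((N : ℝ) + α)) := by
      rw [← Real.rpow_natCast, ← Real.rpow_add hδ0]; congr 1; ring
    rw [this]; ring
  rw [e1]
  have hv : 0 ≤ volume.real (ball (0 : EN N) 1) := measureReal_nonneg
  gcongr ?_ * ?_
  refine Real.rpow_le_rpow_of_nonpos hδ0 ?_ (by linarith)
  rw [hδ]
  nlinarith [norm_nonneg x]

lemma out_bound' {N : ℕ} (hN : 3 ≤ N) {α : ℝ} (hα0 : 0 < α) (hα2 : α < 2) {x : EN N}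
    (hx : ‖x‖ < 1) {ε : ℝ} (hε : 0 < ε) (hεx : ε ≤ 1 - ‖x‖) :
    cOut N α ≤ ∫ z, kJ N α ε z * (1 - WB N (x + z)) := by
  refine le_trans ?_ (out_bound hN hα0 hα2 hx hε hεx)
  refine le_mul_of_one_le_right cOut_pos.le ?_
  refine Real.one_le_rpow_of_pos_of_le_one_of_nonpos ?_ ?_ (by linarith) <;>
    nlinarith [norm_nonneg x]

lemma Leps_WB {N : ℕ} (hN : 3 ≤ N) {α : ℝ} (hα0 : 0 < α) (hα2 : α < 2) {x : EN N}
    (hx : ‖x‖ < 1) {ε : ℝ} (hε : 0 < ε) (hεx : ε ≤ 1 - ‖x‖) :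
    Leps N α ε (WB N) x ≤ -(fracLapCoeff N α * cOut N α) := by
  have h := out_bound' hN hα0 hα2 hx hε hεx
  have hcp := coeff_pos (N := N) hα0 hα2
  unfold Leps
  rw [WB_in hx]
  have : ∀ z, kJ N α ε z * (WB N (x + z) - 1) = -(kJ N α ε z * (1 - WB N (x + z))) :=
    fun z => by ring
  simp_rw [this]
  rw [integral_neg, mul_neg]
  gcongr

/-- the comparison principle -/
lemma comparison {N : ℕ} (hN : 3 ≤ N) {α : ℝ} (hα0 : 0 < α) (hα2 : α < 2) {r ε : ℝ}
    (hr : r < 1) (hε : 0 < ε) (hεr : ε ≤ 1 - r) {w : EN N → ℝ} (hw : Integrable w)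
    (hbd : ∃ M, ∀ x, ‖x‖ ≤ r → w x ≤ M) (hout : ∀ x, r < ‖x‖ → w x ≤ 0)
    (hL : ∀ x, ‖x‖ ≤ r → 0 < w x → 0 ≤ Leps N α ε w x) : ∀ x, w x ≤ 0 := by
  by_contra hcon
  push Not at hcon
  obtain ⟨x0, hx0⟩ := hcon
  have hx0r : ‖x0‖ ≤ r := by
    by_contra h
    exact absurd (hout x0 (not_le.1 h)) (not_le.2 hx0)
  obtain ⟨M0, hM0⟩ := hbd
  set S := w '' {x | ‖x‖ ≤ r} with hS
  have hSb : BddAbove S := ⟨M0, by rintro _ ⟨x, hx, rfl⟩; exact hM0 x hx⟩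
  have hSn : S.Nonempty := ⟨_, x0, hx0r, rfl⟩
  set M := sSup S with hM
  have hle : ∀ x, ‖x‖ ≤ r → w x ≤ M := fun x hx => le_csSup hSb ⟨x, hx, rfl⟩
  have hMpos : 0 < M := hx0.trans_le (hle x0 hx0r)
  have hWle : ∀ y, w y ≤ M * WB N y := by
    intro y
    rcases lt_or_ge ‖y‖ 1 with h | h
    · rw [WB_in h, mul_one]
      rcases le_or_gt ‖y‖ r with h' | h'
      · exact hle y h'
      · exact (hout y h').trans hMpos.le
    · rw [WB_out h, mul_zero]
      exact hout y (by linarith)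
  have hcp := coeff_pos (N := N) hα0 hα2
  have hk := kJ_integrable hN hα0 hα2 hε
  set m := ∫ z, kJ N α ε z with hm
  have hc1 := cOut_pos (N := N) (α := α)
  have key : ∀ x, ‖x‖ ≤ r → 0 < w x → w x * m ≤ M * (m - cOut N α) := by
    intro x hx hwx
    have h1 := hL x hx hwx
    rw [Leps_eq hN hα0 hα2 hε hw] at h1
    have h2 : 0 ≤ (∫ z, kJ N α ε z * w (x + z)) - m * w x := by
      by_contra h; push Not at h
      have := mul_neg_of_pos_of_neg hcp h
      linarith
    have h3 : ∫ z, kJ N α ε z * w (x + z) ≤ ∫ z, M * (kJ N α ε z * WB N (x + z)) := by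
      refine integral_mono (kJ_shift_integrable hα0 hε hw x)
        ((kJ_shift_integrable hα0 hε WB_integrable x).const_mul M) fun z => ?_
      have := mul_le_mul_of_nonneg_left (hWle (x + z)) (kJ_nonneg (α := α) (ε := ε) z)
      simp only
      linarith
    rw [integral_const_mul] at h3
    have h4 := out_bound' hN hα0 hα2 (x := x) (by linarith) hε (by linarith)
    have h5 : ∫ z, kJ N α ε z * (1 - WB N (x + z)) = m - ∫ z, kJ N α ε z * WB N (x + z) := by
      simp_rw [mul_sub, mul_one]
      rw [integral_sub hk (kJ_shift_integrable hα0 hε WB_integrable x)]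
    have h6 : M * (∫ z, kJ N α ε z * WB N (x + z)) ≤ M * (m - cOut N α) := by
      gcongr; linarith
    linarith
  have hmpos : 0 < m := by
    have := key x0 hx0r hx0
    by_contra h
    push Not at h
    have h0 : 0 ≤ m := integral_nonneg fun z => kJ_nonneg z
    have : m = 0 := le_antisymm h h0
    rw [this] at key
    have := key x0 hx0r hx0
    nlinarith
  have hMm : M ≤ M * (m - cOut N α) / m := by
    have hge : 0 ≤ M * (m - cOut N α) / m := by
      have := key x0 hx0r hx0
      apply div_nonneg _ hmpos.le
      have : 0 < w x0 * m := by positivity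
      linarith
    refine csSup_le hSn ?_
    rintro _ ⟨x, hx, rfl⟩
    rcases le_or_gt (w x) 0 with h | h
    · linarith
    · rw [le_div_iff₀ hmpos]
      exact key x hx h
  rw [le_div_iff₀ hmpos] at hMm
  nlinarith

/-- the auxiliary barrier `h^θ` -/
def VB (N : ℕ) (α θ : ℝ) (x : EN N) : ℝ := hB N α x ^ θ

lemma VB_nonneg {N : ℕ} {α θ : ℝ} (x : EN N) : 0 ≤ VB N α θ x :=
  Real.rpow_nonneg (hB_nonneg x) _

lemma VB_out {N : ℕ} {α θ : ℝ} (hα2 : α < 2) (hθ : 0 < θ) {x : EN N} (hx : 1 ≤ ‖x‖) :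
    VB N α θ x = 0 := by
  unfold VB; rw [hB_out hα2 hx, Real.zero_rpow hθ.ne']

lemma VB_le_hB {N : ℕ} {α θ : ℝ} (hα2 : α < 2) (hθ : 0 < θ) (hθ1 : θ < 1) (x : EN N) :
    VB N α θ x ≤ hB N α x := by
  rcases lt_or_ge ‖x‖ 1 with h | h
  · unfold VB
    exact Real.rpow_le_self_of_one_le (hB_ge_one hα2 h) hθ1.le
  · rw [VB_out hα2 hθ h]; exact hB_nonneg x

lemma VB_measurable {N : ℕ} {α θ : ℝ} : Measurable (VB N α θ) := by
  unfold VB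
  exact hB_measurable.pow_const θ

lemma VB_integrable {N : ℕ} (hN : 3 ≤ N) {α θ : ℝ} (hα0 : 0 < α) (hα2 : α < 2) (hθ : 0 < θ)
    (hθ1 : θ < 1) : Integrable (VB N α θ) := by
  refine Integrable.mono' (hB_integrable hN hα0 hα2) VB_measurable.aestronglyMeasurable
    (Eventually.of_forall fun x => ?_)
  rw [Real.norm_of_nonneg (VB_nonneg x)]
  exact VB_le_hB hα2 hθ hθ1 x

lemma V_super {N : ℕ} (hN : 3 ≤ N) {α γ : ℝ} (hα0 : 0 < α) (hα2 : α < 2)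
    (hγ1 : γ < (2 + α) / (2 - α)) :
    ∃ θ c2 : ℝ, 0 < θ ∧ θ < 1 ∧ 0 < c2 ∧ ∀ x : EN N, ‖x‖ < 1 → ∀ ε, 0 < ε → ε ≤ 1 - ‖x‖ →
      Leps N α ε (VB N α θ) x ≤ |Leps N α ε (hB N α) x| - c2 * hB N α x ^ γ := by
  set θ := max (1 / 2) (γ - α / (1 - α / 2)) with hθd
  have hθ0 : 0 < θ := lt_of_lt_of_le (by norm_num) (le_max_left _ _)
  have ha2 : 0 < 1 - α / 2 := by linarith
  have hθ1 : θ < 1 := by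
    refine max_lt (by norm_num) ?_
    have : (2 + α) / (2 - α) = 1 + α / (1 - α / 2) := by
      have : 2 - α ≠ 0 := by linarith
      have : 1 - α / 2 ≠ 0 := ha2.ne'
      field_simp
      ring
    linarith
  have hθ2 : γ * (1 - α / 2) ≤ α + θ * (1 - α / 2) := by
    have : γ - α / (1 - α / 2) ≤ θ := le_max_right _ _
    rw [sub_le_iff_le_add] at this
    have h2 := mul_le_mul_of_nonneg_right this ha2.le
    rw [add_mul, div_mul_cancel₀ _ ha2.ne'] at h2
    linarith
  have hcp := coeff_pos (N := N) hα0 hα2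
  have hc1 := cOut_pos (N := N) (α := α)
  refine ⟨θ, fracLapCoeff N α * ((1 - θ) * cOut N α), hθ0, hθ1,
    mul_pos hcp (mul_pos (by linarith) hc1), ?_⟩
  intro x hx ε hε hεx
  have hh1 := hB_ge_one hα2 hx
  have hh0 : 0 < hB N α x := by linarith
  have hVi := VB_integrable hN hα0 hα2 hθ0 hθ1
  have hhi := hB_integrable hN hα0 hα2
  have hd : 0 < 1 - ‖x‖ ^ 2 := by nlinarith [norm_nonneg x]
  have hd1 : 1 - ‖x‖ ^ 2 ≤ 1 := by nlinarith [norm_nonneg x]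
  set a := θ * hB N α x ^ (θ - 1) with ha
  have hpt : ∀ y, VB N α θ y - VB N α θ x ≤ a * (hB N α y - hB N α x) -
      (1 - θ) * VB N α θ x * (1 - WB N y) := by
    intro y
    have e1 : VB N α θ x = hB N α x ^ (θ - 1) * hB N α x := by
      unfold VB; rw [← Real.rpow_add_one hh0.ne']; ring_nf
    rcases lt_or_ge ‖y‖ 1 with h | h
    · rw [WB_in h, sub_self, mul_zero, sub_zero]
      have hb := rpow_one_add_le_one_add_mul_self (s := hB N α y / hB N α x - 1) (p := θ)
        (by have : 0 ≤ hB N α y / hB N α x := div_nonneg (hB_nonneg y) hh0.le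
            linarith) hθ0.le hθ1.le
      rw [add_sub_cancel, Real.div_rpow (hB_nonneg y) hh0.le, div_le_iff₀ (by positivity)] at hb
      have e2 : (1 + θ * (hB N α y / hB N α x - 1)) * hB N α x ^ θ =
          VB N α θ x + a * (hB N α y - hB N α x) := by
        have : hB N α x ^ θ = hB N α x ^ (θ - 1) * hB N α x := e1
        rw [e1, this, ha]; field_simp
      rw [e2] at hb
      have : VB N α θ y = hB N α y ^ θ := rfl
      linarith
    · rw [WB_out h, VB_out hα2 hθ0 h, hB_out hα2 h, e1, ha]
      apply le_of_eq; ring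
  have hI1 := (kJ_diff_integrable hN hα0 hα2 hε hhi x).const_mul a
  have hI2 := (out_integrable hN hα0 hα2 hε x).const_mul ((1 - θ) * VB N α θ x)
  have h1 : ∫ z, kJ N α ε z * (VB N α θ (x + z) - VB N α θ x) ≤
      a * (∫ z, kJ N α ε z * (hB N α (x + z) - hB N α x)) -
      ((1 - θ) * VB N α θ x) * ∫ z, kJ N α ε z * (1 - WB N (x + z)) := by
    rw [← integral_const_mul, ← integral_const_mul, ← integral_sub hI1 hI2]
    refine integral_mono (kJ_diff_integrable hN hα0 hα2 hε hVi x) (hI1.sub hI2) fun z => ?_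
    have := mul_le_mul_of_nonneg_left (hpt (x + z)) (kJ_nonneg (α := α) (ε := ε) z)
    simp only
    linarith
  have h2 := mul_le_mul_of_nonneg_left h1 hcp.le
  have h3 : Leps N α ε (VB N α θ) x ≤ a * Leps N α ε (hB N α) x -
      fracLapCoeff N α * (((1 - θ) * VB N α θ x) * ∫ z, kJ N α ε z * (1 - WB N (x + z))) := by
    unfold Leps; linarith
  refine h3.trans ?_
  have ha1 : |a| ≤ 1 := by
    have p1 : hB N α x ^ (θ - 1) ≤ 1 := Real.rpow_le_one_of_one_le_of_nonpos hh1 (by linarith)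
    have p0 : 0 ≤ hB N α x ^ (θ - 1) := by positivity
    rw [abs_of_nonneg (by positivity), ha]
    nlinarith
  have h4 : a * Leps N α ε (hB N α) x ≤ |Leps N α ε (hB N α) x| := by
    refine (le_abs_self _).trans ?_
    rw [abs_mul]
    exact mul_le_of_le_one_left (abs_nonneg _) ha1
  have h5 : (1 - θ) * cOut N α * hB N α x ^ γ ≤
      ((1 - θ) * VB N α θ x) * ∫ z, kJ N α ε z * (1 - WB N (x + z)) := by
    have ho := out_bound hN hα0 hα2 hx hε hεx
    have e3 : hB N α x ^ γ ≤ VB N α θ x * (1 - ‖x‖ ^ 2) ^ (-α) := by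
      unfold VB
      rw [hB_in hx, ← Real.rpow_mul hd.le, ← Real.rpow_mul hd.le, ← Real.rpow_add hd]
      exact Real.rpow_le_rpow_of_exponent_ge hd hd1 (by linarith)
    calc (1 - θ) * cOut N α * hB N α x ^ γ ≤
        (1 - θ) * cOut N α * (VB N α θ x * (1 - ‖x‖ ^ 2) ^ (-α)) := by
          have : 0 ≤ (1 - θ) * cOut N α := mul_nonneg (by linarith) hc1.le
          gcongr
      _ = ((1 - θ) * VB N α θ x) * (cOut N α * (1 - ‖x‖ ^ 2) ^ (-α)) := by ring
      _ ≤ _ := by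
          have : 0 ≤ (1 - θ) * VB N α θ x := mul_nonneg (by linarith) (VB_nonneg x)
          gcongr
  have h6 := mul_le_mul_of_nonneg_left h5 hcp.le
  linarith

lemma exists_phi_inv {A γ : ℝ} (hA : 0 < A) (hγ : 0 < γ) :
    ∃ Ψ : ℝ → ℝ, Continuous Ψ ∧ Monotone Ψ ∧ Ψ 0 = 0 ∧
      (∀ s, A * Ψ s + (max (Ψ s) 0) ^ γ = s) ∧ ∀ s y, 0 ≤ s → y ≤ A * s → Ψ y ≤ s := by
  have hmono : StrictMono (fun s : ℝ => A * s + (max s 0) ^ γ) := by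
    intro s t hst
    have h1 : (max s 0) ^ γ ≤ (max t 0) ^ γ :=
      Real.rpow_le_rpow (le_max_right _ _) (max_le_max_right _ hst.le) hγ.le
    have h2 : A * s < A * t := by gcongr
    simp only
    linarith
  have hcont : Continuous (fun s : ℝ => A * s + (max s 0) ^ γ) := by
    refine (continuous_const.mul continuous_id).add ?_
    exact (continuous_id.max continuous_const).rpow_const fun s => Or.inr hγ.le
  have hsurj : Function.Surjective (fun s : ℝ => A * s + (max s 0) ^ γ) := by
    refine hcont.surjective ?_ ?_
    · refine tendsto_atTop_mono (f := fun s => A * s) (fun s => ?_)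
        (tendsto_id.const_mul_atTop hA)
      have : 0 ≤ (max s 0) ^ γ := by positivity
      linarith
    · have h1 : Tendsto (fun s : ℝ => A * s) atBot atBot := tendsto_id.const_mul_atBot hA
      refine h1.congr' ?_
      filter_upwards [eventually_le_atBot 0] with s hs
      rw [max_eq_right hs, Real.zero_rpow hγ.ne', add_zero]
  set e := StrictMono.orderIsoOfSurjective _ hmono hsurj with he
  have heq : ∀ s, e s = A * s + (max s 0) ^ γ := fun s => rfl
  have hinv : ∀ s, A * e.symm s + (max (e.symm s) 0) ^ γ = s := fun s => by
    rw [← heq]; exact e.apply_symm_apply s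
  refine ⟨e.symm, e.symm.continuous, e.symm.monotone, ?_, hinv, ?_⟩
  · rw [e.symm_apply_eq, heq]; simp [Real.zero_rpow hγ.ne']
  · intro s y hs hy
    rw [e.symm_apply_le, heq]
    have : 0 ≤ (max s 0) ^ γ := by positivity
    linarith

lemma discrete_solution {N : ℕ} (hN : 3 ≤ N) {α γ : ℝ} (hα0 : 0 < α) (hα2 : α < 2) (hγ : 0 < γ)
    {r ε : ℝ} (hε : 0 < ε) (hε1 : ε ≤ 1) {f S : EN N → ℝ} (hf : Measurable f)
    (hf0 : ∀ x, 0 ≤ f x) (hfS : ∀ x, f x ≤ S x) (hSi : Integrable S)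
    (hSL : ∀ x, ‖x‖ ≤ r → Leps N α ε S x ≤ 0) :
    ∃ u : EN N → ℝ, Measurable u ∧ (∀ x, 0 ≤ u x) ∧ (∀ x, u x ≤ S x) ∧
      (∀ x, r < ‖x‖ → u x = f x) ∧ ∀ x, ‖x‖ ≤ r → Leps N α ε u x = u x ^ γ := by
  have hcp := coeff_pos (N := N) hα0 hα2
  have hk := kJ_integrable hN hα0 hα2 hε
  set c := fracLapCoeff N α with hc
  set m := ∫ z, kJ N α ε z with hm
  have hm0 : 0 < m := by
    have h1 := out_bound' hN hα0 hα2 (x := 0) (by simp) hε (by simpa using hε1)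
    have h2 : ∫ z, kJ N α ε z * (1 - WB N (0 + z)) ≤ m := by
      refine integral_mono (out_integrable hN hα0 hα2 hε 0) hk fun z => ?_
      refine mul_le_of_le_one_right (kJ_nonneg z) ?_
      linarith [WB_nonneg (0 + z)]
    linarith [cOut_pos (N := N) (α := α)]
  have hA : 0 < c * m := by positivity
  obtain ⟨Ψ, hΨc, hΨm, hΨ0, hΨi, hΨle⟩ := exists_phi_inv hA hγ
  have hS0 : ∀ x, 0 ≤ S x := fun x => (hf0 x).trans (hfS x)
  let T : (EN N → ℝ) → EN N → ℝ := fun u x =>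
    if ‖x‖ ≤ r then Ψ (c * ∫ z, kJ N α ε z * u (x + z)) else f x
  have hTm : ∀ u, Measurable u → Measurable (T u) := by
    intro u hu
    refine Measurable.ite (measurableSet_le measurable_norm measurable_const) ?_ hf
    refine hΨc.measurable.comp ?_
    refine Measurable.const_mul ?_ c
    have : StronglyMeasurable (fun p : EN N × EN N => kJ N α ε p.2 * u (p.1 + p.2)) := by
      refine Measurable.stronglyMeasurable ?_
      exact (kJ_measurable.comp measurable_snd).mul
        (hu.comp (measurable_fst.add measurable_snd))
    exact this.integral_prod_right.measurable
  have hInt : ∀ u, Measurable u → (∀ x, 0 ≤ u x) → (∀ x, u x ≤ S x) → Integrable u := by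
    intro u hu h0 h1
    refine Integrable.mono' hSi hu.aestronglyMeasurable (Eventually.of_forall fun x => ?_)
    rw [Real.norm_of_nonneg (h0 x)]; exact h1 x
  have hImono : ∀ u v : EN N → ℝ, Integrable u → Integrable v → (∀ x, u x ≤ v x) → ∀ x,
      c * ∫ z, kJ N α ε z * u (x + z) ≤ c * ∫ z, kJ N α ε z * v (x + z) := by
    intro u v hu hv huv x
    refine mul_le_mul_of_nonneg_left ?_ hcp.le
    refine integral_mono (kJ_shift_integrable hα0 hε hu x) (kJ_shift_integrable hα0 hε hv x)
      fun z => ?_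
    exact mul_le_mul_of_nonneg_left (huv _) (kJ_nonneg z)
  have hTmono : ∀ u v : EN N → ℝ, Integrable u → Integrable v → (∀ x, u x ≤ v x) →
      ∀ x, T u x ≤ T v x := by
    intro u v hu hv huv x
    simp only [T]
    split_ifs
    · exact hΨm (hImono u v hu hv huv x)
    · exact le_rfl
  have hTS : ∀ x, T S x ≤ S x := by
    intro x
    simp only [T]
    split_ifs with hx
    · refine hΨle _ _ (hS0 x) ?_
      have := hSL x hx
      rw [Leps_eq hN hα0 hα2 hε hSi] at this
      rw [← hm, ← hc] at this
      linarith
    · exact hfS x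
  let U : ℕ → EN N → ℝ := fun k => T^[k] (fun _ => 0)
  have hUs : ∀ k, U (k + 1) = T (U k) := fun k => Function.iterate_succ_apply' T k _
  have hU0 : U 0 = fun _ => 0 := rfl
  have hprop : ∀ k, Measurable (U k) ∧ (∀ x, 0 ≤ U k x) ∧ (∀ x, U k x ≤ S x) := by
    intro k
    induction k with
    | zero => exact ⟨by rw [hU0]; exact measurable_const, fun x => le_rfl, fun x => hS0 x⟩
    | succ k ih =>
      obtain ⟨h1, h2, h3⟩ := ih
      rw [hUs]
      have hi := hInt _ h1 h2 h3
      refine ⟨hTm _ h1, fun x => ?_, fun x => (hTmono _ _ hi hSi h3 x).trans (hTS x)⟩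
      simp only [T]
      split_ifs
      · rw [← hΨ0]
        refine hΨm (mul_nonneg hcp.le (integral_nonneg fun z => ?_))
        exact mul_nonneg (kJ_nonneg z) (h2 _)
      · exact hf0 x
  have hUi : ∀ k, Integrable (U k) := fun k => hInt _ (hprop k).1 (hprop k).2.1 (hprop k).2.2
  have hUmono : ∀ k x, U k x ≤ U (k + 1) x := by
    intro k
    induction k with
    | zero => intro x; exact (hprop 1).2.1 x
    | succ k ih =>
      intro x
      have := hTmono _ _ (hUi k) (hUi (k + 1)) ih x
      rw [← hUs, ← hUs] at this
      exact this
  have hUm : ∀ x, Monotone (fun k => U k x) := fun x => monotone_nat_of_le_succ fun k => hUmono k x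
  have hUb : ∀ x, BddAbove (range fun k => U k x) := fun x =>
    ⟨S x, by rintro _ ⟨k, rfl⟩; exact (hprop k).2.2 x⟩
  have hlim : ∀ x, Tendsto (fun k => U k x) atTop (𝓝 (⨆ k, U k x)) := fun x =>
    tendsto_atTop_ciSup (hUm x) (hUb x)
  set u : EN N → ℝ := fun x => ⨆ k, U k x with hu
  have hum : Measurable u := measurable_of_tendsto_metrizable (fun k => (hprop k).1)
    (tendsto_pi_nhds.2 hlim)
  have hu0 : ∀ x, 0 ≤ u x := fun x => ge_of_tendsto' (hlim x) fun k => (hprop k).2.1 x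
  have huS : ∀ x, u x ≤ S x := fun x => le_of_tendsto' (hlim x) fun k => (hprop k).2.2 x
  have hfix : ∀ x, u x = T u x := by
    intro x
    have h1 : Tendsto (fun k => U (k + 1) x) atTop (𝓝 (u x)) :=
      (hlim x).comp (tendsto_add_atTop_nat 1)
    have h2 : Tendsto (fun k => T (U k) x) atTop (𝓝 (T u x)) := by
      simp only [T]
      split_ifs
      · refine (hΨc.tendsto _).comp (Tendsto.const_mul _ ?_)
        refine tendsto_integral_of_dominated_convergence (fun z => kJ N α ε z * S (x + z))
          (fun k => (kJ_shift_integrable hα0 hε (hUi k) x).1)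
          (kJ_shift_integrable hα0 hε hSi x) ?_ ?_
        · refine fun k => Eventually.of_forall fun z => ?_
          rw [Real.norm_of_nonneg (mul_nonneg (kJ_nonneg z) ((hprop k).2.1 _))]
          exact mul_le_mul_of_nonneg_left ((hprop k).2.2 _) (kJ_nonneg z)
        · exact Eventually.of_forall fun z => (hlim (x + z)).const_mul _
      · exact tendsto_const_nhds
    simp_rw [← hUs] at h2
    exact tendsto_nhds_unique h1 h2
  refine ⟨u, hum, hu0, huS, ?_, ?_⟩
  · intro x hx
    rw [hfix x]
    simp only [T]
    rw [if_neg (not_le.2 hx)]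
  · intro x hx
    have h1 := hfix x
    simp only [T] at h1
    rw [if_pos hx] at h1
    have h2 := hΨi (c * ∫ z, kJ N α ε z * u (x + z))
    rw [← h1, max_eq_left (hu0 x)] at h2
    rw [Leps_eq hN hα0 hα2 hε (hInt u hum hu0 huS)]
    rw [← hm, ← hc]
    linarith

/-- discrete approximate solutions -/
structure Approx (N : ℕ) (α γ : ℝ) (g : EN N → ℝ) (G1 r ε η : ℝ) (u : EN N → ℝ) : Prop where
  r0 : 0 ≤ r
  r1 : r < 1
  ε0 : 0 < ε
  εr : ε ≤ 1 - r
  η0 : 0 < η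
  η1 : η ≤ 1
  harm : ∀ x : EN N, ‖x‖ ≤ r → |Leps N α ε (hB N α) x| ≤ η
  harm1 : ∀ x : EN N, ‖x‖ ≤ r → ∀ e : EN N, ‖e‖ ≤ 1 →
    |Leps N α ε (fun y => inner ℝ e y * hB N α y) x| ≤ η
  meas : Measurable u
  nonneg : ∀ x, 0 ≤ u x
  le : ∀ x, u x ≤ G1 * hB N α x
  out : ∀ x, r < ‖x‖ → u x = g x * hB N α x
  eq : ∀ x, ‖x‖ ≤ r → Leps N α ε u x = u x ^ γ

lemma Approx.integrable {N : ℕ} (hN : 3 ≤ N) {α γ : ℝ} (hα0 : 0 < α) (hα2 : α < 2)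
    {g : EN N → ℝ} {G1 r ε η : ℝ} {u : EN N → ℝ} (A : Approx N α γ g G1 r ε η u) :
    Integrable u := by
  refine ((hB_integrable hN hα0 hα2).const_mul G1).mono' A.meas.aestronglyMeasurable
    (Eventually.of_forall fun x => ?_)
  rw [Real.norm_eq_abs, abs_of_nonneg (A.nonneg x)]
  exact A.le x

lemma inner_hB_integrable {N : ℕ} (hN : 3 ≤ N) {α : ℝ} (hα0 : 0 < α) (hα2 : α < 2) (e : EN N)  :
    Integrable (fun y => inner ℝ e y * hB N α y) := by
  refine ((hB_integrable hN hα0 hα2).const_mul ‖e‖).mono'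
    (by have := hB_measurable (N := N) (α := α); exact (by fun_prop : Measurable _).aestronglyMeasurable)
    (Eventually.of_forall fun x => ?_)
  rw [Real.norm_eq_abs, abs_mul, abs_of_nonneg (hB_nonneg x)]
  by_cases hx : 1 ≤ ‖x‖
  · rw [hB_out hα2 hx]; simp
  · refine mul_le_mul_of_nonneg_right ?_ (hB_nonneg x)
    refine (abs_real_inner_le_norm e x).trans ?_
    exact mul_le_of_le_one_right (norm_nonneg _) (not_le.1 hx).le

/-- bounds on compact subballs -/
lemma hB_bdd {N : ℕ} {α : ℝ} {r : ℝ} (hr : r < 1) : ∃ H, 1 ≤ H ∧ ∀ x : EN N, ‖x‖ ≤ r → hB N α x ≤ H := by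
  have hc : IsCompact (closedBall (0 : EN N) r) := isCompact_closedBall _ _
  have := hc.bddAbove_image (f := hB N α) (hB_continuousOn.mono (closedBall_subset_ball hr))
  obtain ⟨H, hH⟩ := this
  refine ⟨max H 1, le_max_right _ _, fun x hx => (hH ⟨x, by simpa using hx, rfl⟩).trans (le_max_left _ _)⟩

/-- existence of good radii -/
lemma seq_exists {N : ℕ} (hN : 3 ≤ N) {α : ℝ} (hα0 : 0 < α) (hα2 : α < 2) (n : ℕ) :
    ∃ ε : ℝ, 0 < ε ∧ ε ≤ 1 / ((n : ℝ) + 2) ∧ ∀ x : EN N, ‖x‖ ≤ 1 - 1 / ((n : ℝ) + 2) →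
      |Leps N α ε (hB N α) x| ≤ 1 / ((n : ℝ) + 1) ∧ ∀ e : EN N, ‖e‖ ≤ 1 →
        |Leps N α ε (fun y => inner ℝ e y * hB N α y) x| ≤ 1 / ((n : ℝ) + 1) := by
  have hn : (0 : ℝ) < (n : ℝ) + 2 := by positivity
  have hr0 : 0 ≤ 1 - 1 / ((n : ℝ) + 2) := by
    rw [sub_nonneg, div_le_one hn]; linarith [Nat.cast_nonneg (α := ℝ) n]
  have hr1 : 1 - 1 / ((n : ℝ) + 2) < 1 := by
    have : 0 < 1 / ((n : ℝ) + 2) := by positivity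
    linarith
  obtain ⟨C, ε0, hC, hε0, hh⟩ := h_harm (N := N) hN hα0 hα2 hr0 hr1
  have ht : Tendsto (fun ε : ℝ => C * ε ^ (2 - α)) (𝓝[>] 0) (𝓝 0) := by
    have h1 : Tendsto (fun ε : ℝ => ε ^ (2 - α)) (𝓝[>] 0) (𝓝 (0 ^ (2 - α))) :=
      ((Real.continuousAt_rpow_const 0 (2 - α) (Or.inr (by linarith))).tendsto).mono_left
        nhdsWithin_le_nhds
    rw [Real.zero_rpow (by linarith)] at h1
    simpa using h1.const_mul C
  have h1 := ht.eventually (ge_mem_nhds (show (0 : ℝ) < 1 / ((n : ℝ) + 1) by positivity))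
  have h2 : ∀ᶠ ε : ℝ in 𝓝[>] 0, ε ≤ ε0 :=
    (ge_mem_nhds hε0).filter_mono nhdsWithin_le_nhds
  have h3 : ∀ᶠ ε : ℝ in 𝓝[>] 0, ε ≤ 1 / ((n : ℝ) + 2) :=
    (ge_mem_nhds (show (0 : ℝ) < 1 / ((n : ℝ) + 2) by positivity)).filter_mono nhdsWithin_le_nhds
  have h4 : ∀ᶠ ε : ℝ in 𝓝[>] 0, 0 < ε := eventually_mem_nhdsWithin
  obtain ⟨ε, a1, a2, a3, a4⟩ := (h1.and (h2.and (h3.and h4))).exists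
  refine ⟨ε, a4, a3, fun x hx => ?_⟩
  have := hh ε a4 a2 x hx
  exact ⟨this.1.trans a1, fun e he => (this.2 e he).trans a1⟩

/-- existence of approximate solutions -/
lemma approx_exists {N : ℕ} (hN : 3 ≤ N) {α γ : ℝ} (hα0 : 0 < α) (hα2 : α < 2) (hγ : 0 < γ)
    {g : EN N → ℝ} (hg : Continuous g) (hg0 : ∀ x, 0 ≤ g x) {G : ℝ} (hG : ∀ x, g x ≤ G) :
    ∃ G1 : ℝ, 0 < G1 ∧ ∀ n : ℕ, ∃ ε u, ε ≤ 1 / ((n : ℝ) + 2) ∧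
      Approx N α γ g G1 (1 - 1 / ((n : ℝ) + 2)) ε (1 / ((n : ℝ) + 1)) u := by
  have hcp := coeff_pos (N := N) hα0 hα2
  have hc1 := cOut_pos (N := N) (α := α)
  have hG0 : 0 ≤ G := (hg0 0).trans (hG 0)
  set q := fracLapCoeff N α * cOut N α with hq
  have hq0 : 0 < q := mul_pos hcp hc1
  refine ⟨G + G / q + 1, by positivity, fun n => ?_⟩
  obtain ⟨ε, hε, hε1, hh⟩ := seq_exists (N := N) hN hα0 hα2 n
  have hn : (0 : ℝ) < (n : ℝ) + 2 := by positivity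
  have hnn : (0 : ℝ) < (n : ℝ) + 1 := by positivity
  have hle1 : 1 / ((n : ℝ) + 2) ≤ 1 := by
    rw [div_le_one hn]; linarith [Nat.cast_nonneg (α := ℝ) n]
  have hle2 : 1 / ((n : ℝ) + 1) ≤ 1 := by
    rw [div_le_one hnn]; linarith [Nat.cast_nonneg (α := ℝ) n]
  set η := 1 / ((n : ℝ) + 1) with hη
  have hη0 : 0 < η := by positivity
  set r := 1 - 1 / ((n : ℝ) + 2) with hr
  have hr1 : r < 1 := by
    have : 0 < 1 / ((n : ℝ) + 2) := by positivity
    linarith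
  have hhi := hB_integrable (N := N) hN hα0 hα2
  have hWi := WB_integrable (N := N)
  have hSL : ∀ x : EN N, ‖x‖ ≤ r →
      Leps N α ε (fun y => G * hB N α y + (G * η / q) * WB N y) x ≤ 0 := by
    intro x hx
    rw [Leps_add hN hα0 hα2 hε (hhi.const_mul G) (hWi.const_mul _), Leps_smul, Leps_smul]
    have h1 := Leps_WB (N := N) hN hα0 hα2 (x := x) (hx.trans_lt hr1) hε (by linarith)
    have h2 := (abs_le.1 (hh x hx).1).2
    have h3 : G * η / q * Leps N α ε (WB N) x ≤ G * η / q * (-q) :=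
      mul_le_mul_of_nonneg_left h1 (by positivity)
    have h4 : G * η / q * (-q) = - (G * η) := by field_simp
    have h5 := mul_le_mul_of_nonneg_left h2 hG0
    linarith
  obtain ⟨u, um, u0, uS, uo, ue⟩ := discrete_solution hN hα0 hα2 hγ (r := r) hε (hε1.trans hle1)
    (f := fun y => g y * hB N α y) (S := fun y => G * hB N α y + (G * η / q) * WB N y)
    (hg.measurable.mul hB_measurable) (fun x => mul_nonneg (hg0 x) (hB_nonneg x))
    (fun x => by
      have := mul_le_mul_of_nonneg_right (hG x) (hB_nonneg (α := α) x)
      have h2 : 0 ≤ G * η / q * WB N x := mul_nonneg (by positivity) (WB_nonneg x)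
      linarith)
    ((hhi.const_mul G).add (hWi.const_mul _)) hSL
  refine ⟨ε, u, hε1, ⟨by linarith, hr1, hε, by linarith, hη0, hle2, fun x hx => (hh x hx).1,
    fun x hx => (hh x hx).2, um, u0, fun x => ?_, uo, ue⟩⟩
  refine (uS x).trans ?_
  have h1 : G * η / q * WB N x ≤ G / q * hB N α x := by
    refine mul_le_mul ?_ (WB_le_hB hα2 x) (WB_nonneg x) (by positivity)
    gcongr
    exact mul_le_of_le_one_right hG0 hle2
  have := hB_nonneg (α := α) x
  nlinarith

/-- modulus of continuity through linear functions -/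
lemma modulus {N : ℕ} {g : EN N → ℝ} (hg : Continuous g) (hg0 : ∀ x, 0 ≤ g x) {G : ℝ}
    (hG : ∀ x, g x ≤ G) {τ : ℝ} (hτ : 0 < τ) :
    ∃ C, 0 ≤ C ∧ ∀ z x : EN N, ‖z‖ = 1 → ‖x‖ ≤ 1 →
      |g x - g z| ≤ τ + C * (1 - inner ℝ z x) := by
  have hG0 : 0 ≤ G := (hg0 0).trans (hG 0)
  have huc := (isCompact_closedBall (0 : EN N) 1).uniformContinuousOn_of_continuous hg.continuousOn
  rw [Metric.uniformContinuousOn_iff] at huc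
  obtain ⟨d, hd, hud⟩ := huc τ hτ
  refine ⟨2 * G / d ^ 2, by positivity, fun z x hz hx => ?_⟩
  have hi : inner ℝ z x ≤ 1 := by
    refine (real_inner_le_norm z x).trans ?_
    rw [hz, one_mul]; exact hx
  by_cases h : dist x z < d
  · have h1 := hud x (by simpa using hx) z (by simp [hz]) h
    rw [Real.dist_eq] at h1
    have : 0 ≤ 2 * G / d ^ 2 * (1 - inner ℝ z x) := mul_nonneg (by positivity) (by linarith)
    linarith
  · have h1 : d ≤ ‖x - z‖ := by rw [← dist_eq_norm]; exact not_lt.1 h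
    have h2 : ‖x - z‖ ^ 2 = ‖x‖ ^ 2 - 2 * inner ℝ z x + 1 := by
      rw [norm_sub_sq_real, hz, real_inner_comm]; ring
    have h3 : d ^ 2 ≤ 2 * (1 - inner ℝ z x) := by nlinarith [norm_nonneg x]
    have h4 : G ≤ 2 * G / d ^ 2 * (1 - inner ℝ z x) := by
      rw [div_mul_eq_mul_div, le_div_iff₀ (by positivity)]
      nlinarith
    have h5 : |g x - g z| ≤ G := by
      rw [abs_le]; constructor <;> linarith [hg0 x, hg0 z, hG x, hG z]
    linarith

lemma upper_barrier {N : ℕ} (hN : 3 ≤ N) {α γ : ℝ} (hα0 : 0 < α) (hα2 : α < 2)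
    {g : EN N → ℝ} {G1 r ε η : ℝ} {u : EN N → ℝ} (hG1 : 0 ≤ G1)
    (A : Approx N α γ g G1 r ε η u) {z : EN N} (hz : ‖z‖ = 1) {a C : ℝ} (ha : 0 ≤ a) (hC : 0 ≤ C)
    (hgz : ∀ x : EN N, ‖x‖ ≤ 1 → g x ≤ a + C * (1 - inner ℝ z x)) (x : EN N) :
    u x ≤ (a + C * (1 - inner ℝ z x)) * hB N α x
      + (a + 2 * C) * η / (fracLapCoeff N α * cOut N α) * WB N x := by
  have hcp := coeff_pos (N := N) hα0 hα2
  have hc1 := cOut_pos (N := N) (α := α)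
  set q := fracLapCoeff N α * cOut N α with hq
  have hq0 : 0 < q := mul_pos hcp hc1
  have hη := A.η0
  have hhi := hB_integrable (N := N) hN hα0 hα2
  have hWi := WB_integrable (N := N)
  have hui := A.integrable hN hα0 hα2
  have hzi := inner_hB_integrable hN hα0 hα2 z
  set K := (a + 2 * C) * η / q with hK
  have hK0 : 0 ≤ K := by positivity
  have i1 : Integrable (fun y => (a + C) * hB N α y) := hhi.const_mul _
  have i2 : Integrable (fun y => C * (inner ℝ z y * hB N α y)) := hzi.const_mul _
  have i3 : Integrable (fun y => K * WB N y) := hWi.const_mul _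
  have i4 : Integrable (fun y => (a + C) * hB N α y - C * (inner ℝ z y * hB N α y)) := i1.sub i2
  have i5 : Integrable (fun y => (a + C) * hB N α y - C * (inner ℝ z y * hB N α y) + K * WB N y) :=
    i4.add i3
  have key := comparison hN hα0 hα2 A.r1 A.ε0 A.εr
    (w := fun y => u y - ((a + C) * hB N α y - C * (inner ℝ z y * hB N α y) + K * WB N y))
    (hui.sub i5) ?_ ?_ ?_ x
  · nlinarith [key]
  · obtain ⟨H, hH1, hH⟩ := hB_bdd (N := N) (α := α) A.r1
    refine ⟨G1 * H, fun y hy => ?_⟩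
    have h1 := (A.le y).trans (mul_le_mul_of_nonneg_left (hH y hy) hG1)
    have h2 := hB_nonneg (α := α) y
    have h3 : inner ℝ z y ≤ 1 := by
      refine (real_inner_le_norm z y).trans ?_
      rw [hz, one_mul]; exact hy.trans A.r1.le
    have h4 : 0 ≤ (a + C * (1 - inner ℝ z y)) * hB N α y :=
      mul_nonneg (add_nonneg ha (mul_nonneg hC (by linarith))) h2
    have h5 := mul_nonneg hK0 (WB_nonneg y)
    nlinarith
  · intro y hy
    have h5 := mul_nonneg hK0 (WB_nonneg y)
    show _ - _ ≤ (0 : ℝ)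
    rw [A.out y hy]
    by_cases h1 : ‖y‖ ≤ 1
    · have := mul_le_mul_of_nonneg_right (hgz y h1) (hB_nonneg (α := α) y)
      nlinarith
    · rw [hB_out hα2 (not_le.1 h1).le]; simp; exact h5
  · intro y hy _
    rw [Leps_sub hN hα0 hα2 A.ε0 hui i5, Leps_add hN hα0 hα2 A.ε0 i4 i3,
      Leps_sub hN hα0 hα2 A.ε0 i1 i2, Leps_smul, Leps_smul, Leps_smul, A.eq y hy]
    have h0 : 0 ≤ u y ^ γ := Real.rpow_nonneg (A.nonneg y) _
    have h1 := Leps_WB (N := N) hN hα0 hα2 (x := y) (hy.trans_lt A.r1) A.ε0 (by linarith [A.εr])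
    have h2 := (abs_le.1 (A.harm y hy)).2
    have h3 := (abs_le.1 (A.harm1 y hy z hz.le)).1
    have h4 := mul_le_mul_of_nonneg_left h1 hK0
    have h5 : K * (-q) = - ((a + 2 * C) * η) := by rw [hK]; field_simp
    have h6 := mul_le_mul_of_nonneg_left h2 (add_nonneg ha hC)
    have h7 := mul_le_mul_of_nonneg_left h3 hC
    linarith

lemma lower_barrier {N : ℕ} (hN : 3 ≤ N) {α γ : ℝ} (hα0 : 0 < α) (hα2 : α < 2) (hγ : 0 < γ)
    {g : EN N → ℝ} {G1 r ε η θ c2 : ℝ} {u : EN N → ℝ} (hG1 : 0 ≤ G1)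
    (hθ0 : 0 < θ) (hθ1 : θ < 1) (hc2 : 0 < c2)
    (hV : ∀ x : EN N, ‖x‖ < 1 → ∀ ε, 0 < ε → ε ≤ 1 - ‖x‖ →
      Leps N α ε (VB N α θ) x ≤ |Leps N α ε (hB N α) x| - c2 * hB N α x ^ γ)
    (A : Approx N α γ g G1 r ε η u) {z : EN N} (hz : ‖z‖ = 1) {a C : ℝ} (hC : 0 ≤ C)
    (hgz : ∀ x : EN N, ‖x‖ ≤ 1 → a - C * (1 - inner ℝ z x) ≤ g x) (x : EN N) :
    (a - C * (1 - inner ℝ z x)) * hB N α x - G1 ^ γ / c2 * VB N α θ x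
      - (|a| + 2 * C + G1 ^ γ / c2) * η / (fracLapCoeff N α * cOut N α) * WB N x ≤ u x := by
  have hcp := coeff_pos (N := N) hα0 hα2
  have hc1 := cOut_pos (N := N) (α := α)
  set q := fracLapCoeff N α * cOut N α with hq
  have hq0 : 0 < q := mul_pos hcp hc1
  have hη := A.η0
  have hhi := hB_integrable (N := N) hN hα0 hα2
  have hWi := WB_integrable (N := N)
  have hVi := VB_integrable (N := N) hN hα0 hα2 hθ0 hθ1
  have hui := A.integrable hN hα0 hα2
  have hzi := inner_hB_integrable hN hα0 hα2 z
  set P := G1 ^ γ / c2 with hP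
  have hP0 : 0 ≤ P := div_nonneg (Real.rpow_nonneg hG1 _) hc2.le
  set K := (|a| + 2 * C + P) * η / q with hK
  have hK0 : 0 ≤ K := by positivity
  have i1 : Integrable (fun y => (a - C) * hB N α y) := hhi.const_mul _
  have i2 : Integrable (fun y => C * (inner ℝ z y * hB N α y)) := hzi.const_mul _
  have i3 : Integrable (fun y => K * WB N y) := hWi.const_mul _
  have i6 : Integrable (fun y => P * VB N α θ y) := hVi.const_mul _
  have i4 : Integrable (fun y => (a - C) * hB N α y + C * (inner ℝ z y * hB N α y)) := i1.add i2
  have i7 : Integrable (fun y => P * VB N α θ y + K * WB N y) := i6.add i3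
  have i8 : Integrable (fun y => P * VB N α θ y + K * WB N y + u y) := i7.add hui
  have key := comparison hN hα0 hα2 A.r1 A.ε0 A.εr
    (w := fun y => ((a - C) * hB N α y + C * (inner ℝ z y * hB N α y))
      - (P * VB N α θ y + K * WB N y + u y))
    (i4.sub i8) ?_ ?_ ?_ x
  · nlinarith [key]
  · obtain ⟨H, hH1, hH⟩ := hB_bdd (N := N) (α := α) A.r1
    refine ⟨|a| * H, fun y hy => ?_⟩
    have h1 := (mul_le_mul_of_nonneg_left (hH y hy) (abs_nonneg a))
    have h2 := hB_nonneg (α := α) y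
    have h3 : inner ℝ z y ≤ 1 := by
      refine (real_inner_le_norm z y).trans ?_
      rw [hz, one_mul]; exact hy.trans A.r1.le
    have h4 : 0 ≤ (C * (1 - inner ℝ z y)) * hB N α y :=
      mul_nonneg ((mul_nonneg hC (by linarith))) h2
    have h5 := mul_nonneg hK0 (WB_nonneg y)
    have h6 := mul_nonneg hP0 (VB_nonneg (α := α) (θ := θ) y)
    have h7 := A.nonneg y
    have h8 := mul_le_mul_of_nonneg_right (le_abs_self a) h2
    nlinarith
  · intro y hy
    have h5 := mul_nonneg hK0 (WB_nonneg y)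
    have h6 := mul_nonneg hP0 (VB_nonneg (α := α) (θ := θ) y)
    show _ - _ ≤ (0 : ℝ)
    rw [A.out y hy]
    by_cases h1 : ‖y‖ ≤ 1
    · have := mul_le_mul_of_nonneg_right (hgz y h1) (hB_nonneg (α := α) y)
      nlinarith
    · rw [hB_out hα2 (not_le.1 h1).le]; simp; linarith
  · intro y hy _
    rw [Leps_sub hN hα0 hα2 A.ε0 i4 i8, Leps_add hN hα0 hα2 A.ε0 i7 hui,
      Leps_add hN hα0 hα2 A.ε0 i6 i3,
      Leps_add hN hα0 hα2 A.ε0 i1 i2, Leps_smul, Leps_smul, Leps_smul, Leps_smul, A.eq y hy]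
    have h0 : u y ^ γ ≤ P * c2 * hB N α y ^ γ := by
      rw [hP, div_mul_cancel₀ _ hc2.ne', ← Real.mul_rpow hG1 (hB_nonneg y)]
      exact Real.rpow_le_rpow (A.nonneg y) (A.le y) hγ.le
    have h1 := Leps_WB (N := N) hN hα0 hα2 (x := y) (hy.trans_lt A.r1) A.ε0 (by linarith [A.εr])
    have h2 := A.harm y hy
    have h3 := (abs_le.1 (A.harm1 y hy z hz.le)).1
    have h4 := mul_le_mul_of_nonneg_left h1 hK0
    have h5 : K * (-q) = - ((|a| + 2 * C + P) * η) := by rw [hK]; field_simp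
    have h6 : -((|a| + C) * η) ≤ (a - C) * Leps N α ε (hB N α) y := by
      refine (abs_le.1 ?_).1
      rw [abs_mul]
      refine mul_le_mul ?_ h2 (abs_nonneg _) (by positivity)
      calc |a - C| ≤ |a| + |C| := abs_sub _ _
        _ = _ := by rw [abs_of_nonneg hC]
    have h7 := mul_le_mul_of_nonneg_left h3 hC
    have h8 := hV y (hy.trans_lt A.r1) ε A.ε0 (by linarith [A.εr])
    have h9 := mul_le_mul_of_nonneg_left (h8.trans (sub_le_sub_right h2 _)) hP0
    nlinarith

lemma VB_small {N : ℕ} {α θ : ℝ} (hα2 : α < 2) (hθ0 : 0 < θ) (hθ1 : θ < 1) {τ : ℝ} (hτ : 0 < τ) :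
    ∃ d, 0 < d ∧ ∀ x : EN N, 1 - d < ‖x‖ → VB N α θ x ≤ τ * hB N α x := by
  have hs : 0 < (α / 2 - 1) * (θ - 1) := mul_pos_of_neg_of_neg (by linarith) (by linarith)
  have ht : Tendsto (fun t : ℝ => t ^ ((α / 2 - 1) * (θ - 1))) (𝓝 0) (𝓝 0) := by
    have := (Real.continuousAt_rpow_const 0 ((α / 2 - 1) * (θ - 1)) (Or.inr hs.le)).tendsto
    rwa [Real.zero_rpow hs.ne'] at this
  obtain ⟨d, hd, hh⟩ := Metric.eventually_nhds_iff.1 (ht.eventually (ge_mem_nhds hτ))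
  refine ⟨d / 2, by positivity, fun x hx => ?_⟩
  by_cases h1 : 1 ≤ ‖x‖
  · rw [VB_out hα2 hθ0 h1, hB_out hα2 h1]; simp
  · push Not at h1
    have h0 := norm_nonneg x
    have hp : 0 < 1 - ‖x‖ ^ 2 := by nlinarith
    have h2 : (1 - ‖x‖ ^ 2) ^ ((α / 2 - 1) * (θ - 1)) ≤ τ := by
      apply hh
      rw [Real.dist_eq, sub_zero, abs_of_pos hp]
      nlinarith
    unfold VB
    rw [hB_in h1, ← Real.rpow_mul hp.le]
    calc (1 - ‖x‖ ^ 2) ^ ((α / 2 - 1) * θ) =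
        (1 - ‖x‖ ^ 2) ^ ((α / 2 - 1) * (θ - 1)) * (1 - ‖x‖ ^ 2) ^ (α / 2 - 1) := by
          rw [← Real.rpow_add hp]; congr 1; ring
      _ ≤ _ := mul_le_mul_of_nonneg_right h2 (Real.rpow_nonneg hp.le _)

lemma near_bd {N : ℕ} (hN : 3 ≤ N) {α γ : ℝ} (hα0 : 0 < α) (hα2 : α < 2) (hγ : 0 < γ)
    (hγ1 : γ < (2 + α) / (2 - α))
    {g : EN N → ℝ} (hg : Continuous g) (hg0 : ∀ x, 0 ≤ g x) {G : ℝ} (hG : ∀ x, g x ≤ G)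
    {G1 : ℝ} (hG1 : 0 ≤ G1) {τ : ℝ} (hτ : 0 < τ) :
    ∃ d η1 : ℝ, 0 < d ∧ d < 1 ∧ 0 < η1 ∧ ∀ r ε η u, Approx N α γ g G1 r ε η u → η ≤ η1 →
      ∀ x : EN N, 1 - d < ‖x‖ → |u x - g x * hB N α x| ≤ τ * hB N α x := by
  have hG0 : 0 ≤ G := (hg0 0).trans (hG 0)
  obtain ⟨θ, c2, hθ0, hθ1, hc2, hV⟩ := V_super (N := N) hN hα0 hα2 hγ1
  obtain ⟨C, hC, hm⟩ := modulus hg hg0 hG (τ := τ / 10) (by positivity)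
  set P := G1 ^ γ / c2 with hP
  have hP0 : 0 ≤ P := div_nonneg (Real.rpow_nonneg hG1 _) hc2.le
  obtain ⟨d1, hd1, hd1V⟩ := VB_small (N := N) (α := α) hα2 hθ0 hθ1
    (τ := τ / 10 / (P + 1)) (by positivity)
  have hcp := coeff_pos (N := N) hα0 hα2
  have hc1 := cOut_pos (N := N) (α := α)
  set q := fracLapCoeff N α * cOut N α with hq
  have hq0 : 0 < q := mul_pos hcp hc1
  set K := G + τ + 2 * C + P with hK
  have hK0 : 0 < K := by positivity
  refine ⟨min d1 (min (1 / 2) (τ / 10 / (C + 1))), τ / 10 * q / K, by positivity, ?_, by positivity,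
    fun r ε η u A hη x hx => ?_⟩
  · exact (min_le_right _ _).trans_lt ((min_le_left _ _).trans_lt (by norm_num))
  by_cases h1 : 1 ≤ ‖x‖
  · have : u x = 0 := by rw [A.out x (A.r1.trans_le h1), hB_out hα2 h1, mul_zero]
    rw [this, hB_out hα2 h1]; simp
  push Not at h1
  have hd2 : min d1 (min (1 / 2) (τ / 10 / (C + 1))) ≤ d1 := min_le_left _ _
  have hd3 : min d1 (min (1 / 2) (τ / 10 / (C + 1))) ≤ 1/2 :=
    (min_le_right _ _).trans (min_le_left _ _)
  have hd4 : min d1 (min (1 / 2) (τ / 10 / (C + 1))) ≤ τ / 10 / (C + 1) :=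
    (min_le_right _ _).trans (min_le_right _ _)
  obtain ⟨z, hz, hxz⟩ := exists_dir hN x
  have hin : inner ℝ z x = ‖x‖ := by
    rw [hxz, inner_smul_right, real_inner_self_eq_norm_sq, hz, norm_smul, hz]; simp
  have hCx : C * (1 - ‖x‖) ≤ τ / 10 := by
    have h2 : 1 - ‖x‖ ≤ τ / 10 / (C + 1) := by linarith
    rw [le_div_iff₀ (by positivity)] at h2
    nlinarith
  have hu := upper_barrier hN hα0 hα2 hG1 A hz (a := g z + τ / 10) (C := C)
    (by linarith [hg0 z]) hC (fun y hy => by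
      have := (abs_le.1 (hm z y hz hy)).2
      linarith) x
  have hl := lower_barrier hN hα0 hα2 hγ hG1 hθ0 hθ1 hc2 hV A hz (a := g z - τ / 10) (C := C)
    hC (fun y hy => by
      have := (abs_le.1 (hm z y hz hy)).1
      linarith) x
  have hmx := hm z x hz h1.le
  rw [hin] at hu hl hmx
  rw [← hq] at hu hl
  rw [← hP] at hl
  have hh := hB_nonneg (α := α) x
  have hVx : P * VB N α θ x ≤ τ / 10 * hB N α x := by
    have h2 := mul_le_mul_of_nonneg_left (hd1V x (by linarith)) hP0
    refine h2.trans ?_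
    rw [← mul_assoc]
    refine mul_le_mul_of_nonneg_right ?_ hh
    rw [mul_div_assoc', div_le_iff₀ (by positivity)]
    nlinarith
  have hW : ∀ k, 0 ≤ k → k ≤ K → k * η / q * WB N x ≤ τ / 10 * hB N α x := by
    intro k hk0 hk
    refine mul_le_mul ?_ (WB_le_hB hα2 x) (WB_nonneg x) (by positivity)
    rw [div_le_iff₀ hq0]
    rw [le_div_iff₀ hK0] at hη
    nlinarith [A.η0, mul_le_mul_of_nonneg_right hk A.η0.le]
  have hW1 := hW (g z + τ / 10 + 2 * C) (by linarith [hg0 z]) (by rw [hK]; linarith [hG z])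
  have hW2 := hW (|g z - τ / 10| + 2 * C + P) (by positivity) (by
    have : |g z - τ / 10| ≤ G + τ := by
      rw [abs_le]; constructor <;> linarith [hG z, hg0 z]
    rw [hK]; linarith)
  have e1 := mul_le_mul_of_nonneg_right hCx hh
  have e2 := mul_le_mul_of_nonneg_right (abs_le.1 hmx).1 hh
  have e3 := mul_le_mul_of_nonneg_right (abs_le.1 hmx).2 hh
  have e4 := mul_nonneg hτ.le hh
  rw [abs_le]
  constructor
  · linarith
  · linarith

lemma trans_L1 {N : ℕ} {f : EN N → ℝ} (hf : Integrable f) {σ : ℝ} (hσ : 0 < σ) :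
    ∃ d, 0 < d ∧ ∀ e : EN N, ‖e‖ ≤ d → ∫ x, |f (x + e) - f x| ≤ σ := by
  obtain ⟨p, hpc, hpf, hp, hpi⟩ := hf.exists_hasCompactSupport_integral_sub_le
    (ε := σ / 4) (by positivity)
  obtain ⟨M, hM⟩ := hpc.exists_bound_of_continuous hp
  obtain ⟨R, hR⟩ := hpc.isCompact.isBounded.subset_closedBall (0 : EN N)
  have hM0 : 0 ≤ M := (norm_nonneg _).trans (hM 0)
  have hp0 : ∀ y : EN N, R < ‖y‖ → p y = 0 := by
    intro y hy
    by_contra h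
    have := hR (subset_tsupport _ (Function.mem_support.2 h))
    simp at this; linarith
  have ht : Tendsto (fun e : EN N => ∫ x, |p (x + e) - p x|) (𝓝 0) (𝓝 (∫ x : EN N, (0 : ℝ))) := by
    refine tendsto_integral_filter_of_dominated_convergence
      ((closedBall (0 : EN N) (R + 1)).indicator fun _ => 2 * M) ?_ ?_ ?_ ?_
    · exact Eventually.of_forall fun e => (by fun_prop : Continuous _).aestronglyMeasurable
    · have : ∀ᶠ e : EN N in 𝓝 0, ‖e‖ ≤ 1 := by
        have := closedBall_mem_nhds (0 : EN N) one_pos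
        filter_upwards [this] with e he
        simpa using he
      filter_upwards [this] with e he
      refine Eventually.of_forall fun x => ?_
      by_cases hx : x ∈ closedBall (0 : EN N) (R + 1)
      · rw [indicator_of_mem hx, Real.norm_eq_abs, abs_abs]
        have h1 := hM (x + e)
        have h2 := hM x
        rw [Real.norm_eq_abs] at h1 h2
        exact (abs_sub _ _).trans (by linarith)
      · rw [indicator_of_notMem hx]
        have hx' : R + 1 < ‖x‖ := by simpa using hx
        rw [hp0 x (by linarith), hp0 (x + e)]
        · simp
        · have := norm_sub_le (x + e) e
          rw [add_sub_cancel_right] at this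
          linarith
    · rw [integrable_indicator_iff isClosed_closedBall.measurableSet]
      exact integrableOn_const (isCompact_closedBall _ _).measure_lt_top.ne
    · refine Eventually.of_forall fun x => ?_
      have : Continuous fun e : EN N => |p (x + e) - p x| := by fun_prop
      have := this.tendsto 0
      simpa using this
  simp only [integral_zero] at ht
  obtain ⟨d, hd, hh⟩ := Metric.eventually_nhds_iff.1
    (ht.eventually (ge_mem_nhds (show (0 : ℝ) < σ / 4 by positivity)))
  refine ⟨d / 2, by positivity, fun e he => ?_⟩
  have h1 := hh (y := e) (by rw [dist_zero_right]; linarith)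
  have i1 : Integrable fun x => |f (x + e) - p (x + e)| := ((hf.sub hpi).abs).comp_add_right e
  have i2 : Integrable fun x => |f x - p x| := (hf.sub hpi).abs
  have i3 : Integrable fun x => |p (x + e) - p x| := ((hpi.comp_add_right e).sub hpi).abs
  have e1 : ∫ x, |f (x + e) - p (x + e)| = ∫ x, |f x - p x| :=
    integral_add_right_eq_self (fun x => |f x - p x|) e
  calc ∫ x, |f (x + e) - f x| ≤ ∫ x, (|f (x + e) - p (x + e)| + |f x - p x| + |p (x + e) - p x|) := by
        refine integral_mono ((hf.comp_add_right e).sub hf).abs ((i1.add i2).add i3) fun x => ?_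
        have a1 := abs_add_le (f (x + e) - p (x + e)) (p (x + e) - f x)
        have a2 := abs_add_le (p (x + e) - p x) (p x - f x)
        rw [abs_sub_comm (p x) (f x)] at a2
        simp only [sub_add_sub_cancel] at a1 a2
        show |f (x + e) - f x| ≤ |f (x + e) - p (x + e)| + |f x - p x| + |p (x + e) - p x|
        linarith
    _ = (∫ x, |f (x + e) - p (x + e)|) + (∫ x, |f x - p x|) + ∫ x, |p (x + e) - p x| := by
        have i12 : Integrable fun x => |f (x + e) - p (x + e)| + |f x - p x| := i1.add i2
        rw [integral_add i12 i3, integral_add i1 i2]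
    _ ≤ σ := by
        simp only [Real.norm_eq_abs] at hpf
        rw [e1]; linarith

lemma Leps_far {N : ℕ} {α : ℝ} (hα0 : 0 < α) (hα2 : α < 2) {ε : ℝ} (hε : 0 < ε)
    {S : EN N → ℝ} (hS : Integrable S) (hS0 : ∀ x, 0 ≤ S x) {s t : ℝ} (hs : 0 < s)
    (hz : ∀ y, ‖y‖ ≤ t + s → S y = 0) {x : EN N} (hx : ‖x‖ ≤ t) :
    Leps N α ε S x ≤ fracLapCoeff N α * (s ^ (-((N : ℝ) + α)) * ∫ y, S y) := by
  have hcp := coeff_pos (N := N) hα0 hα2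
  unfold Leps
  refine mul_le_mul_of_nonneg_left ?_ hcp.le
  have h0 : S x = 0 := hz x (by linarith)
  rw [← integral_add_left_eq_self S x, ← integral_const_mul]
  simp only [h0, sub_zero]
  refine integral_mono (kJ_shift_integrable hα0 hε hS x) ((hS.comp_add_left x).const_mul _) fun z => ?_
  by_cases h : ‖z‖ ≤ s
  · have : S (x + z) = 0 := hz _ ((norm_add_le _ _).trans (by linarith))
    simp [this]
  · refine mul_le_mul_of_nonneg_right ?_ (hS0 _)
    unfold kJ
    split_ifs
    · exact Real.rpow_le_rpow_of_nonpos hs (not_le.1 h).le (by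
        have : (0:ℝ) ≤ N := by positivity
        linarith)
    · positivity

lemma equicont {N : ℕ} (hN : 3 ≤ N) {α γ : ℝ} (hα0 : 0 < α) (hα2 : α < 2) (hγ : 0 < γ)
    (hγ1 : γ < (2 + α) / (2 - α))
    {g : EN N → ℝ} (hg : Continuous g) (hg0 : ∀ x, 0 ≤ g x) {G : ℝ} (hG : ∀ x, g x ≤ G)
    {G1 : ℝ} (hG1 : 0 ≤ G1) {τ ρ : ℝ} (hτ : 0 < τ) (hρ0 : 0 ≤ ρ) (hρ : ρ < 1) :
    ∃ d η1 r1 : ℝ, 0 < d ∧ 0 < η1 ∧ r1 < 1 ∧ ∀ r ε η u, Approx N α γ g G1 r ε η u → η ≤ η1 →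
      r1 ≤ r → ∀ x e : EN N, ‖x‖ ≤ ρ → ‖e‖ ≤ d → u (x + e) - u x ≤ τ := by
  have hcp := coeff_pos (N := N) hα0 hα2
  have hc1 := cOut_pos (N := N) (α := α)
  set q := fracLapCoeff N α * cOut N α with hq
  have hq0 : 0 < q := mul_pos hcp hc1
  obtain ⟨H, hH1, hH⟩ := hB_bdd (N := N) (α := α) (r := (1 + ρ) / 2) (by linarith)
  set t' := τ / (8 * H) with ht'
  have ht0 : 0 < t' := by positivity
  obtain ⟨d0, η0, hd0, hd01, hη0, hnb⟩ := near_bd (N := N) hN hα0 hα2 hγ hγ1 hg hg0 hG hG1 ht0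
  -- shrink the boundary layer
  set b := min d0 (1 - ρ) with hb
  have hb0 : 0 < b := lt_min hd0 (by linarith)
  have hb1 : b ≤ d0 := min_le_left _ _
  have hb2 : b ≤ 1 - ρ := min_le_right _ _
  set f : EN N → ℝ := fun x => g x * hB N α x with hf
  have hhi := hB_integrable (N := N) hN hα0 hα2
  have hWi := WB_integrable (N := N)
  have hfi : Integrable f := by
    refine (hhi.const_mul G).mono' (hg.measurable.mul hB_measurable).aestronglyMeasurable
      (Eventually.of_forall fun x => ?_)
    rw [Real.norm_eq_abs, abs_of_nonneg (mul_nonneg (hg0 x) (hB_nonneg x))]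
    exact mul_le_mul_of_nonneg_right (hG x) (hB_nonneg x)
  have hfc : ContinuousOn f (closedBall 0 (1 - b / 8)) :=
    (hg.continuousOn.mul hB_continuousOn).mono (closedBall_subset_ball (by linarith))
  have huc := (isCompact_closedBall (0 : EN N) (1 - b / 8)).uniformContinuousOn_of_continuous hfc
  rw [Metric.uniformContinuousOn_iff] at huc
  obtain ⟨d1, hd1, hu1⟩ := huc (τ / 4) (by positivity)
  set s := (b / 4) ^ (-((N : ℝ) + α)) with hs
  have hs0 : 0 < s := by positivity
  obtain ⟨d2, hd2, hu2⟩ := trans_L1 hfi (σ := τ / 8 * q / (fracLapCoeff N α * s)) (by positivity)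
  refine ⟨min (b / 8) (min (d1 / 2) d2), min η0 (τ / 8 * q / (2 * t')), 1 - b / 4, by positivity,
    by positivity, by linarith, fun r ε η u A hη hr x e hx he => ?_⟩
  have he1 : ‖e‖ ≤ b / 8 := he.trans (min_le_left _ _)
  have he2 : ‖e‖ < d1 := by
    have := he.trans ((min_le_right _ _).trans (min_le_left _ _))
    linarith
  have he3 : ‖e‖ ≤ d2 := he.trans ((min_le_right _ _).trans (min_le_right _ _))
  have hnorm : ∀ y : EN N, ‖y + e‖ ≤ ‖y‖ + b / 8 := fun y => (norm_add_le _ _).trans (by linarith)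
  have hnorm' : ∀ y : EN N, ‖y‖ - b / 8 ≤ ‖y + e‖ := fun y => by
    have := norm_sub_le (y + e) e
    rw [add_sub_cancel_right] at this
    linarith
  have hη1 : η ≤ η0 := hη.trans (min_le_left _ _)
  have hη2 : 2 * t' * η ≤ τ / 8 * q := by
    have := hη.trans (min_le_right _ _)
    rw [le_div_iff₀ (by positivity)] at this
    linarith
  have hui := A.integrable hN hα0 hα2
  have hm : MeasurableSet {y : EN N | 1 - b / 4 < ‖y‖} :=
    measurableSet_lt measurable_const measurable_norm
  set S1 : EN N → ℝ := {y : EN N | 1 - b / 4 < ‖y‖}.indicator fun y => |f (y + e) - f y| with hS1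
  have hF : Integrable fun y => |f (y + e) - f y| := ((hfi.comp_add_right e).sub hfi).abs
  have hS1i : Integrable S1 := hF.indicator hm
  have hS10 : ∀ y, 0 ≤ S1 y := fun y => indicator_nonneg (fun _ _ => abs_nonneg _) _
  have hS1s : ∀ y, ‖y‖ ≤ 1 - b / 2 + b / 4 → S1 y = 0 := fun y hy => by
    refine indicator_of_notMem ?_ _
    rw [Set.mem_ofPred_eq]; linarith
  have hS1I : ∫ y, S1 y ≤ τ / 8 * q / (fracLapCoeff N α * s) := by
    refine le_trans ?_ (hu2 e he3)
    refine integral_mono hS1i hF fun y => ?_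
    exact indicator_le_self' (fun _ _ => abs_nonneg _) _
  have hS1L : ∀ y : EN N, ‖y‖ ≤ 1 - b / 2 → Leps N α ε S1 y ≤ τ / 8 * q := by
    intro y hy
    refine (Leps_far hα0 hα2 A.ε0 hS1i hS10 (by positivity : 0 < b / 4) hS1s hy).trans ?_
    rw [← hs, ← mul_assoc]
    rw [le_div_iff₀ (by positivity)] at hS1I
    linarith
  have j1 : Integrable fun y => u (y + e) := hui.comp_add_right e
  have j2 : Integrable fun y => u (y + e) - u y := j1.sub hui
  have j3 : Integrable fun y => hB N α (y + e) := hhi.comp_add_right e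
  have j4 : Integrable fun y => t' * hB N α y := hhi.const_mul _
  have j5 : Integrable fun y => t' * hB N α (y + e) := j3.const_mul _
  have j6 : Integrable fun y => t' * hB N α y + t' * hB N α (y + e) := j4.add j5
  have j7 : Integrable fun y => t' * hB N α y + t' * hB N α (y + e) + S1 y := j6.add hS1i
  have j8 : Integrable fun y => τ / 2 * WB N y := hWi.const_mul _
  have j9 : Integrable fun y => t' * hB N α y + t' * hB N α (y + e) + S1 y + τ / 2 * WB N y :=
    j7.add j8
  have key := comparison hN hα0 hα2 (r := 1 - b / 2) (by linarith) A.ε0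
    (by linarith [A.εr])
    (w := fun y => (u (y + e) - u y)
      - (t' * hB N α y + t' * hB N α (y + e) + S1 y + τ / 2 * WB N y)) (j2.sub j9) ?_ ?_ ?_ x
  · have h1 : S1 x = 0 := hS1s x (by linarith)
    have h2 := hH x (by linarith)
    have h3 := hH (x + e) ((hnorm x).trans (by linarith))
    have h4 := mul_le_mul_of_nonneg_left h2 ht0.le
    have h5 := mul_le_mul_of_nonneg_left h3 ht0.le
    have h6 : t' * H = τ / 8 := by rw [ht']; field_simp
    have h7 := WB_le_one (N := N) x
    have h8 : τ / 2 * WB N x ≤ τ / 2 * 1 := mul_le_mul_of_nonneg_left h7 (by positivity)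
    linarith
  · obtain ⟨H', hH1', hH'⟩ := hB_bdd (N := N) (α := α) (r := 1 - b / 4) (by linarith)
    refine ⟨G1 * H', fun y hy => ?_⟩
    have h1 := (A.le (y + e)).trans (mul_le_mul_of_nonneg_left
      (hH' (y + e) ((hnorm y).trans (by linarith))) hG1)
    have h2 := A.nonneg y
    have h3 := mul_nonneg ht0.le (hB_nonneg (α := α) y)
    have h4 := mul_nonneg ht0.le (hB_nonneg (α := α) (y + e))
    have h5 := hS10 y
    have h6 : 0 ≤ τ / 2 * WB N y := mul_nonneg (by positivity) (WB_nonneg y)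
    linarith
  · intro y hy
    have n1 := (abs_le.1 (hnb r ε η u A hη1 y (by linarith))).1
    have n2 := (abs_le.1 (hnb r ε η u A hη1 (y + e) (by linarith [hnorm' y]))).2
    have n3 : f (y + e) - f y ≤ S1 y + τ / 2 * WB N y := by
      have h6 : 0 ≤ τ / 2 * WB N y := mul_nonneg (by positivity) (WB_nonneg y)
      by_cases hy2 : 1 - b / 4 < ‖y‖
      · have : S1 y = |f (y + e) - f y| := by
          rw [hS1]; exact indicator_of_mem (s := {y : EN N | 1 - b / 4 < ‖y‖}) hy2 _
        rw [this]
        linarith [le_abs_self (f (y + e) - f y)]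
      · push Not at hy2
        have h1 := hu1 (y + e) (by simpa using (hnorm y).trans (by linarith)) y
          (by simp; linarith) (by simpa using he2)
        rw [Real.dist_eq] at h1
        rw [WB_in (by linarith)]
        linarith [hS10 y, le_abs_self (f (y + e) - f y)]
    simp only [hf] at n3
    linarith
  · intro y hy hw
    rw [Leps_sub hN hα0 hα2 A.ε0 j2 j9, Leps_sub hN hα0 hα2 A.ε0 j1 hui,
      Leps_add hN hα0 hα2 A.ε0 j7 j8, Leps_add hN hα0 hα2 A.ε0 j6 hS1i,
      Leps_add hN hα0 hα2 A.ε0 j4 j5, Leps_smul, Leps_smul, Leps_smul, Leps_translate,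
      Leps_translate, A.eq y (by linarith), A.eq (y + e) ((hnorm y).trans (by linarith))]
    have h1 := (abs_le.1 (A.harm y (by linarith))).2
    have h2 := (abs_le.1 (A.harm (y + e) ((hnorm y).trans (by linarith)))).2
    have h3 := Leps_WB (N := N) hN hα0 hα2 (x := y) (by linarith) A.ε0 (by linarith [A.εr])
    have h4 := hS1L y hy
    have h5 : u y ^ γ ≤ u (y + e) ^ γ := by
      refine Real.rpow_le_rpow (A.nonneg y) ?_ hγ.le
      have h3 := mul_nonneg ht0.le (hB_nonneg (α := α) y)
      have h4 := mul_nonneg ht0.le (hB_nonneg (α := α) (y + e))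
      have h5 := hS10 y
      have h6 : 0 ≤ τ / 2 * WB N y := mul_nonneg (by positivity) (WB_nonneg y)
      linarith
    have h6 := mul_le_mul_of_nonneg_left h1 ht0.le
    have h7 := mul_le_mul_of_nonneg_left h2 ht0.le
    have h8 := mul_le_mul_of_nonneg_left h3 (show 0 ≤ τ / 2 by positivity)
    have h9 := mul_pos hτ hq0
    linarith

lemma extraction {N : ℕ} {u : ℕ → EN N → ℝ} {b : EN N → ℝ} (h0 : ∀ n x, 0 ≤ u n x)
    (hb : ∀ n x, u n x ≤ b x) (hout : ∀ n x, 1 ≤ ‖x‖ → u n x = 0)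
    (heq : ∀ τ, 0 < τ → ∀ ρ, 0 ≤ ρ → ρ < 1 → ∃ d, 0 < d ∧ ∃ n0, ∀ n, n0 ≤ n → ∀ x e : EN N,
      ‖x‖ ≤ ρ → ‖e‖ ≤ d → u n (x + e) - u n x ≤ τ) :
    ∃ ψ : ℕ → ℕ, StrictMono ψ ∧ ∃ v : EN N → ℝ,
      ∀ x, Tendsto (fun n => u (ψ n) x) atTop (𝓝 (v x)) := by
  set D := TopologicalSpace.denseSeq (EN N) with hD
  have hDd : DenseRange D := TopologicalSpace.denseRange_denseSeq _
  have hK : IsCompact (Set.pi univ fun k : ℕ => Icc (0 : ℝ) (b (D k))) :=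
    isCompact_univ_pi fun k => isCompact_Icc
  obtain ⟨a, -, ψ, hψ, ha⟩ := hK.tendsto_subseq (x := fun n k => u n (D k))
    (fun n k _ => ⟨h0 n _, hb n _⟩)
  rw [tendsto_pi_nhds] at ha
  have hcauchy : ∀ x, ∃ l, Tendsto (fun n => u (ψ n) x) atTop (𝓝 l) := by
    intro x
    by_cases hx : 1 ≤ ‖x‖
    · refine ⟨0, ?_⟩
      simp only [hout _ x hx]
      exact tendsto_const_nhds
    push Not at hx
    refine cauchySeq_tendsto_of_complete (Metric.cauchySeq_iff'.2 fun τ hτ => ?_)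
    obtain ⟨d, hd, n0, hn0⟩ := heq (τ / 8) (by positivity) ((1 + ‖x‖) / 2)
      (by positivity) (by linarith)
    obtain ⟨k, hk⟩ := hDd.exists_dist_lt x (ε := min d ((1 - ‖x‖) / 2))
      (lt_min hd (by linarith))
    have hk1 : ‖D k - x‖ ≤ d := by
      rw [← dist_eq_norm, dist_comm]; exact (hk.trans_le (min_le_left _ _)).le
    have hk2 : ‖D k - x‖ ≤ (1 - ‖x‖) / 2 := by
      rw [← dist_eq_norm, dist_comm]; exact (hk.trans_le (min_le_right _ _)).le
    have hk3 : ‖D k‖ ≤ (1 + ‖x‖) / 2 := by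
      have := norm_add_le (D k - x) x
      rw [sub_add_cancel] at this
      linarith
    have hcl : ∀ n, n0 ≤ n → |u n (D k) - u n x| ≤ τ / 8 := by
      intro n hn
      have a1 := hn0 n hn x (D k - x) (by linarith) hk1
      have a2 := hn0 n hn (D k) (x - D k) hk3 (by rw [norm_sub_rev]; exact hk1)
      rw [add_sub_cancel] at a1 a2
      rw [abs_le]; constructor <;> linarith
    obtain ⟨n1, hn1⟩ := Metric.tendsto_atTop.1 (ha k) (τ / 8) (by positivity)
    refine ⟨max n0 n1, fun n hn => ?_⟩
    have hψn : ∀ n, n ≤ ψ n := hψ.id_le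
    have b1 := hcl (ψ n) ((le_max_left _ _).trans (hn.trans (hψn n)))
    have b2 := hcl (ψ (max n0 n1)) ((le_max_left _ _).trans (hψn _))
    have b3 := hn1 n ((le_max_right _ _).trans hn)
    have b4 := hn1 (max n0 n1) (le_max_right _ _)
    simp only [Function.comp, Real.dist_eq] at b3 b4
    rw [Real.dist_eq, abs_lt]
    rw [abs_le] at b1 b2
    rw [abs_lt] at b3 b4
    constructor <;> linarith
  choose v hv using hcauchy
  exact ⟨ψ, hψ, v, hv⟩

lemma Leps_measurable {N : ℕ} (hN : 3 ≤ N) {α ε : ℝ} (hα0 : 0 < α) (hα2 : α < 2) (hε : 0 < ε)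
    {φ : EN N → ℝ} (hφ : Measurable φ) : Measurable (Leps N α ε φ) := by
  unfold Leps
  refine Measurable.const_mul ?_ _
  have : StronglyMeasurable (fun p : EN N × EN N => kJ N α ε p.2 * (φ (p.1 + p.2) - φ p.1)) := by
    have := kJ_measurable (N := N) (α := α) (ε := ε)
    exact (by fun_prop : Measurable _).stronglyMeasurable
  exact this.integral_prod_right.measurable

lemma weak_form {N : ℕ} (hN : 3 ≤ N) {α γ : ℝ} (hα0 : 0 < α) (hα2 : α < 2) (hγ : 0 < γ)
    {g : EN N → ℝ} {G1 : ℝ} (hG1 : 0 ≤ G1) {r ε η : ℕ → ℝ} {u : ℕ → EN N → ℝ} {v : EN N → ℝ}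
    (A : ∀ n, Approx N α γ g G1 (r n) (ε n) (η n) (u n))
    (hr : Tendsto r atTop (𝓝 1)) (hε : Tendsto ε atTop (𝓝[>] 0))
    (hv : ∀ x, Tendsto (fun n => u n x) atTop (𝓝 (v x)))
    {φ : EN N → ℝ} (hφ : ContDiff ℝ (⊤ : ℕ∞) φ) (hc : HasCompactSupport φ)
    (hs : tsupport φ ⊆ ball 0 1) :
    ∫ x, v x * fracLap N α φ x = ∫ x, v x ^ γ * φ x := by
  obtain ⟨C, hC, hT⟩ := test_fracLap hN hα0 hα2 hφ hc
  have hφi : Integrable φ := hφ.continuous.integrable_of_hasCompactSupport hc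
  have hhi := hB_integrable (N := N) hN hα0 hα2
  have hC0 : 0 ≤ C := (abs_nonneg _).trans (hC 1 one_pos 0)
  obtain ⟨ρ, hρ, hsρ⟩ : ∃ ρ < 1, tsupport φ ⊆ closedBall 0 ρ := by
    have hf : ContinuousOn (fun x : EN N => ‖x‖) (tsupport φ) := continuous_norm.continuousOn
    by_cases hne : (tsupport φ).Nonempty
    · obtain ⟨x, hx, hm⟩ := hc.isCompact.exists_isMaxOn hne hf
      refine ⟨‖x‖, by simpa using hs hx, fun y hy => ?_⟩
      simpa using hm hy
    · rw [not_nonempty_iff_eq_empty.1 hne]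
      exact ⟨0, by norm_num, empty_subset _⟩
  obtain ⟨H, hH1, hH⟩ := hB_bdd (N := N) (α := α) hρ
  have hφ0 : ∀ x, ρ < ‖x‖ → φ x = 0 := by
    intro y hy
    by_contra h
    have := hsρ (subset_tsupport _ (Function.mem_support.2 h))
    simp at this; linarith
  obtain ⟨M, hM⟩ := hc.exists_bound_of_continuous hφ.continuous
  have hT1 : Tendsto (fun n => ∫ x, u n x * Leps N α (ε n) φ x) atTop
      (𝓝 (∫ x, v x * fracLap N α φ x)) := by
    refine tendsto_integral_of_dominated_convergence (fun x => G1 * hB N α x * C) ?_ ?_ ?_ ?_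
    · intro n
      exact ((A n).meas.mul (Leps_measurable hN hα0 hα2 (A n).ε0
        hφ.continuous.measurable)).aestronglyMeasurable
    · exact (hhi.const_mul G1).mul_const C
    · intro n
      refine Eventually.of_forall fun x => ?_
      rw [Real.norm_eq_abs, abs_mul, abs_of_nonneg ((A n).nonneg x)]
      exact mul_le_mul ((A n).le x) (hC _ (A n).ε0 x) (abs_nonneg _)
        (mul_nonneg hG1 (hB_nonneg x))
    · exact Eventually.of_forall fun x => (hv x).mul ((hT x).comp hε)
  have hT2 : Tendsto (fun n => ∫ x, u n x ^ γ * φ x) atTop (𝓝 (∫ x, v x ^ γ * φ x)) := by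
    refine tendsto_integral_of_dominated_convergence (fun x => (G1 * H) ^ γ * |φ x|) ?_ ?_ ?_ ?_
    · intro n
      have := (A n).meas
      have := hφ.continuous.measurable
      exact (by fun_prop : Measurable _).aestronglyMeasurable
    · exact hφi.abs.const_mul _
    · intro n
      refine Eventually.of_forall fun x => ?_
      have h1 : 0 ≤ u n x ^ γ := Real.rpow_nonneg ((A n).nonneg x) _
      rw [Real.norm_eq_abs, abs_mul, abs_of_nonneg h1]
      by_cases hx : ‖x‖ ≤ ρ
      · refine mul_le_mul_of_nonneg_right ?_ (abs_nonneg _)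
        refine Real.rpow_le_rpow ((A n).nonneg x) (((A n).le x).trans ?_) hγ.le
        exact mul_le_mul_of_nonneg_left (hH x hx) hG1
      · rw [hφ0 x (not_le.1 hx)]; simp
    · refine Eventually.of_forall fun x => Tendsto.mul_const _ ?_
      exact (Real.continuousAt_rpow_const _ _ (Or.inr hγ.le)).tendsto.comp (hv x)
  refine tendsto_nhds_unique hT1 (hT2.congr' ?_)
  filter_upwards [hr.eventually (le_mem_nhds hρ)] with n hn
  have hui := (A n).integrable hN hα0 hα2
  rw [Leps_pairing hN hα0 hα2 (A n).ε0 hui hφi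
    (hui.mul_bdd (c := M) hφ.continuous.aestronglyMeasurable (Eventually.of_forall hM))]
  refine integral_congr_ae (Eventually.of_forall fun x => ?_)
  by_cases hx : ‖x‖ ≤ ρ
  · show _ = φ x * Leps N α (ε n) (u n) x
    rw [(A n).eq x (hx.trans hn), mul_comm]
  · simp [hφ0 x (not_le.1 hx)]

lemma delta_hB {N : ℕ} {α : ℝ} (x : EN N) (hx : ‖x‖ < 1) :
    delta1 x ^ (1 - α / 2) * hB N α x = (1 + ‖x‖) ^ (α / 2 - 1) := by
  unfold delta1
  rw [if_pos hx, hB_in hx]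
  have h1 : 0 < 1 - ‖x‖ := by linarith
  have h2 : 0 ≤ 1 + ‖x‖ := by positivity
  rw [show 1 - ‖x‖ ^ 2 = (1 - ‖x‖) * (1 + ‖x‖) by ring, Real.mul_rpow h1.le h2, ← mul_assoc,
    ← Real.rpow_add h1]
  rw [show 1 - α / 2 + (α / 2 - 1) = 0 by ring]; simp

lemma existence (N : ℕ) (hN : 3 ≤ N) (α : ℝ) (hα0 : 0 < α) (hα2 : α < 2)
    (γ : ℝ) (hγ0 : 0 < γ) (hγ1 : γ < (2 + α) / (2 - α))
    (g : Metric.sphere (0 : EN N) 1 → ℝ) (hgc : Continuous g) (hg0 : ∀ z, 0 ≤ g z) :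
    ∃ u : EN N → ℝ, IsSolutionPg N α γ g u := by
  -- extension of the boundary data
  obtain ⟨G0, hG0⟩ : ∃ G0, ∀ z, g z ≤ G0 := by
    obtain ⟨G0, h⟩ := (isCompact_range hgc).bddAbove
    exact ⟨G0, fun z => h ⟨z, rfl⟩⟩
  set p : ℝ := 2 ^ (1 - α / 2) with hp
  have hp0 : 0 < p := by positivity
  set G := p * max G0 0 with hG
  have hGn : 0 ≤ G := by positivity
  obtain ⟨gh, hgh⟩ := ContinuousMap.exists_restrict_eq (isClosed_sphere (x := (0 : EN N)) (ε := 1))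
    (⟨fun z => p * g z, by fun_prop⟩ : C(Metric.sphere (0 : EN N) 1, ℝ))
  set k : EN N → ℝ := fun x => max (min (gh x) G) 0 with hk
  have hkc : Continuous k := by have := gh.continuous; fun_prop
  have hk0 : ∀ x, 0 ≤ k x := fun x => le_max_right _ _
  have hkG : ∀ x, k x ≤ G := fun x => max_le (min_le_right _ _) hGn
  have hkz : ∀ z : Metric.sphere (0 : EN N) 1, k z = p * g z := by
    intro z
    have h1 : gh z = p * g z := by
      have := congrArg (fun F => F z) hgh
      simpa using this
    have h2 : p * g z ≤ G := mul_le_mul_of_nonneg_left ((hG0 z).trans (le_max_left _ _)) hp0.le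
    simp only [hk]
    rw [h1, min_eq_left h2, max_eq_left (mul_nonneg hp0.le (hg0 z))]
  obtain ⟨G1, hG1, hA⟩ := approx_exists hN hα0 hα2 hγ0 hkc hk0 hkG
  choose ε u hε hA using hA
  have hzero : ∀ n (x : EN N), 1 ≤ ‖x‖ → u n x = 0 := by
    intro n x hx
    rw [(hA n).out x ((hA n).r1.trans_le hx), hB_out hα2 hx, mul_zero]
  have tη : Tendsto (fun n : ℕ => 1 / ((n : ℝ) + 1)) atTop (𝓝 0) :=
    tendsto_one_div_add_atTop_nhds_zero_nat
  have tr0 : Tendsto (fun n : ℕ => 1 / ((n : ℝ) + 2)) atTop (𝓝 0) := by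
    have := tη.comp (tendsto_add_atTop_nat 1)
    refine this.congr fun n => ?_
    simp only [Function.comp]; push_cast; ring
  have tr : Tendsto (fun n : ℕ => 1 - 1 / ((n : ℝ) + 2)) atTop (𝓝 1) := by
    simpa using tr0.const_sub 1
  have tε : Tendsto ε atTop (𝓝[>] 0) := by
    refine tendsto_nhdsWithin_iff.2 ⟨?_, Eventually.of_forall fun n => (hA n).ε0⟩
    exact squeeze_zero (fun n => (hA n).ε0.le) hε tr0
  have heq : ∀ τ, 0 < τ → ∀ ρ, 0 ≤ ρ → ρ < 1 → ∃ d, 0 < d ∧ ∃ n0, ∀ n, n0 ≤ n → ∀ x e : EN N,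
      ‖x‖ ≤ ρ → ‖e‖ ≤ d → u n (x + e) - u n x ≤ τ := by
    intro τ hτ ρ hρ0 hρ
    obtain ⟨d, η1, r1, hd, hη1, hr1, hh⟩ := equicont (N := N) hN hα0 hα2 hγ0 hγ1 hkc hk0 hkG
      hG1.le hτ hρ0 hρ
    obtain ⟨n0, hn0⟩ := eventually_atTop.1
      ((tη.eventually (ge_mem_nhds hη1)).and (tr.eventually (le_mem_nhds hr1)))
    exact ⟨d, hd, n0, fun n hn x e => hh _ _ _ _ (hA n) (hn0 n hn).1 (hn0 n hn).2 x e⟩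
  obtain ⟨ψ, hψ, v, hv⟩ := extraction (u := u) (b := fun x => G1 * hB N α x)
    (fun n => (hA n).nonneg) (fun n => (hA n).le) hzero heq
  have hv0 : ∀ x, 0 ≤ v x := fun x =>
    ge_of_tendsto' (hv x) fun n => (hA _).nonneg x
  have hvle : ∀ x, v x ≤ G1 * hB N α x := fun x => le_of_tendsto' (hv x) fun n => (hA _).le x
  have hvm : Measurable v :=
    measurable_of_tendsto_metrizable (fun n => (hA (ψ n)).meas) (tendsto_pi_nhds.2 hv)
  have hvout : ∀ x : EN N, ¬ ‖x‖ < 1 → v x = 0 := by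
    intro x hx
    have := hvle x
    rw [hB_out hα2 (not_lt.1 hx), mul_zero] at this
    exact le_antisymm this (hv0 x)
  have hvL : memLalpha N α v := by
    refine ((hB_integrable (N := N) hN hα0 hα2).const_mul G1).mono' ?_
      (Eventually.of_forall fun x => ?_)
    · exact (hvm.mul (by fun_prop)).aestronglyMeasurable
    · have h1 : (1 + ‖x‖) ^ (-((N : ℝ) + α)) ≤ 1 :=
        Real.rpow_le_one_of_one_le_of_nonpos (by linarith [norm_nonneg x])
          (by have : (0:ℝ) ≤ N := by positivity
              linarith)
      have h2 : 0 ≤ (1 + ‖x‖) ^ (-((N : ℝ) + α)) := by positivity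
      rw [Real.norm_eq_abs, abs_of_nonneg (mul_nonneg (hv0 x) h2)]
      exact (mul_le_of_le_one_right (hv0 x) h1).trans (hvle x)
  have hvc : ContinuousOn v (ball 0 1) := by
    refine fun x hx => ContinuousAt.continuousWithinAt ?_
    have hx1 : ‖x‖ < 1 := by simpa using hx
    rw [Metric.continuousAt_iff]
    intro τ hτ
    obtain ⟨d, hd, n0, hn0⟩ := heq (τ / 2) (by positivity) ((1 + ‖x‖) / 2)
      (by positivity) (by linarith)
    refine ⟨min d ((1 - ‖x‖) / 2), lt_min hd (by linarith), fun {y} hy => ?_⟩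
    have hy1 : ‖y - x‖ ≤ d := by
      rw [← dist_eq_norm]; exact (hy.trans_le (min_le_left _ _)).le
    have hy2 : ‖y - x‖ ≤ (1 - ‖x‖) / 2 := by
      rw [← dist_eq_norm]; exact (hy.trans_le (min_le_right _ _)).le
    have hy3 : ‖y‖ ≤ (1 + ‖x‖) / 2 := by
      have := norm_add_le (y - x) x
      rw [sub_add_cancel] at this
      linarith
    have e1 : v y - v x ≤ τ / 2 := by
      refine le_of_tendsto ((hv y).sub (hv x)) (eventually_atTop.2 ⟨n0, fun n hn => ?_⟩)
      have := hn0 (ψ n) (hn.trans (hψ.id_le n)) x (y - x) (by linarith) hy1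
      rwa [add_sub_cancel] at this
    have e2 : v x - v y ≤ τ / 2 := by
      refine le_of_tendsto ((hv x).sub (hv y)) (eventually_atTop.2 ⟨n0, fun n hn => ?_⟩)
      have := hn0 (ψ n) (hn.trans (hψ.id_le n)) y (x - y) hy3 (by rw [norm_sub_rev]; exact hy1)
      rwa [add_sub_cancel] at this
    rw [Real.dist_eq, abs_lt]
    constructor <;> linarith
  refine ⟨v, hv0, hvL, hvout, ⟨hv0, hvc, hvL, fun φ hφ hc hs _ => ?_⟩, fun z => ?_⟩
  · exact weak_form hN hα0 hα2 hγ0 hG1.le (fun n => hA (ψ n)) (tr.comp hψ.tendsto_atTop)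
      (tε.comp hψ.tendsto_atTop) hv hφ hc hs
  · have hz1 : ‖(z : EN N)‖ = 1 := by simpa using z.2
    -- main term
    have hm : Tendsto (fun x : EN N => k x * (1 + ‖x‖) ^ (α / 2 - 1))
        (𝓝[ball (0 : EN N) 1] (z : EN N)) (𝓝 (g z)) := by
      have hcont : Continuous fun x : EN N => k x * (1 + ‖x‖) ^ (α / 2 - 1) :=
        hkc.mul ((by fun_prop : Continuous fun x : EN N => 1 + ‖x‖).rpow_const
          fun x => Or.inl (by positivity))
      have := (hcont.tendsto (z : EN N)).mono_left (nhdsWithin_le_nhds (s := ball (0 : EN N) 1))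
      rw [hkz, hz1, hp] at this
      convert this using 2
      rw [mul_right_comm, one_add_one_eq_two, ← Real.rpow_add two_pos]
      simp
    rw [Metric.tendsto_nhds]
    intro τ hτ
    obtain ⟨d, η1, hd, hd1, hη1, hnb⟩ := near_bd (N := N) hN hα0 hα2 hγ0 hγ1 hkc hk0 hkG hG1.le
      (τ := τ / 2) (by positivity)
    obtain ⟨n0, hn0⟩ := eventually_atTop.1 (tη.eventually (ge_mem_nhds hη1))
    have hvb : ∀ x : EN N, 1 - d < ‖x‖ → |v x - k x * hB N α x| ≤ τ / 2 * hB N α x := by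
      intro x hx
      refine le_of_tendsto (((hv x).sub_const _).abs) (eventually_atTop.2 ⟨n0, fun n hn => ?_⟩)
      exact hnb _ _ _ _ (hA (ψ n)) (hn0 _ (hn.trans (hψ.id_le n))) x hx
    have hn1 : ∀ᶠ x : EN N in 𝓝[ball (0 : EN N) 1] (z : EN N), 1 - d < ‖x‖ := by
      have := (continuous_norm (E := EN N)).tendsto (z : EN N)
      rw [hz1] at this
      exact (this.mono_left nhdsWithin_le_nhds).eventually (lt_mem_nhds (by linarith))
    have hn2 : ∀ᶠ x : EN N in 𝓝[ball (0 : EN N) 1] (z : EN N), x ∈ ball (0 : EN N) 1 :=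
      eventually_mem_nhdsWithin
    filter_upwards [hn1, hn2, (Metric.tendsto_nhds.1 hm) (τ / 2) (by positivity)] with x a1 a2 a3
    have hx1 : ‖x‖ < 1 := by simpa using a2
    have hdl : 0 ≤ delta1 x ^ (1 - α / 2) := by
      refine Real.rpow_nonneg ?_ _
      unfold delta1; split_ifs; linarith
    have b1 := mul_le_mul_of_nonneg_left (hvb x a1) hdl
    have b2 := delta_hB (α := α) x hx1
    have b3 : delta1 x ^ (1 - α / 2) * (τ / 2 * hB N α x) ≤ τ / 2 := by
      have : (1 + ‖x‖) ^ (α / 2 - 1) ≤ 1 :=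
        Real.rpow_le_one_of_one_le_of_nonpos (by linarith [norm_nonneg x]) (by linarith)
      calc delta1 x ^ (1 - α / 2) * (τ / 2 * hB N α x)
          = τ / 2 * (delta1 x ^ (1 - α / 2) * hB N α x) := by ring
        _ ≤ _ := by rw [b2]; exact mul_le_of_le_one_right (by positivity) this
    have b4 : delta1 x ^ (1 - α / 2) * |v x - k x * hB N α x|
        = |delta1 x ^ (1 - α / 2) * v x - k x * (1 + ‖x‖) ^ (α / 2 - 1)| := by
      rw [← b2, ← abs_of_nonneg hdl, ← abs_mul, abs_of_nonneg hdl]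
      congr 1; ring
    rw [b4] at b1
    rw [Real.dist_eq] at a3 ⊢
    have b5 := abs_add_le (delta1 x ^ (1 - α / 2) * v x - k x * (1 + ‖x‖) ^ (α / 2 - 1))
      (k x * (1 + ‖x‖) ^ (α / 2 - 1) - g z)
    rw [sub_add_sub_cancel] at b5
    linarith

lemma sol_integrable {N : ℕ} {α : ℝ} (hα0 : 0 < α) {u : EN N → ℝ} (h0 : ∀ x, 0 ≤ u x)
    (hu : memLalpha N α u) (hout : ∀ x : EN N, ¬ ‖x‖ < 1 → u x = 0) : Integrable u := by
  have hN0 : (0:ℝ) ≤ N := by positivity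
  have h1 : AEStronglyMeasurable u := by
    have hm : Measurable fun y : EN N => (1 + ‖y‖) ^ ((N : ℝ) + α) := by fun_prop
    refine (hu.aestronglyMeasurable.mul hm.aestronglyMeasurable).congr
      (Eventually.of_forall fun y => ?_)
    show u y * (1 + ‖y‖) ^ (-((N : ℝ) + α)) * (1 + ‖y‖) ^ ((N : ℝ) + α) = u y
    rw [mul_assoc, ← Real.rpow_add (by positivity)]; simp
  refine (Integrable.const_mul hu (2 ^ ((N : ℝ) + α))).mono' h1 (Eventually.of_forall fun y => ?_)
  rw [Real.norm_eq_abs, abs_of_nonneg (h0 y)]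
  by_cases hy : ‖y‖ < 1
  · have h2 : 1 ≤ 2 ^ ((N : ℝ) + α) * (1 + ‖y‖) ^ (-((N : ℝ) + α)) := by
      rw [Real.rpow_neg (by positivity), ← div_eq_mul_inv, one_le_div (by positivity)]
      exact Real.rpow_le_rpow (by positivity) (by linarith) (by linarith)
    nlinarith [h0 y]
  · rw [hout y hy]; simp

lemma test_nonpos {N : ℕ} (hN : 3 ≤ N) {α ε : ℝ} (hα0 : 0 < α) (hα2 : α < 2) (hε : 0 < ε)
    {m φ : EN N → ℝ} (hm : Integrable m) (hφ : Continuous φ) {C : ℝ} (hC : ∀ x, ‖φ x‖ ≤ C)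
    {x1 : EN N} (hx1 : ∀ x, ∫ y, φ (y - x) * m y ≤ ∫ y, φ (y - x1) * m y) :
    ∫ y, m y * Leps N α ε (fun y => φ (y - x1)) y ≤ 0 := by
  have hcp := coeff_pos (N := N) hα0 hα2
  have hkJ := kJ_integrable (N := N) hN hα0 hα2 hε
  have hF : Integrable (fun p : EN N × EN N =>
      (m p.1 * kJ N α ε p.2) * (φ (p.1 + p.2 - x1) - φ (p.1 - x1))) (volume.prod volume) := by
    refine (hm.mul_prod hkJ).mul_bdd (c := C + C) ?_ (Eventually.of_forall fun p => ?_)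
    · exact (by fun_prop : Continuous _).aestronglyMeasurable
    · exact (norm_sub_le _ _).trans (add_le_add (hC _) (hC _))
  have e1 : ∫ y, m y * Leps N α ε (fun y => φ (y - x1)) y = fracLapCoeff N α *
      ∫ y, ∫ z, (m y * kJ N α ε z) * (φ (y + z - x1) - φ (y - x1)) := by
    rw [← integral_const_mul]
    refine integral_congr_ae (Eventually.of_forall fun y => ?_)
    show m y * Leps N α ε (fun y => φ (y - x1)) y = _
    unfold Leps
    rw [← mul_assoc, mul_comm (m y), mul_assoc, ← integral_const_mul]
    congr 2
    funext z; ring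
  rw [e1, integral_integral_swap hF]
  refine mul_nonpos_of_nonneg_of_nonpos hcp.le (integral_nonpos fun z => ?_)
  have i1 : ∀ x, Integrable fun y => φ (y - x) * m y := fun x =>
    hm.bdd_mul (c := C) (by exact (by fun_prop : Continuous _).aestronglyMeasurable)
      (Eventually.of_forall fun y => hC _)
  have e2 : ∫ y, (m y * kJ N α ε z) * (φ (y + z - x1) - φ (y - x1)) =
      kJ N α ε z * ((∫ y, φ (y - (x1 - z)) * m y) - ∫ y, φ (y - x1) * m y) := by
    rw [← integral_sub (i1 _) (i1 _), ← integral_const_mul]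
    refine integral_congr_ae (Eventually.of_forall fun y => ?_)
    show (m y * kJ N α ε z) * (φ (y + z - x1) - φ (y - x1)) =
      kJ N α ε z * (φ (y - (x1 - z)) * m y - φ (y - x1) * m y)
    rw [show y - (x1 - z) = y + z - x1 by abel]; ring
  show ∫ y, (m y * kJ N α ε z) * (φ (y + z - x1) - φ (y - x1)) ≤ 0
  rw [e2]
  exact mul_nonpos_of_nonneg_of_nonpos (kJ_nonneg z) (by linarith [hx1 (x1 - z)])

lemma test_lim {N : ℕ} (hN : 3 ≤ N) {α : ℝ} (hα0 : 0 < α) (hα2 : α < 2)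
    {u φ : EN N → ℝ} (hu : Integrable u) (hφ : ContDiff ℝ (⊤ : ℕ∞) φ) (hc : HasCompactSupport φ) :
    (∀ ε, 0 < ε → Integrable fun x => u x * Leps N α ε φ x) ∧
    Tendsto (fun ε => ∫ x, u x * Leps N α ε φ x) (𝓝[>] 0) (𝓝 (∫ x, u x * fracLap N α φ x)) := by
  obtain ⟨C, hC, hT⟩ := test_fracLap hN hα0 hα2 hφ hc
  have hb : ∀ ε, 0 < ε → ∀ x, ‖u x * Leps N α ε φ x‖ ≤ ‖u x‖ * C := fun ε hε x => by
    rw [norm_mul]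
    exact mul_le_mul_of_nonneg_left (hC ε hε x) (norm_nonneg _)
  have hmeas : ∀ ε, 0 < ε → AEStronglyMeasurable (fun x => u x * Leps N α ε φ x) := fun ε hε =>
    hu.aestronglyMeasurable.mul (Leps_measurable hN hα0 hα2 hε
      hφ.continuous.measurable).aestronglyMeasurable
  have hpos : ∀ᶠ ε : ℝ in 𝓝[>] 0, 0 < ε := eventually_mem_nhdsWithin
  refine ⟨fun ε hε => (hu.norm.mul_const C).mono' (hmeas ε hε) (Eventually.of_forall (hb ε hε)), ?_⟩
  refine tendsto_integral_filter_of_dominated_convergence (fun x => ‖u x‖ * C) ?_ ?_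
    (hu.norm.mul_const C) ?_
  · filter_upwards [hpos] with ε hε using hmeas ε hε
  · filter_upwards [hpos] with ε hε using Eventually.of_forall (hb ε hε)
  · exact Eventually.of_forall fun x => (hT x).const_mul _

lemma barrier_test {N : ℕ} (hN : 3 ≤ N) {α : ℝ} (hα0 : 0 < α) (hα2 : α < 2)
    {φ : EN N → ℝ} (hφ : Continuous φ) (hc : HasCompactSupport φ) (hφ0 : ∀ x, 0 ≤ φ x) {ρ : ℝ}
    (hρ0 : 0 ≤ ρ) (hρ : ρ < 1) (hs : ∀ x, ρ < ‖x‖ → φ x = 0) :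
    ∀ᶠ ε in 𝓝[>] (0 : ℝ), ∫ x, (hB N α x + WB N x) * Leps N α ε φ x ≤
      -(fracLapCoeff N α * cOut N α / 2) * ∫ x, φ x := by
  have hcp := coeff_pos (N := N) hα0 hα2
  have hc1 := cOut_pos (N := N) (α := α)
  set q := fracLapCoeff N α * cOut N α with hq
  have hq0 : 0 < q := mul_pos hcp hc1
  have hφi : Integrable φ := hφ.integrable_of_hasCompactSupport hc
  have hhi := hB_integrable (N := N) hN hα0 hα2
  have hWi := WB_integrable (N := N)
  have hSi : Integrable (fun x => hB N α x + WB N x) := hhi.add hWi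
  obtain ⟨M, hM⟩ := hc.exists_bound_of_continuous hφ
  obtain ⟨C, ε0, hC, hε0, hh⟩ := h_harm (N := N) hN hα0 hα2 hρ0 hρ
  have ht : Tendsto (fun ε : ℝ => C * ε ^ (2 - α)) (𝓝[>] 0) (𝓝 0) := by
    have h1 : Tendsto (fun ε : ℝ => ε ^ (2 - α)) (𝓝[>] 0) (𝓝 (0 ^ (2 - α))) :=
      ((Real.continuousAt_rpow_const 0 (2 - α) (Or.inr (by linarith))).tendsto).mono_left
        nhdsWithin_le_nhds
    rw [Real.zero_rpow (by linarith)] at h1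
    simpa using h1.const_mul C
  have h1 := ht.eventually (ge_mem_nhds (show (0 : ℝ) < q / 2 by positivity))
  have h2 : ∀ᶠ ε : ℝ in 𝓝[>] 0, ε ≤ ε0 :=
    (ge_mem_nhds hε0).filter_mono nhdsWithin_le_nhds
  have h3 : ∀ᶠ ε : ℝ in 𝓝[>] 0, ε ≤ 1 - ρ :=
    (ge_mem_nhds (show (0 : ℝ) < 1 - ρ by linarith)).filter_mono nhdsWithin_le_nhds
  have h4 : ∀ᶠ ε : ℝ in 𝓝[>] 0, 0 < ε := eventually_mem_nhdsWithin
  filter_upwards [h1, h2, h3, h4] with ε a1 a2 a3 a4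
  rw [Leps_pairing hN hα0 hα2 a4 hSi hφi
    (hSi.mul_bdd (c := M) hφ.aestronglyMeasurable (Eventually.of_forall hM)), ← integral_const_mul]
  have hkJ := kJ_integrable (N := N) hN hα0 hα2 a4
  have hLW : ∀ x, |Leps N α ε (WB N) x| ≤ fracLapCoeff N α * ∫ z, kJ N α ε z := by
    intro x
    unfold Leps
    rw [abs_mul, abs_of_pos hcp]
    refine mul_le_mul_of_nonneg_left ?_ hcp.le
    rw [← Real.norm_eq_abs]
    refine (norm_integral_le_integral_norm
      (fun z => kJ N α ε z * (WB N (x + z) - WB N x))).trans ?_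
    refine integral_mono_of_nonneg (Eventually.of_forall fun z => norm_nonneg _) hkJ
      (Eventually.of_forall fun z => ?_)
    show ‖_‖ ≤ kJ N α ε z
    rw [norm_mul, Real.norm_eq_abs, abs_of_nonneg (kJ_nonneg z)]
    refine mul_le_of_le_one_right (kJ_nonneg z) ?_
    rw [Real.norm_eq_abs, abs_le]
    constructor <;>
      linarith [WB_nonneg x, WB_nonneg (x + z), WB_le_one x, WB_le_one (x + z)]
  have hLS : ∀ x, Leps N α ε (fun x => hB N α x + WB N x) x =
      Leps N α ε (hB N α) x + Leps N α ε (WB N) x := fun x =>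
    Leps_add hN hα0 hα2 a4 hhi hWi x
  refine integral_mono ?_ (hφi.const_mul _) fun x => ?_
  · refine (hφi.mul_const (q / 2 + fracLapCoeff N α * ∫ z, kJ N α ε z)).mono' ?_
      (Eventually.of_forall fun x => ?_)
    · exact (hφ.measurable.mul (Leps_measurable hN hα0 hα2 a4
        (hB_measurable.add WB_measurable))).aestronglyMeasurable
    · rw [norm_mul, Real.norm_eq_abs, abs_of_nonneg (hφ0 x)]
      by_cases hx : ‖x‖ ≤ ρ
      · refine mul_le_mul_of_nonneg_left ?_ (hφ0 x)
        rw [hLS]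
        exact (norm_add_le _ _).trans (add_le_add (((hh ε a4 a2 x hx).1).trans a1) (hLW x))
      · simp [hs x (not_le.1 hx)]
  · show φ x * _ ≤ -(q / 2) * φ x
    by_cases hx : ‖x‖ ≤ ρ
    · rw [mul_comm]
      refine mul_le_mul_of_nonneg_right ?_ (hφ0 x)
      rw [hLS]
      have b1 := Leps_WB (N := N) hN hα0 hα2 (x := x) (by linarith) a4 (by linarith)
      have b2 := (abs_le.1 ((hh ε a4 a2 x hx).1.trans a1)).2
      linarith
    · simp [hs x (not_le.1 hx)]

lemma rpow_test_integrable {N : ℕ} {γ : ℝ} (hγ : 0 < γ) {u φ : EN N → ℝ}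
    (hu : ContinuousOn u (ball 0 1)) (hφ : Continuous φ) (hc : HasCompactSupport φ)
    (hs : tsupport φ ⊆ ball 0 1) : Integrable fun x => u x ^ γ * φ x := by
  have h1 : ContinuousOn (fun x => u x ^ γ * φ x) (tsupport φ) :=
    ((hu.mono hs).rpow_const fun x _ => Or.inr hγ.le).mul hφ.continuousOn
  refine (integrableOn_iff_integrable_of_support_subset ?_).1
    (h1.integrableOn_compact hc.isCompact)
  intro x hx
  refine subset_tsupport _ (Function.mem_support.2 fun h => hx ?_)
  simp [h]

lemma sol_le {N : ℕ} (hN : 3 ≤ N) {α γ : ℝ} (hα0 : 0 < α) (hα2 : α < 2) (hγ : 0 < γ)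
    {g : Metric.sphere (0 : EN N) 1 → ℝ} {u v : EN N → ℝ} (hu : IsSolutionPg N α γ g u)
    (hv : IsSolutionPg N α γ g v) {τ : ℝ} (hτ : 0 < τ) (x0 : EN N) :
    u x0 - v x0 ≤ τ * (hB N α x0 + WB N x0) := by
  obtain ⟨hu0, huL, huo, ⟨-, huc, -, hue⟩, hub⟩ := hu
  obtain ⟨hv0, hvL, hvo, ⟨-, hvc, -, hve⟩, hvb⟩ := hv
  have hui := sol_integrable hα0 hu0 huL huo
  have hvi := sol_integrable hα0 hv0 hvL hvo
  have hhi := hB_integrable (N := N) hN hα0 hα2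
  have hWi := WB_integrable (N := N)
  have hcp := coeff_pos (N := N) hα0 hα2
  have hc1 := cOut_pos (N := N) (α := α)
  have hSi : Integrable (fun x => hB N α x + WB N x) := hhi.add hWi
  by_contra hcon
  push Not at hcon
  set m : EN N → ℝ := fun x => u x - v x - τ * (hB N α x + WB N x) with hm
  have hmi : Integrable m := (hui.sub hvi).sub (hSi.const_mul τ)
  have hmout : ∀ x : EN N, 1 ≤ ‖x‖ → m x = 0 := by
    intro x hx
    simp [hm, huo x (not_lt.2 hx), hvo x (not_lt.2 hx), hB_out hα2 hx, WB_out hx]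
  have hWc : ContinuousOn (WB N) (ball 0 1) := by
    refine (continuousOn_const (c := (1 : ℝ))).congr fun x hx => WB_in (by simpa using hx)
  have hmc : ContinuousOn m (ball 0 1) :=
    (huc.sub hvc).sub (continuousOn_const.mul (hB_continuousOn.add hWc))
  set M := m x0 with hM
  have hM0 : 0 < M := by simp only [hM, hm]; linarith
  -- boundary behaviour
  have hbd : ∀ᶠ x in 𝓝ˢ (sphere (0 : EN N) 1), m x ≤ 0 := by
    rw [eventually_nhdsSet_iff_forall]
    intro z hz
    have t1 := (hub ⟨z, hz⟩).sub (hvb ⟨z, hz⟩)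
    rw [sub_self] at t1
    have t2 := t1.eventually (gt_mem_nhds (show (0 : ℝ) < τ * 2 ^ (α / 2 - 1) by positivity))
    have t3 := eventually_nhdsWithin_iff.1 t2
    filter_upwards [t3] with x hx
    by_cases h1 : ‖x‖ < 1
    · have h2 := hx (by simpa using h1)
      have h3 := delta_hB (α := α) x h1
      have hdl : 0 < delta1 x ^ (1 - α / 2) := by
        refine Real.rpow_pos_of_pos ?_ _
        unfold delta1; rw [if_pos h1]; linarith
      have h4 : (2 : ℝ) ^ (α / 2 - 1) ≤ (1 + ‖x‖) ^ (α / 2 - 1) :=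
        Real.rpow_le_rpow_of_nonpos (by positivity) (by linarith) (by linarith)
      have h5 := mul_le_mul_of_nonneg_left h4 hτ.le
      rw [← h3] at h5
      have h6 : delta1 x ^ (1 - α / 2) * (u x - v x - τ * hB N α x) < 0 := by
        linarith
      have h7 : u x - v x - τ * hB N α x < 0 := by
        by_contra h
        exact absurd h6 (not_lt.2 (mul_nonneg hdl.le (not_lt.1 h)))
      have h8 := mul_nonneg hτ.le (WB_nonneg x)
      simp only [hm]
      linarith
    · exact (hmout x (not_lt.1 h1)).le
  obtain ⟨U, hU, hSU, hUm⟩ := eventually_nhdsSet_iff_exists.1 hbd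
  set K := closedBall (0 : EN N) 1 \ U with hK
  have hKc : IsCompact K := (isCompact_closedBall _ _).diff hU
  have hKb : K ⊆ ball 0 1 := by
    intro x hx
    have h1 : ‖x‖ ≤ 1 := by simpa using hx.1
    rcases h1.lt_or_eq with h | h
    · simpa using h
    · exact absurd (hSU (by simpa using h)) hx.2
  have hmK : ∀ x, 0 < m x → x ∈ K := by
    intro x hx
    refine ⟨?_, fun h => absurd (hUm x h) (not_le.2 hx)⟩
    by_contra h
    have : 1 < ‖x‖ := by simpa using h
    rw [hmout x this.le] at hx
    exact lt_irrefl _ hx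
  set A := K ∩ m ⁻¹' (Ici (M / 2)) with hA
  have hAc : IsCompact A := by
    refine hKc.of_isClosed_subset ?_ inter_subset_left
    exact (hmc.mono hKb).preimage_isClosed_of_isClosed hKc.isClosed isClosed_Ici
  set O := ball (0 : EN N) 1 ∩ m ⁻¹' (Ioi 0) with hO
  have hOo : IsOpen O := hmc.isOpen_inter_preimage isOpen_ball isOpen_Ioi
  have hAO : A ⊆ O := fun x hx => ⟨hKb hx.1, by
    have := hx.2
    simp only [mem_preimage, mem_Ici] at this
    simp only [mem_preimage, mem_Ioi]; linarith⟩
  obtain ⟨δ, hδ, hδO⟩ := hAc.exists_cthickening_subset_open hOo hAO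
  have hx0b : x0 ∈ ball (0 : EN N) 1 := hKb (hmK x0 hM0)
  have hx0c : ContinuousAt m x0 := hmc.continuousAt (isOpen_ball.mem_nhds hx0b)
  obtain ⟨ρ0, hρ0, hρm⟩ := Metric.eventually_nhds_iff.1
    (hx0c.eventually (lt_mem_nhds (show 3 * M / 4 < m x0 by linarith)))
  set ρ := min (δ / 2) (min ρ0 1) with hρ
  have hρp : 0 < ρ := by positivity
  have hρ1 : ρ ≤ δ / 2 := min_le_left _ _
  have hρ2 : ρ ≤ ρ0 := (min_le_right _ _).trans (min_le_left _ _)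
  have hρ3 : ρ ≤ 1 := (min_le_right _ _).trans (min_le_right _ _)
  let bmp : ContDiffBump (0 : EN N) := ⟨ρ / 2, ρ, by positivity, by linarith⟩
  set ph : EN N → ℝ := bmp.normed volume with hph
  have hphc : Continuous ph := bmp.continuous_normed
  have hphs : ContDiff ℝ (⊤ : ℕ∞) ph := bmp.contDiff_normed
  have hph0 : ∀ x, 0 ≤ ph x := fun x => bmp.nonneg_normed x
  have hphI : ∫ x, ph x = 1 := bmp.integral_normed
  have hphS : ∀ x, ph x ≠ 0 → ‖x‖ < ρ := by
    intro x hx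
    have : x ∈ Function.support ph := hx
    rw [hph, bmp.support_normed_eq] at this
    simpa using this
  have hphcs : HasCompactSupport ph := bmp.hasCompactSupport_normed
  obtain ⟨C, hC⟩ := hphcs.exists_bound_of_continuous hphc
  have hphi : Integrable ph := hphc.integrable_of_hasCompactSupport hphcs
  set Q : EN N → ℝ := fun x => ∫ y, ph (y - x) * m y with hQ
  have iQ : ∀ x, Integrable fun y => ph (y - x) * m y := fun x =>
    hmi.bdd_mul (c := C) (by exact (by fun_prop : Continuous _).aestronglyMeasurable)
      (Eventually.of_forall fun y => hC _)
  have iP : ∀ x, Integrable fun y => ph (y - x) := fun x => hphi.comp_sub_right x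
  have eP : ∀ x, ∫ y, ph (y - x) = 1 := fun x => by
    rw [integral_sub_right_eq_self ph x]; exact hphI
  have hQc : Continuous Q := by
    refine continuous_of_dominated (bound := fun y => C * ‖m y‖) (fun x => (iQ x).aestronglyMeasurable)
      (fun x => Eventually.of_forall fun y => ?_) (hmi.norm.const_mul C)
      (Eventually.of_forall fun y => by fun_prop)
    rw [norm_mul]
    exact mul_le_mul_of_nonneg_right (hC _) (norm_nonneg _)
  have hQ0 : 3 * M / 4 ≤ Q x0 := by
    have h1 : ∫ y, ph (y - x0) * (3 * M / 4) = 3 * M / 4 := by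
      rw [integral_mul_const, eP, one_mul]
    rw [← h1]
    refine integral_mono ((iP x0).mul_const _) (iQ x0) fun y => ?_
    show ph (y - x0) * (3 * M / 4) ≤ ph (y - x0) * m y
    by_cases h : ph (y - x0) = 0
    · simp [h]
    · refine mul_le_mul_of_nonneg_left ?_ (hph0 _)
      refine (hρm ?_).le
      rw [dist_eq_norm]
      exact (hphS _ h).trans_le hρ2
  have hQout : ∀ x : EN N, 2 < ‖x‖ → Q x = 0 := by
    intro x hx
    simp only [hQ]
    rw [← integral_zero (EN N) ℝ]
    refine integral_congr_ae (Eventually.of_forall fun y => ?_)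
    show ph (y - x) * m y = 0
    by_cases h : ph (y - x) = 0
    · simp [h]
    · have h1 := hphS _ h
      have h2 := norm_sub_norm_le x y
      rw [norm_sub_rev] at h2
      rw [hmout y (by linarith), mul_zero]
  have hx0n : ‖x0‖ < 1 := by simpa using hx0b
  obtain ⟨x1, hx1, hmax⟩ := (isCompact_closedBall (0 : EN N) 2).exists_isMaxOn
    ⟨x0, by simp; linarith⟩ hQc.continuousOn
  have hQ1 : 3 * M / 4 ≤ Q x1 := hQ0.trans (hmax (by simp; linarith))
  have hQmax : ∀ x, Q x ≤ Q x1 := by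
    intro x
    by_cases hx : ‖x‖ ≤ 2
    · exact hmax (by simpa using hx)
    · rw [hQout x (not_le.1 hx)]; linarith
  obtain ⟨y0, hy0, hy1⟩ : ∃ y, ‖y - x1‖ < ρ ∧ M / 2 ≤ m y := by
    by_contra hno
    push Not at hno
    have h1 : ∫ y, ph (y - x1) * (M / 2) = M / 2 := by
      rw [integral_mul_const, eP, one_mul]
    have h2 : Q x1 ≤ ∫ y, ph (y - x1) * (M / 2) := by
      refine integral_mono (iQ x1) ((iP x1).mul_const _) fun y => ?_
      show ph (y - x1) * m y ≤ ph (y - x1) * (M / 2)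
      by_cases h : ph (y - x1) = 0
      · simp [h]
      · exact mul_le_mul_of_nonneg_left (hno y (hphS _ h)).le (hph0 _)
    linarith
  have hy0A : y0 ∈ A := ⟨hmK y0 (by linarith), hy1⟩
  have hcb : closedBall x1 ρ ⊆ O := by
    intro x hx
    refine hδO (mem_cthickening_of_dist_le x y0 δ A hy0A ?_)
    have h1 : dist x x1 ≤ ρ := hx
    have h2 : dist y0 x1 < ρ := by rw [dist_eq_norm]; exact hy0
    have := dist_triangle_right x y0 x1
    linarith
  -- the test function
  set φ : EN N → ℝ := fun y => ph (y - x1) with hφ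
  have hφs : ContDiff ℝ (⊤ : ℕ∞) φ := hphs.comp (contDiff_id.sub contDiff_const)
  have hφsup : Function.support φ ⊆ closedBall x1 ρ := by
    intro y hy
    rw [mem_closedBall, dist_eq_norm]
    exact (hphS _ hy).le
  have hφt : tsupport φ ⊆ closedBall x1 ρ := closure_minimal hφsup isClosed_closedBall
  have hφc : HasCompactSupport φ := (isCompact_closedBall x1 ρ).of_isClosed_subset
    (isClosed_tsupport φ) hφt
  have hφb : tsupport φ ⊆ ball 0 1 := hφt.trans (hcb.trans inter_subset_left)
  have hφ0 : ∀ y, 0 ≤ φ y := fun y => hph0 _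
  obtain ⟨s, hs0, hs1, hss⟩ : ∃ s, 0 ≤ s ∧ s < 1 ∧ ∀ x, s < ‖x‖ → φ x = 0 := by
    have hne : (closedBall x1 ρ).Nonempty := ⟨x1, mem_closedBall_self hρp.le⟩
    obtain ⟨y, hy, hym⟩ := (isCompact_closedBall x1 ρ).exists_isMaxOn hne
      (continuous_norm.continuousOn)
    refine ⟨‖y‖, norm_nonneg _, by simpa using (hcb hy).1, fun x hx => ?_⟩
    by_contra h
    have : ‖x‖ ≤ ‖y‖ := hym (hφsup h)
    linarith
  obtain ⟨iu, tu⟩ := test_lim hN hα0 hα2 hui hφs hφc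
  obtain ⟨iv, tv⟩ := test_lim hN hα0 hα2 hvi hφs hφc
  obtain ⟨iS, -⟩ := test_lim hN hα0 hα2 hSi hφs hφc
  rw [hue φ hφs hφc hφb hφ0] at tu
  rw [hve φ hφs hφc hφb hφ0] at tv
  have hbt := barrier_test hN hα0 hα2 hφs.continuous hφc hφ0 hs0 hs1 hss
  have hφ1 : ∫ x, φ x = 1 := eP x1
  rw [hφ1, mul_one] at hbt
  have hpos : ∀ᶠ ε : ℝ in 𝓝[>] 0, 0 < ε := eventually_mem_nhdsWithin
  have hfin : (∫ x, u x ^ γ * φ x) - ∫ x, v x ^ γ * φ x ≤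
      τ * -(fracLapCoeff N α * cOut N α / 2) := by
    refine le_of_tendsto (tu.sub tv) ?_
    filter_upwards [hpos, hbt] with ε hε hb
    have h1 := test_nonpos hN hα0 hα2 hε hmi hphc hC (x1 := x1) hQmax
    have h2 : ∫ y, m y * Leps N α ε φ y = (∫ x, u x * Leps N α ε φ x)
        - (∫ x, v x * Leps N α ε φ x) - τ * ∫ x, (hB N α x + WB N x) * Leps N α ε φ x := by
      have iuv : Integrable fun x => u x * Leps N α ε φ x - v x * Leps N α ε φ x :=
        (iu ε hε).sub (iv ε hε)
      rw [← integral_const_mul, ← integral_sub (iu ε hε) (iv ε hε),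
        ← integral_sub iuv ((iS ε hε).const_mul τ)]
      refine integral_congr_ae (Eventually.of_forall fun y => ?_)
      simp only [hm]; ring
    rw [h2] at h1
    have h3 := mul_le_mul_of_nonneg_left hb hτ.le
    linarith
  have hge : ∫ x, v x ^ γ * φ x ≤ ∫ x, u x ^ γ * φ x := by
    refine integral_mono (rpow_test_integrable hγ hvc hφs.continuous hφc hφb)
      (rpow_test_integrable hγ huc hφs.continuous hφc hφb) fun x => ?_
    show v x ^ γ * φ x ≤ u x ^ γ * φ x
    by_cases h : φ x = 0
    · simp [h]
    · refine mul_le_mul_of_nonneg_right (Real.rpow_le_rpow (hv0 x) ?_ hγ.le) (hφ0 x)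
      have h1 : 0 < m x := (hcb (hφsup h)).2
      have h2 := mul_nonneg hτ.le (add_nonneg (hB_nonneg (α := α) x) (WB_nonneg x))
      simp only [hm] at h1
      linarith
  have hq : 0 < τ * (fracLapCoeff N α * cOut N α / 2) := by positivity
  linarith

lemma sol_le' {N : ℕ} (hN : 3 ≤ N) {α γ : ℝ} (hα0 : 0 < α) (hα2 : α < 2) (hγ : 0 < γ)
    {g : Metric.sphere (0 : EN N) 1 → ℝ} {u v : EN N → ℝ} (hu : IsSolutionPg N α γ g u)
    (hv : IsSolutionPg N α γ g v) (x : EN N) : u x ≤ v x := by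
  have h0 : 0 ≤ hB N α x + WB N x := add_nonneg (hB_nonneg x) (WB_nonneg x)
  refine le_of_forall_pos_le_add fun τ hτ => ?_
  have := sol_le hN hα0 hα2 hγ hu hv (τ := τ / (hB N α x + WB N x + 1)) (by positivity) x
  rw [div_mul_eq_mul_div] at this
  have h1 : τ * (hB N α x + WB N x) / (hB N α x + WB N x + 1) ≤ τ := by
    rw [div_le_iff₀ (by positivity)]; nlinarith
  linarith

/-- existence and uniqueness for `(P_g)` when `0 < γ < (2+α)/(2-α)`. -/
theorem statement_9 (N : ℕ) (hN : 3 ≤ N) (α : ℝ) (hα0 : 0 < α) (hα2 : α < 2)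
    (γ : ℝ) (hγ0 : 0 < γ) (hγ1 : γ < (2 + α) / (2 - α))
    (g : Metric.sphere (0 : EN N) 1 → ℝ) (hgc : Continuous g) (hg0 : ∀ z, 0 ≤ g z)
    (hgne : ∃ z, g z ≠ 0) :
    ∃! u : EN N → ℝ, IsSolutionPg N α γ g u := by
  obtain ⟨u, hu⟩ := existence N hN α hα0 hα2 γ hγ0 hγ1 g hgc hg0
  exact ⟨u, hu, fun v hv => funext fun x => le_antisymm
    (sol_le' hN hα0 hα2 hγ0 hv hu x) (sol_le' hN hα0 hα2 hγ0 hu hv x)⟩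

end
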